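/- arXiv:2504.07201 — 4 statements merged into one kernel-verified Lean document; each statement's English description precedes it below -/
import Mathlib

section
/- Let N ≥ 2 and let q ∈ ℂ be a primitive 4N-th root of unity. Then for every n with 2 ≤ n < N the Hecke–Clifford algebra G_n(q) is a semisimple ring, and its even subalgebra G_n[0] is a semisimple ring. -/
noncomputable section

/-- Generator index type for the Hecke–Clifford algebra `G_n(q)`:
`Sum.inl i` is the braid-type generator `t_{i+1}` (the paper's 1-indexed `t_1, …, t_{n-1}`),
`Sum.inr j` is the Clifford generator `v_{j+1}` (the paper's 1-indexed `v_1, …, v_n`). -/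
abbrev HCgen (n : ℕ) : Type := Fin (n - 1) ⊕ Fin n

/-- The generator `t_i` in the free algebra (0-indexed). -/
def tF (n : ℕ) (i : Fin (n - 1)) : FreeAlgebra ℂ (HCgen n) :=
  FreeAlgebra.ι ℂ (Sum.inl i)

/-- The generator `v_j` in the free algebra (0-indexed). -/
def vF (n : ℕ) (j : Fin n) : FreeAlgebra ℂ (HCgen n) :=
  FreeAlgebra.ι ℂ (Sum.inr j)

/-- The defining relations of the Hecke–Clifford algebra `G_n(q)`. -/
inductive HCrel (q : ℂ) (n : ℕ) :
    FreeAlgebra ℂ (HCgen n) → FreeAlgebra ℂ (HCgen n) → Prop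
  | braid (i j : Fin (n - 1)) (h : (j : ℕ) = (i : ℕ) + 1) :
      HCrel q n (tF n i * tF n j * tF n i) (tF n j * tF n i * tF n j)
  | tcomm (i j : Fin (n - 1)) (h : (i : ℕ) + 2 ≤ (j : ℕ) ∨ (j : ℕ) + 2 ≤ (i : ℕ)) :
      HCrel q n (tF n i * tF n j) (tF n j * tF n i)
  | quad (i : Fin (n - 1)) :
      HCrel q n (tF n i * tF n i) (1 + (q - q⁻¹) • tF n i)
  | vsq (j : Fin n) :
      HCrel q n (vF n j * vF n j) 1
  | vanti (j k : Fin n) (h : j ≠ k) :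
      HCrel q n (vF n j * vF n k) (-(vF n k * vF n j))
  | tv₁ (i : Fin (n - 1)) (j j' : Fin n) (hj : (j : ℕ) = (i : ℕ))
      (hj' : (j' : ℕ) = (i : ℕ) + 1) :
      HCrel q n (tF n i * vF n j) (vF n j' * tF n i)
  | tv₂ (i : Fin (n - 1)) (j j' : Fin n) (hj : (j : ℕ) = (i : ℕ))
      (hj' : (j' : ℕ) = (i : ℕ) + 1) :
      HCrel q n (tF n i * vF n j') (vF n j * tF n i - (q - q⁻¹) • (vF n j - vF n j'))
  | tvcomm (i : Fin (n - 1)) (l : Fin n) (h : (l : ℕ) ≠ (i : ℕ) ∧ (l : ℕ) ≠ (i : ℕ) + 1) :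
      HCrel q n (tF n i * vF n l) (vF n l * tF n i)

/-- The Hecke–Clifford algebra `G_n(q)`. -/
abbrev HeckeClifford (q : ℂ) (n : ℕ) := RingQuot (HCrel q n)

/-- The generator `t_i` of `G_n(q)` (0-indexed: `i = 0, …, n-2`). -/
def HCt (q : ℂ) (n : ℕ) (i : Fin (n - 1)) : HeckeClifford q n :=
  RingQuot.mkAlgHom ℂ (HCrel q n) (tF n i)

/-- The generator `v_j` of `G_n(q)` (0-indexed: `j = 0, …, n-1`). -/
def HCv (q : ℂ) (n : ℕ) (j : Fin n) : HeckeClifford q n :=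
  RingQuot.mkAlgHom ℂ (HCrel q n) (vF n j)

/-- The element `e_i := v_i v_{i+1}` of `G_n(q)` (0-indexed: `i = 0, …, n-2`). -/
def HCe (q : ℂ) (n : ℕ) (i : Fin (n - 1)) : HeckeClifford q n :=
  HCv q n ⟨(i : ℕ), by have := i.2; omega⟩ * HCv q n ⟨(i : ℕ) + 1, by have := i.2; omega⟩

/-- The even subalgebra `G_n[0]` of `G_n(q)`, generated by the `t_i` and the `e_j`. -/
def HCeven (q : ℂ) (n : ℕ) : Subalgebra ℂ (HeckeClifford q n) :=
  Algebra.adjoin ℂ (Set.range (HCt q n) ∪ Set.range (HCe q n))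

end

theorem mul_mul_of_mul_eq {R : Type*} [Semigroup R] {x y z : R} (h : x * y = z) (w : R) :
    x * (y * w) = z * w := by rw [← mul_assoc, h]

/-- Relations between a braid generator `t`, two Clifford generators `v`, `w`, and an invertible
element `a` with inverse `a'`. -/
structure RankTwo {R : Type*} [Ring R] [Algebra ℂ R] (h : ℂ) (t v w a a' : R) : Prop where
  tt : t * t = 1 + h • t
  vv : v * v = 1
  ww : w * w = 1
  wv : w * v = -(v * w)
  tv : t * v = w * t
  tw : t * w = v * t - h • (v - w)
  aa' : a * a' = 1
  a'a : a' * a = 1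
  av : a * v = v * a'
  a'v : a' * v = v * a
  aw : a * w = w * a
  a'w : a' * w = w * a'

namespace RankTwo

variable {R : Type*} [Ring R] [Algebra ℂ R] {h : ℂ} {t v w a a' : R}

/-- The next Jucys–Murphy element. -/
def next (h : ℂ) (t v w a : R) : R := (t + h • (v * w)) * a * t

/-- The inverse of the next Jucys–Murphy element. -/
def nextInv (h : ℂ) (t v w a' : R) : R := (t - h • 1) * a' * (t + h • (v * w) - h • 1)

section
variable (r : RankTwo h t v w a a')
include r

theorem relations :
    (next h t v w a * nextInv h t v w a' = 1 ∧ nextInv h t v w a' * next h t v w a = 1) ∧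
    (next h t v w a * v = v * next h t v w a ∧ nextInv h t v w a' * v = v * nextInv h t v w a') ∧
    (next h t v w a * w = w * nextInv h t v w a' ∧ nextInv h t v w a' * w = w * next h t v w a) ∧
    (t * a = next h t v w a * t - h • next h t v w a - h • (a' * (v * w))) ∧
    (t * a' = nextInv h t v w a' * t + h • (nextInv h t v w a' * (v * w)) + h • a') ∧
    (t * next h t v w a = a * t + h • next h t v w a - h • (nextInv h t v w a' * (v * w))) ∧
    (t * nextInv h t v w a' = a' * t + h • (a' * (v * w)) - h • a') := by
  refine ⟨⟨?_, ?_⟩, ⟨?_, ?_⟩, ⟨?_, ?_⟩, ?_, ?_, ?_, ?_⟩ <;>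
  · simp only [next, nextInv, mul_assoc, mul_add, add_mul, mul_sub, sub_mul, smul_add, smul_sub,
      smul_mul_assoc, mul_smul_comm, smul_smul, mul_one, one_mul, mul_neg, neg_mul, smul_neg,
      r.tt, r.vv, r.ww, r.wv, r.tv, r.tw, r.aa', r.a'a, r.av, r.a'v, r.aw, r.a'w,
      mul_mul_of_mul_eq r.tt, mul_mul_of_mul_eq r.vv, mul_mul_of_mul_eq r.ww,
      mul_mul_of_mul_eq r.wv, mul_mul_of_mul_eq r.tv, mul_mul_of_mul_eq r.tw,
      mul_mul_of_mul_eq r.aa', mul_mul_of_mul_eq r.a'a, mul_mul_of_mul_eq r.av,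
      mul_mul_of_mul_eq r.a'v, mul_mul_of_mul_eq r.aw, mul_mul_of_mul_eq r.a'w]
    module
end
end RankTwo

/-- Two consecutive Jucys–Murphy elements `a`, `b` with inverses `a'`, `b'`. -/
structure JMPair {R : Type*} [Ring R] [Algebra ℂ R] (h : ℂ) (t v w a a' b b' : R) : Prop
    extends RankTwo h t v w a a' where
  bb' : b * b' = 1
  b'b : b' * b = 1
  bv : b * v = v * b
  b'v : b' * v = v * b'
  bw : b * w = w * b'
  b'w : b' * w = w * b
  ta : t * a = b * t - h • b - h • (a' * (v * w))
  ta' : t * a' = b' * t + h • (b' * (v * w)) + h • a'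
  tb : t * b = a * t + h • b - h • (b' * (v * w))
  tb' : t * b' = a' * t + h • (a' * (v * w)) - h • a'
  ba : b * a = a * b
  ba' : b * a' = a' * b
  b'a : b' * a = a * b'
  b'a' : b' * a' = a' * b'

/-- The correction term in the commutation of `t` with `a + a'`. -/
def psi {R : Type*} [Ring R] (v w a' b b' : R) : R := (b - a') - (b' - a') * (v * w)

/-- The intertwining element. -/
def phi {R : Type*} [Ring R] [Algebra ℂ R] (h : ℂ) (t v w a a' b b' : R) : R :=
  (a + a' - (b + b')) * t + h • psi v w a' b b'

namespace JMPair

variable {R : Type*} [Ring R] [Algebra ℂ R] {h : ℂ} {t v w a a' b b' : R}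
  (r : JMPair h t v w a a' b b')
include r

theorem psi_relations :
    psi v w a' b b' * (a + a') = (a + a') * psi v w a' b b' ∧
    psi v w a' b b' * (b + b') = (b + b') * psi v w a' b b' ∧
    t * (a + a') = (b + b') * t - h • psi v w a' b b' ∧
    t * (b + b') = (a + a') * t + h • psi v w a' b b' ∧
    phi h t v w a a' b b' = t * ((b + b') - (a + a')) - h • psi v w a' b b' := by
  have va : v * a = a' * v := r.a'v.symm
  have va' : v * a' = a * v := r.av.symm
  have wa : w * a = a * w := r.aw.symm
  have wa' : w * a' = a' * w := r.a'w.symm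
  have vb : v * b = b * v := r.bv.symm
  have vb' : v * b' = b' * v := r.b'v.symm
  have wb : w * b = b' * w := r.b'w.symm
  have wb' : w * b' = b * w := r.bw.symm
  refine ⟨?_, ?_, ?_, ?_, ?_⟩ <;>
  · simp only [psi, phi, mul_assoc, mul_add, add_mul, mul_sub, sub_mul, smul_sub,
      one_mul, r.aa', r.a'a, r.bb', r.b'b, wa, wa', wb, wb', r.ta, r.ta', r.tb,
      r.tb', r.ba, r.ba', r.b'a',
      mul_mul_of_mul_eq r.aa', mul_mul_of_mul_eq r.a'a, mul_mul_of_mul_eq r.bb',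
      mul_mul_of_mul_eq r.b'b, mul_mul_of_mul_eq va, mul_mul_of_mul_eq va',
      mul_mul_of_mul_eq vb, mul_mul_of_mul_eq vb', mul_mul_of_mul_eq r.ba',
      mul_mul_of_mul_eq r.b'a, mul_mul_of_mul_eq r.b'a']
    module

theorem phi_relations :
    phi h t v w a a' b b' * (a + a') = (b + b') * phi h t v w a a' b b' ∧
    phi h t v w a a' b b' * (b + b') = (a + a') * phi h t v w a a' b b' ∧
    phi h t v w a a' b b' * b = a * phi h t v w a a' b b' ∧
    phi h t v w a a' b b' * phi h t v w a a' b b' =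
      (h * h) • ((a + a') * (b + b') - (4 : ℂ) • 1) -
        (a + a' - (b + b')) * (a + a' - (b + b')) := by
  have va : v * a = a' * v := r.a'v.symm
  have va' : v * a' = a * v := r.av.symm
  have wa : w * a = a * w := r.aw.symm
  have wa' : w * a' = a' * w := r.a'w.symm
  have vb : v * b = b * v := r.bv.symm
  have vb' : v * b' = b' * v := r.b'v.symm
  have wb : w * b = b' * w := r.b'w.symm
  have wb' : w * b' = b * w := r.bw.symm
  refine ⟨?_, ?_, ?_, ?_⟩ <;>
  · simp only [psi, phi, mul_assoc, mul_add, add_mul, mul_sub, sub_mul, smul_add, smul_sub,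
      smul_mul_assoc, mul_smul_comm, smul_smul, mul_one, one_mul, mul_neg, neg_mul, smul_neg,
      r.tt, r.vv, r.ww, r.wv, r.tw, r.aa', r.a'a, r.bb', r.b'b, wa, wa', wb, wb',
      r.ta, r.ta', r.tb, r.tb', r.ba, r.ba', r.b'a, r.b'a',
      mul_mul_of_mul_eq r.wv, mul_mul_of_mul_eq r.tv, mul_mul_of_mul_eq r.aa',
      mul_mul_of_mul_eq r.a'a, mul_mul_of_mul_eq r.bb',
      mul_mul_of_mul_eq r.b'b, mul_mul_of_mul_eq va, mul_mul_of_mul_eq va',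
      mul_mul_of_mul_eq wa, mul_mul_of_mul_eq wa', mul_mul_of_mul_eq vb,
      mul_mul_of_mul_eq vb', mul_mul_of_mul_eq wb, mul_mul_of_mul_eq wb',
      mul_mul_of_mul_eq r.ta, mul_mul_of_mul_eq r.ta', mul_mul_of_mul_eq r.tb,
      mul_mul_of_mul_eq r.tb', mul_mul_of_mul_eq r.ba, mul_mul_of_mul_eq r.ba',
      mul_mul_of_mul_eq r.b'a, mul_mul_of_mul_eq r.b'a']
    module

end JMPair

section Dichotomy

variable {R : Type*} [Ring R] [Algebra ℂ R] {a a' c c' e : R} {α : ℂ} {U : Submodule ℂ R}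

theorem eq_zero_of_eq_neg {R : Type*} [AddCommGroup R] [Module ℂ R] {x : R} (h : x = -x) :
    x = 0 := by
  have : (2 : ℂ) • x = 0 := by rw [two_smul]; nth_rw 2 [h]; exact add_neg_cancel x
  exact (smul_eq_zero.mp this).resolve_left two_ne_zero

theorem sq_sub_four_smul_eq_zero (ha : a * a' = 1) (ha' : a' * a = 1) (ee : e * e = -1)
    (ea : e * a = a' * e) (ea' : e * a' = a * e) (ec : e * c = c' * e) (ac : a * c = c * a)
    (a'c : a' * c = c * a')
    (hUa : ∀ m ∈ U, a * m ∈ U) (hUa' : ∀ m ∈ U, a' * m ∈ U) (hUc : ∀ m ∈ U, c * m ∈ U)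
    (hUe : ∀ m ∈ U, e * m ∈ U) (h1 : ∀ m ∈ U, a * m + a' * m = α • m)
    (h2 : ∀ m ∈ U, c * m + c' * m = α • m)
    (h3 : ∀ m ∈ U, c * m - a' * m = a * (e * m) - c * (e * m)) {m : R} (hm : m ∈ U) :
    (α ^ 2 - 4) • m = 0 := by
  have hA : ∀ m ∈ U, (c - a') * m = (a - c) * (e * m) := fun m hm => by
    rw [sub_mul, sub_mul, h3 m hm]
  have hAU : ∀ m ∈ U, (c - a') * m ∈ U := fun m hm => by
    rw [sub_mul]; exact U.sub_mem (hUc m hm) (hUa' m hm)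
  have hBU : ∀ m ∈ U, (a - c) * m ∈ U := fun m hm => by
    rw [sub_mul]; exact U.sub_mem (hUa m hm) (hUc m hm)
  have hee : ∀ m, e * (e * m) = -m := fun m => by rw [← mul_assoc, ee, neg_one_mul]
  have hAe : ∀ m ∈ U, (c - a') * (e * m) = -((a - c) * m) := fun m hm => by
    rw [hA _ (hUe m hm), hee, mul_neg]
  have heA : ∀ m ∈ U, e * ((c - a') * m) = -((c - a') * (e * m)) := fun m hm => by
    have h4 := h1 _ (hUe m hm)
    have h5 := h2 _ (hUe m hm)
    have : e * ((c - a') * m) = c' * (e * m) - a * (e * m) := by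
      rw [← mul_assoc, mul_sub, ec, ea', sub_mul, mul_assoc, mul_assoc]
    rw [this, sub_mul, eq_sub_of_add_eq' h5, eq_sub_of_add_eq h4]
    abel
  have hcomm : (c - a') * (a - c) = (a - c) * (c - a') := by
    simp only [mul_sub, sub_mul, ha, ha', ac, a'c]
    abel
  have hAA : ∀ m ∈ U, (c - a') * ((c - a') * m) = -((c - a') * ((a - c) * (e * m))) := by
    intro m hm
    rw [hA _ (hAU m hm), heA m hm, mul_neg, ← mul_assoc, ← hcomm, mul_assoc]
  have hAA' : ∀ m ∈ U, (c - a') * ((c - a') * m) = (c - a') * ((a - c) * (e * m)) := by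
    intro m hm
    rw [hA m hm]
  have hAA0 : ∀ m ∈ U, (c - a') * ((c - a') * m) = 0 := by
    intro m hm
    have h6 := hAA m hm
    rw [← hAA' m hm] at h6
    exact eq_zero_of_eq_neg h6
  have hAB : ∀ m ∈ U, (c - a') * ((a - c) * m) = 0 := by
    intro m hm
    have h7 := hAA0 _ (U.neg_mem (hUe m hm))
    rwa [hAA' _ (U.neg_mem (hUe m hm)), mul_neg e, hee, neg_neg] at h7
  have hBB : (a - c) * ((a - c) * m) = 0 := by
    have h8 := hAB _ (hUe m hm)
    rwa [← mul_assoc, hcomm, mul_assoc, hAe m hm, mul_neg, neg_eq_zero] at h8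
  have hBA : (a - c) * ((c - a') * m) = 0 := by
    rw [← mul_assoc, ← hcomm, mul_assoc, hAB m hm]
  have h9 : (a - a') * ((a - a') * m) = 0 := by
    have : a - a' = (c - a') + (a - c) := by abel
    rw [this]
    simp only [mul_add, add_mul _ _ m, add_mul _ _ ((c - a') * m), add_mul _ _ ((a - c) * m),
      hAA0 m hm, hAB m hm, hBA, hBB, add_zero]
  have h10 : (a + a') * ((a + a') * m) = α • (α • m) := by
    have h11 : (a + a') * m = α • m := by rw [add_mul, h1 m hm]
    rw [h11, mul_smul_comm, h11]
  have h12 : (a + a') * ((a + a') * m) = (a - a') * ((a - a') * m) + (4 : ℂ) • m := by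
    simp only [← mul_assoc, mul_add, add_mul, mul_sub, sub_mul, ha, ha', one_mul]
    module
  rw [h9, h10, zero_add, smul_smul] at h12
  rw [sub_smul, ← h12, pow_two, sub_self]

theorem mul_eq_self_of_forall (ee : e * e = -1)
    (hUe : ∀ m ∈ U, e * m ∈ U) (h1 : ∀ m ∈ U, a * m = m) (h1' : ∀ m ∈ U, a' * m = m)
    (h3 : ∀ m ∈ U, c * m - a' * m = a * (e * m) - c * (e * m)) {m : R} (hm : m ∈ U) :
    c * m = m := by
  have hee : ∀ m, e * (e * m) = -m := fun m => by rw [← mul_assoc, ee, neg_one_mul]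
  have h4 := h3 m hm
  have h5 := h3 _ (hUe m hm)
  rw [h1 _ (hUe m hm), h1' m hm] at h4
  rw [hee, h1' _ (hUe m hm), h1 _ (U.neg_mem hm)] at h5
  have : (2 : ℂ) • (c * m) = (2 : ℂ) • m := by
    simp only [mul_neg] at h5
    linear_combination (norm := module) h4 - h5
  exact smul_right_injective R (two_ne_zero : (2 : ℂ) ≠ 0) this

end Dichotomy

/-- Three consecutive Jucys–Murphy elements. -/
structure JMTriple {R : Type*} [Ring R] [Algebra ℂ R] (h : ℂ)
    (t₁ t₂ v₁ v₂ v₃ a a' b b' c c' : R) : Prop where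
  r₁ : JMPair h t₁ v₁ v₂ a a' b b'
  r₂ : JMPair h t₂ v₂ v₃ b b' c c'
  braid : t₁ * t₂ * t₁ = t₂ * t₁ * t₂
  v₃v₁ : v₃ * v₁ = -(v₁ * v₃)
  av₃ : a * v₃ = v₃ * a
  a'v₃ : a' * v₃ = v₃ * a'
  cv₁ : c * v₁ = v₁ * c
  c'v₁ : c' * v₁ = v₁ * c'
  ca : c * a = a * c
  ca' : c * a' = a' * c
  c'a : c' * a = a * c'
  c'a' : c' * a' = a' * c'

namespace JMTriple

variable {R : Type*} [Ring R] [Algebra ℂ R] {h : ℂ} {t₁ t₂ v₁ v₂ v₃ a a' b b' c c' : R}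
  {α δ : ℂ} {U : Submodule ℂ R} (r : JMTriple h t₁ t₂ v₁ v₂ v₃ a a' b b' c c')
include r

theorem psi_braid
    (hUa : ∀ m ∈ U, a * m ∈ U) (hUb : ∀ m ∈ U, b * m ∈ U) (hUc : ∀ m ∈ U, c * m ∈ U)
    (ha : ∀ m ∈ U, a * m + a' * m = α • m) (hb : ∀ m ∈ U, b * m + b' * m = δ • m)
    (hc : ∀ m ∈ U, c * m + c' * m = α • m) {m : R} (hm : m ∈ U) :
    psi v₁ v₂ a' b b' * (psi v₂ v₃ b' c c' * (psi v₁ v₂ a' b b' * m)) +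
      psi v₂ v₃ b' c c' * (psi v₁ v₂ a' b b' * (psi v₂ v₃ b' c c' * m)) =
    (δ ^ 2 + α * δ - 8) • ((c * m - a' * m) + (c * (v₁ * v₃ * m) - a * (v₁ * v₃ * m))) := by
  obtain ⟨r₁, r₂, -, v₃v₁, av₃, a'v₃, cv₁, c'v₁, ca, ca', c'a, c'a'⟩ := r
  have ea : ∀ m ∈ U, a' * m = α • m - a * m := fun m hm => by rw [← ha m hm]; abel
  have eb : ∀ m ∈ U, b' * m = δ • m - b * m := fun m hm => by rw [← hb m hm]; abel
  have ec : ∀ m ∈ U, c' * m = α • m - c * m := fun m hm => by rw [← hc m hm]; abel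
  have eaa : ∀ m ∈ U, a * (a * m) = α • (a * m) - m := fun m hm => by
    rw [← mul_smul_comm, ← ha m hm, mul_add, ← mul_assoc a a', r₁.aa', one_mul]; abel
  have ebb : ∀ m ∈ U, b * (b * m) = δ • (b * m) - m := fun m hm => by
    rw [← mul_smul_comm, ← hb m hm, mul_add, ← mul_assoc b b', r₁.bb', one_mul]; abel
  have ecc : ∀ m ∈ U, c * (c * m) = α • (c * m) - m := fun m hm => by
    rw [← mul_smul_comm, ← hc m hm, mul_add, ← mul_assoc c c', r₂.bb', one_mul]; abel
  have hcm := hUc m hm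
  have hbm := hUb m hm
  have hbcm := hUb _ hcm
  have hacm := hUa _ hcm
  have habcm := hUa _ hbcm
  simp only [psi, mul_assoc, add_mul, mul_sub, sub_mul, smul_add, smul_sub,
      mul_smul_comm, smul_smul, one_mul, mul_neg, neg_mul, smul_neg,
      mul_mul_of_mul_eq r₁.vv, mul_mul_of_mul_eq r₁.ww, mul_mul_of_mul_eq r₂.ww,
      mul_mul_of_mul_eq r₁.wv, mul_mul_of_mul_eq r₂.wv, mul_mul_of_mul_eq v₃v₁,
      mul_mul_of_mul_eq r₁.av, mul_mul_of_mul_eq r₁.a'v, mul_mul_of_mul_eq r₁.aw,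
      mul_mul_of_mul_eq r₁.a'w, mul_mul_of_mul_eq av₃, mul_mul_of_mul_eq a'v₃,
      mul_mul_of_mul_eq r₁.bv, mul_mul_of_mul_eq r₁.b'v, mul_mul_of_mul_eq r₁.bw,
      mul_mul_of_mul_eq r₁.b'w, mul_mul_of_mul_eq r₂.aw, mul_mul_of_mul_eq r₂.a'w,
      mul_mul_of_mul_eq r₂.bv, mul_mul_of_mul_eq r₂.b'v, mul_mul_of_mul_eq r₂.bw,
      mul_mul_of_mul_eq r₂.b'w, mul_mul_of_mul_eq cv₁, mul_mul_of_mul_eq c'v₁,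
      mul_mul_of_mul_eq r₁.ba, mul_mul_of_mul_eq r₂.ba, mul_mul_of_mul_eq ca,
      ea, eb, ec, eaa, ebb, ecc, hUa, hUb, hUc, hm, hcm, hbm]
  module

/-- A vector on which both intertwiners vanish gives a dichotomy relation. -/
theorem dichotomy (h0 : h ≠ 0) (hαδ : α ≠ δ) (hK : δ ^ 2 + α * δ - 8 ≠ 0)
    (hUa : ∀ m ∈ U, a * m ∈ U) (hUa' : ∀ m ∈ U, a' * m ∈ U)
    (hUb : ∀ m ∈ U, b * m ∈ U) (hUb' : ∀ m ∈ U, b' * m ∈ U)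
    (hUc : ∀ m ∈ U, c * m ∈ U) (hUc' : ∀ m ∈ U, c' * m ∈ U)
    (hUv₁ : ∀ m ∈ U, v₁ * m ∈ U) (hUv₂ : ∀ m ∈ U, v₂ * m ∈ U) (hUv₃ : ∀ m ∈ U, v₃ * m ∈ U)
    (ha : ∀ m ∈ U, a * m + a' * m = α • m) (hb : ∀ m ∈ U, b * m + b' * m = δ • m)
    (hc : ∀ m ∈ U, c * m + c' * m = α • m)
    (hφ₁ : ∀ m ∈ U, phi h t₁ v₁ v₂ a a' b b' * m = 0)
    (hφ₂ : ∀ m ∈ U, phi h t₂ v₂ v₃ b b' c c' * m = 0) {m : R} (hm : m ∈ U) :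
    c * m - a' * m = a * (v₁ * v₃ * m) - c * (v₁ * v₃ * m) := by
  have hz : δ - α ≠ 0 := sub_ne_zero.mpr hαδ.symm
  have hz' : α - δ ≠ 0 := sub_ne_zero.mpr hαδ
  have ht₁ : ∀ m ∈ U, t₁ * m = (h / (δ - α)) • (psi v₁ v₂ a' b b' * m) := by
    intro m hm
    have h1 := hφ₁ m hm
    rw [r.r₁.psi_relations.2.2.2.2, sub_mul, mul_assoc, sub_mul, add_mul, add_mul, ha m hm,
      hb m hm, ← sub_smul, mul_smul_comm, smul_mul_assoc, sub_eq_zero] at h1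
    rw [div_eq_inv_mul, mul_smul, ← h1, inv_smul_smul₀ hz]
  have ht₂ : ∀ m ∈ U, t₂ * m = (h / (α - δ)) • (psi v₂ v₃ b' c c' * m) := by
    intro m hm
    have h1 := hφ₂ m hm
    rw [r.r₂.psi_relations.2.2.2.2, sub_mul, mul_assoc, sub_mul, add_mul, add_mul, hc m hm,
      hb m hm, ← sub_smul, mul_smul_comm, smul_mul_assoc, sub_eq_zero] at h1
    rw [div_eq_inv_mul, mul_smul, ← h1, inv_smul_smul₀ hz']
  have hψ₁ : ∀ m ∈ U, psi v₁ v₂ a' b b' * m ∈ U := by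
    intro m hm
    have h1 : v₁ * (v₂ * m) ∈ U := hUv₁ _ (hUv₂ _ hm)
    rw [psi, sub_mul, sub_mul, mul_assoc, mul_assoc, sub_mul]
    exact U.sub_mem (U.sub_mem (hUb _ hm) (hUa' _ hm)) (U.sub_mem (hUb' _ h1) (hUa' _ h1))
  have hψ₂ : ∀ m ∈ U, psi v₂ v₃ b' c c' * m ∈ U := by
    intro m hm
    have h1 : v₂ * (v₃ * m) ∈ U := hUv₂ _ (hUv₃ _ hm)
    rw [psi, sub_mul, sub_mul, mul_assoc, mul_assoc, sub_mul]
    exact U.sub_mem (U.sub_mem (hUc _ hm) (hUb' _ hm)) (U.sub_mem (hUc' _ h1) (hUb' _ h1))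
  have hbr : t₁ * (t₂ * (t₁ * m)) = t₂ * (t₁ * (t₂ * m)) := by
    simp only [← mul_assoc, r.braid]
  rw [ht₁ m hm, ht₂ m hm, mul_smul_comm, mul_smul_comm, mul_smul_comm, mul_smul_comm,
    ht₂ _ (hψ₁ m hm), ht₁ _ (hψ₂ m hm), mul_smul_comm, mul_smul_comm,
    ht₁ _ (hψ₂ _ (hψ₁ m hm)), ht₂ _ (hψ₁ _ (hψ₂ m hm))] at hbr
  have hk : h / (α - δ) = -(h / (δ - α)) := by
    rw [← neg_sub δ α, div_neg]
  have hsum := r.psi_braid hUa hUb hUc ha hb hc hm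
  have h0' : (h / (δ - α)) ^ 3 ≠ 0 := pow_ne_zero _ (div_ne_zero h0 hz)
  have h3 : (h / (δ - α)) ^ 3 •
      (psi v₁ v₂ a' b b' * (psi v₂ v₃ b' c c' * (psi v₁ v₂ a' b b' * m)) +
      psi v₂ v₃ b' c c' * (psi v₁ v₂ a' b b' * (psi v₂ v₃ b' c c' * m))) = 0 := by
    rw [hk] at hbr
    linear_combination (norm := module) -hbr
  rw [hsum] at h3
  have h4 := (smul_eq_zero.mp ((smul_eq_zero.mp h3).resolve_left h0')).resolve_left hK
  linear_combination (norm := module) h4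

end JMTriple

/-- A family of braid and Clifford elements satisfying the Hecke–Clifford relations. -/
structure HC {R : Type*} [Ring R] [Algebra ℂ R] (h : ℂ) (n : ℕ) (t v : ℕ → R) : Prop where
  braid : ∀ i, i + 2 < n → t i * t (i + 1) * t i = t (i + 1) * t i * t (i + 1)
  tcomm : ∀ i j, i + 2 ≤ j → j + 1 < n → t i * t j = t j * t i
  quad : ∀ i, i + 1 < n → t i * t i = 1 + h • t i
  vsq : ∀ j, j < n → v j * v j = 1
  vanti : ∀ i j, i < n → j < n → i ≠ j → v i * v j = -(v j * v i)
  tv : ∀ i, i + 1 < n → t i * v i = v (i + 1) * t i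
  tw : ∀ i, i + 1 < n → t i * v (i + 1) = v i * t i - h • (v i - v (i + 1))
  tvcomm : ∀ i l, i + 1 < n → l < n → l ≠ i → l ≠ i + 1 → t i * v l = v l * t i

section JM

variable {R : Type*} [Ring R] [Algebra ℂ R]

/-- The Jucys–Murphy elements. -/
def jm (h : ℂ) (t v : ℕ → R) : ℕ → R
  | 0 => 1
  | i + 1 => RankTwo.next h (t i) (v i) (v (i + 1)) (jm h t v i)

/-- The inverses of the Jucys–Murphy elements. -/
def jmInv (h : ℂ) (t v : ℕ → R) : ℕ → R
  | 0 => 1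
  | i + 1 => RankTwo.nextInv h (t i) (v i) (v (i + 1)) (jmInv h t v i)

theorem commute_jm {h : ℂ} {t v : ℕ → R} {c : R} {i : ℕ} (ht : ∀ j < i, Commute c (t j))
    (hv : ∀ j < i, Commute c (v j * v (j + 1))) :
    Commute c (jm h t v i) ∧ Commute c (jmInv h t v i) := by
  induction i with
  | zero => exact ⟨Commute.one_right c, Commute.one_right c⟩
  | succ i ih =>
    obtain ⟨h1, h2⟩ := ih (fun j hj => ht j (by omega)) (fun j hj => hv j (by omega))
    have h3 := ht i (by omega)
    have h4 := (hv i (by omega)).smul_right h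
    have h5 : Commute c (h • (1 : R)) := (Commute.one_right c).smul_right h
    exact ⟨((h3.add_right h4).mul_right h1).mul_right h3,
      ((h3.sub_right h5).mul_right h2).mul_right ((h3.add_right h4).sub_right h5)⟩

omit [Algebra ℂ R] in
theorem Commute.inverse_right {c a a' : R} (h : Commute c a) (h1 : a * a' = 1) (h2 : a' * a = 1) :
    Commute c a' := by
  calc c * a' = a' * a * c * a' := by rw [h2, one_mul]
    _ = a' * (c * a) * a' := by rw [mul_assoc a', h.eq]
    _ = a' * c := by rw [mul_assoc, mul_assoc, h1, mul_one]

omit [Algebra ℂ R] in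
theorem Commute.mul_of_neg {a b c : R} (h1 : c * a = -(a * c)) (h2 : c * b = -(b * c)) :
    Commute c (a * b) := by
  show c * (a * b) = a * b * c
  rw [← mul_assoc, h1, neg_mul, mul_assoc, h2, mul_neg, neg_neg, mul_assoc]

end JM

namespace HC

variable {R : Type*} [Ring R] [Algebra ℂ R] {h : ℂ} {n : ℕ} {t v : ℕ → R} (H : HC h n t v)
include H

theorem commute_vv {i j : ℕ} (hi : i < n) (hj : j + 1 < n) (h1 : i ≠ j) (h2 : i ≠ j + 1) :
    Commute (v i) (v j * v (j + 1)) :=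
  Commute.mul_of_neg (H.vanti i j hi (by omega) h1) (H.vanti i (j + 1) hi hj h2)

theorem commute_t_vv {i j : ℕ} (hi : i + 1 < n) (hj : j + 1 < n) (h1 : i ≠ j) (h2 : i ≠ j + 1)
    (h3 : j ≠ i + 1) : Commute (t i) (v j * v (j + 1)) :=
  Commute.mul_right (H.tvcomm i j hi (by omega) (by omega) (by omega))
    (H.tvcomm i (j + 1) hi hj (by omega) (by omega))

theorem commute_tt {i j : ℕ} (hi : i + 1 < n) (hj : j + 1 < n) (h1 : i ≠ j + 1)
    (h2 : j ≠ i + 1) : Commute (t i) (t j) := by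
  rcases lt_trichotomy i j with h3 | rfl | h3
  · exact H.tcomm i j (by omega) hj
  · exact Commute.refl _
  · exact (H.tcomm j i (by omega) hi).symm

theorem rankTwo_of {i : ℕ} (hi : i + 1 < n)
    (aa' : jm h t v i * jmInv h t v i = 1) (a'a : jmInv h t v i * jm h t v i = 1)
    (av : jm h t v i * v i = v i * jmInv h t v i) (a'v : jmInv h t v i * v i = v i * jm h t v i)
    (aw : ∀ j < n, j ≠ i → jm h t v i * v j = v j * jm h t v i)
    (a'w : ∀ j < n, j ≠ i → jmInv h t v i * v j = v j * jmInv h t v i) :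
    RankTwo h (t i) (v i) (v (i + 1)) (jm h t v i) (jmInv h t v i) where
  tt := H.quad i hi
  vv := H.vsq i (by omega)
  ww := H.vsq (i + 1) hi
  wv := H.vanti _ _ hi (by omega) (by omega)
  tv := H.tv i hi
  tw := H.tw i hi
  aa' := aa'
  a'a := a'a
  av := av
  a'v := a'v
  aw := aw _ hi (by omega)
  a'w := a'w _ hi (by omega)

theorem jm_basic {i : ℕ} (hi : i < n) :
    jm h t v i * jmInv h t v i = 1 ∧ jmInv h t v i * jm h t v i = 1 ∧
    jm h t v i * v i = v i * jmInv h t v i ∧ jmInv h t v i * v i = v i * jm h t v i ∧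
    (∀ j < n, j ≠ i → jm h t v i * v j = v j * jm h t v i) ∧
    (∀ j < n, j ≠ i → jmInv h t v i * v j = v j * jmInv h t v i) := by
  induction i with
  | zero => simp [jm, jmInv]
  | succ i ih =>
    obtain ⟨aa', a'a, av, a'v, aw, a'w⟩ := ih (by omega)
    obtain ⟨⟨h1, h2⟩, ⟨h3, h4⟩, ⟨h5, h6⟩, -⟩ := (H.rankTwo_of hi aa' a'a av a'v aw a'w).relations
    have key : ∀ j < n, j ≠ i + 1 → jm h t v (i + 1) * v j = v j * jm h t v (i + 1) := by
      intro j hj hji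
      by_cases hj' : j = i
      · subst hj'; exact h3
      have c1 : Commute (v j) (t i) := (H.tvcomm i j hi hj hj' hji).symm
      have c2 := (H.commute_vv hj hi hj' hji).smul_right h
      have c3 : Commute (v j) (jm h t v i) := (aw j hj hj').symm
      exact (((c1.add_right c2).mul_right c3).mul_right c1).symm
    refine ⟨h1, h2, h5, h6, key, fun j hj hji => ?_⟩
    exact (Commute.inverse_right (Commute.symm (key j hj hji)) h1 h2).symm

theorem rankTwo {i : ℕ} (hi : i + 1 < n) :
    RankTwo h (t i) (v i) (v (i + 1)) (jm h t v i) (jmInv h t v i) := by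
  obtain ⟨aa', a'a, av, a'v, aw, a'w⟩ := H.jm_basic (i := i) (by omega)
  exact H.rankTwo_of hi aa' a'a av a'v aw a'w

theorem commute_t_jm_of_lt {i j : ℕ} (hij : i < j) (hj : j + 1 < n) :
    Commute (t j) (jm h t v i) ∧ Commute (t j) (jmInv h t v i) :=
  commute_jm (fun k hk => H.commute_tt hj (by omega) (by omega) (by omega))
    (fun k hk => H.commute_t_vv hj (by omega) (by omega) (by omega) (by omega))

theorem commute_t_jm_add_two {j : ℕ} (hj : j + 2 < n) : Commute (t j) (jm h t v (j + 2)) := by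
  have r := H.rankTwo (i := j) (by omega)
  have sa : t (j + 1) * jm h t v j = jm h t v j * t (j + 1) :=
    (H.commute_t_jm_of_lt (by omega) (by omega)).1
  have az := (H.jm_basic (i := j) (by omega)).2.2.2.2.1 (j + 2) (by omega) (by omega)
  have tst := H.braid j hj
  have ss := H.quad (j + 1) (by omega)
  have sw := H.tv (j + 1) (by omega)
  have sz := H.tw (j + 1) (by omega)
  have sv := H.tvcomm (j + 1) j (by omega) (by omega) (by omega) (by omega)
  have tz := H.tvcomm j (j + 2) (by omega) (by omega) (by omega) (by omega)
  have zv := H.vanti (j + 2) j (by omega) (by omega) (by omega)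
  have zw := H.vanti (j + 2) (j + 1) (by omega) (by omega) (by omega)
  have zz := H.vsq (j + 2) (by omega)
  have tst' : ∀ x, t j * (t (j + 1) * (t j * x)) = t (j + 1) * (t j * (t (j + 1) * x)) :=
    fun x => by simp only [← mul_assoc, tst]
  rw [mul_assoc] at tst
  rw [mul_assoc] at tst
  show t j * _ = _ * t j
  simp only [jm, RankTwo.next]
  generalize jm h t v j = a at *
  generalize t (j + 1) = s at *
  simp only [show j + 1 + 1 = j + 2 from rfl] at *
  generalize v (j + 2) = z at *
  generalize v (j + 1) = w at *
  simp only [mul_assoc, mul_add, add_mul, sub_mul, smul_add, smul_sub,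
    smul_mul_assoc, mul_smul_comm, smul_smul, one_mul, mul_neg, neg_mul, smul_neg,
    tst, tst', mul_mul_of_mul_eq r.tt, mul_mul_of_mul_eq r.ww,
    mul_mul_of_mul_eq r.wv, mul_mul_of_mul_eq r.tv, mul_mul_of_mul_eq r.tw,
    mul_mul_of_mul_eq sa, mul_mul_of_mul_eq ss,
    mul_mul_of_mul_eq sw, mul_mul_of_mul_eq sv, mul_mul_of_mul_eq tz,
    mul_mul_of_mul_eq zv, mul_mul_of_mul_eq zw]
  module

theorem commute_t_jm_of_add_two_le {i j : ℕ} (hij : j + 2 ≤ i) (hi : i < n) :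
    Commute (t j) (jm h t v i) ∧ Commute (t j) (jmInv h t v i) := by
  have key : Commute (t j) (jm h t v i) := by
    induction i, hij using Nat.le_induction with
    | base => exact H.commute_t_jm_add_two hi
    | succ i hij ih =>
      have c1 := H.commute_tt (i := j) (j := i) (by omega) (by omega) (by omega) (by omega)
      have c2 := (H.commute_t_vv (i := j) (j := i) (by omega) (by omega) (by omega) (by omega)
        (by omega)).smul_right h
      exact ((c1.add_right c2).mul_right (ih (by omega))).mul_right c1
  obtain ⟨aa', a'a, -⟩ := H.jm_basic hi
  exact ⟨key, key.inverse_right aa' a'a⟩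

theorem commute_t_jm {i j : ℕ} (hi : i < n) (hj : j + 1 < n) (h1 : i ≠ j) (h2 : i ≠ j + 1) :
    Commute (t j) (jm h t v i) ∧ Commute (t j) (jmInv h t v i) := by
  rcases lt_or_ge i j with h3 | h3
  · exact H.commute_t_jm_of_lt h3 hj
  · exact H.commute_t_jm_of_add_two_le (by omega) hi

theorem commute_v_jm {i j : ℕ} (hi : i < n) (hj : j < n) (h1 : j ≠ i) :
    Commute (v j) (jm h t v i) ∧ Commute (v j) (jmInv h t v i) :=
  have := H.jm_basic hi
  ⟨(this.2.2.2.2.1 j hj h1).symm, (this.2.2.2.2.2 j hj h1).symm⟩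

theorem commute_jm_jm {i j : ℕ} (hi : i < n) (hj : j < n) :
    Commute (jm h t v i) (jm h t v j) ∧ Commute (jm h t v i) (jmInv h t v j) ∧
    Commute (jmInv h t v i) (jm h t v j) ∧ Commute (jmInv h t v i) (jmInv h t v j) := by
  have key : ∀ i j, i < n → j < n → j < i → Commute (jm h t v i) (jm h t v j) := by
    intro i j hi hj hij
    refine (commute_jm (fun k hk => ?_) (fun k hk => ?_)).1
    · exact (H.commute_t_jm hi (by omega) (by omega) (by omega)).1.symm
    · exact ((H.commute_v_jm hi (by omega) (by omega)).1.symm.mul_right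
        (H.commute_v_jm hi (by omega) (by omega)).1.symm)
  have key' : Commute (jm h t v i) (jm h t v j) := by
    rcases lt_trichotomy i j with h3 | rfl | h3
    · exact (key j i hj hi h3).symm
    · exact Commute.refl _
    · exact key i j hi hj h3
  obtain ⟨aa', a'a, -⟩ := H.jm_basic hi
  obtain ⟨bb', b'b, -⟩ := H.jm_basic hj
  have k2 := key'.inverse_right bb' b'b
  exact ⟨key', k2, (key'.symm.inverse_right aa' a'a).symm, (k2.symm.inverse_right aa' a'a).symm⟩

theorem pair {i : ℕ} (hi : i + 1 < n) :
    JMPair h (t i) (v i) (v (i + 1)) (jm h t v i) (jmInv h t v i)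
      (jm h t v (i + 1)) (jmInv h t v (i + 1)) := by
  have r := H.rankTwo hi
  obtain ⟨⟨h1, h2⟩, ⟨h3, h4⟩, ⟨h5, h6⟩, h7, h8, h9, h10⟩ := r.relations
  obtain ⟨c1, c2, c3, c4⟩ := H.commute_jm_jm (i := i + 1) (j := i) hi (by omega)
  exact ⟨r, h1, h2, h3, h4, h5, h6, h7, h8, h9, h10, c1, c2, c3, c4⟩

theorem triple {i : ℕ} (hi : i + 2 < n) :
    JMTriple h (t i) (t (i + 1)) (v i) (v (i + 1)) (v (i + 2)) (jm h t v i) (jmInv h t v i)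
      (jm h t v (i + 1)) (jmInv h t v (i + 1)) (jm h t v (i + 2)) (jmInv h t v (i + 2)) := by
  obtain ⟨c1, c2, c3, c4⟩ := H.commute_jm_jm (i := i + 2) (j := i) hi (by omega)
  have d1 := H.commute_v_jm (i := i) (j := i + 2) (by omega) (by omega) (by omega)
  have d2 := H.commute_v_jm (i := i + 2) (j := i) (by omega) (by omega) (by omega)
  exact ⟨H.pair (by omega), H.pair hi, H.braid i hi, H.vanti _ _ hi (by omega) (by omega),
    d1.1.symm, d1.2.symm, d2.1.symm, d2.2.symm, c1, c2, c3, c4⟩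

end HC

/-- The strict partition, given by its set of parts, obtained by adding a box of content `d`. -/
def addBox (D : Finset ℕ) (d : ℕ) : Finset ℕ := insert (d + 1) (D.erase d)

/-- A box of content `d` can be added to the strict partition with set of parts `D`. -/
def Addable (D : Finset ℕ) (d : ℕ) : Prop := (d = 0 ∨ d ∈ D) ∧ d + 1 ∉ D

/-- The strict partition reached after the first `k` steps of a content sequence. -/
def shape (c : ℕ → ℕ) : ℕ → Finset ℕ
  | 0 => ∅
  | k + 1 => addBox (shape c k) (c k)

/-- The first `k` entries are the contents of a standard shifted tableau. -/
def ValidSeq (c : ℕ → ℕ) (k : ℕ) : Prop := ∀ i < k, Addable (shape c i) (c i)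

theorem mem_addBox {D : Finset ℕ} {d x : ℕ} : x ∈ addBox D d ↔ x = d + 1 ∨ x ≠ d ∧ x ∈ D := by
  simp [addBox]

namespace Addable

variable {D : Finset ℕ} {d e : ℕ}

theorem ne_of_addBox (h2 : Addable (addBox D d) e) : e ≠ d := by
  rintro rfl
  exact h2.2 (mem_addBox.mpr (Or.inl rfl))

theorem of_addBox (h1 : Addable D d) (h2 : Addable (addBox D d) e) :
    Addable D e ∨ e = d + 1 ∨ e + 1 = d := by
  have := ne_of_addBox h2
  simp only [Addable, mem_addBox] at *
  by_cases h3 : e + 1 = d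
  · simp [h3]
  · by_cases h4 : e = d + 1
    · simp [h4]
    · left
      constructor
      · rcases h2.1 with h5 | h5 <;> tauto
      · intro h5
        exact h2.2 (Or.inr ⟨h3, h5⟩)

theorem nonadjacent (h1 : Addable D d) (h2 : Addable D e) (h3 : e ≠ d) :
    e ≠ d + 1 ∧ e + 1 ≠ d := by
  constructor
  · rintro rfl
    rcases h2.1 with h4 | h4
    · omega
    · exact h1.2 h4
  · rintro rfl
    rcases h1.1 with h4 | h4
    · omega
    · exact h2.2 h4

theorem addBox_of_ne (h1 : Addable D d) (h2 : Addable D e) (h3 : e ≠ d) :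
    Addable (addBox D d) e := by
  simp only [Addable, mem_addBox] at *
  refine ⟨?_, ?_⟩
  · rcases h2.1 with h4 | h4
    · exact Or.inl h4
    · exact Or.inr (Or.inr ⟨h3, h4⟩)
  · rintro (h4 | h4)
    · omega
    · exact h2.2 h4.2

end Addable

theorem addBox_comm {D : Finset ℕ} {d e : ℕ} (h1 : e ≠ d + 1) (h2 : e + 1 ≠ d) :
    addBox (addBox D d) e = addBox (addBox D e) d := by
  ext x
  simp only [mem_addBox]
  by_cases h3 : x = e + 1
  · have : x ≠ d := by omega
    tauto
  · by_cases h4 : x = d + 1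
    · have : x ≠ e := by omega
      tauto
    · tauto

theorem shape_congr {c c' : ℕ → ℕ} {k : ℕ} (h : ∀ i < k, c i = c' i) : shape c k = shape c' k := by
  induction k with
  | zero => rfl
  | succ k ih => rw [shape, shape, ih fun i hi => h i (by omega), h k (by omega)]

theorem ValidSeq.congr {c c' : ℕ → ℕ} {k : ℕ} (hv : ValidSeq c k) (h : ∀ i < k, c i = c' i) :
    ValidSeq c' k := by
  intro i hi
  rw [← h i hi, ← shape_congr fun j hj => h j (by omega)]
  exact hv i hi

theorem ValidSeq.mono {c : ℕ → ℕ} {k l : ℕ} (hv : ValidSeq c k) (h : l ≤ k) : ValidSeq c l :=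
  fun i hi => hv i (by omega)

theorem ValidSeq.succ {c : ℕ → ℕ} {k : ℕ} (hv : ValidSeq c k) (h : Addable (shape c k) (c k)) :
    ValidSeq c (k + 1) := by
  intro i hi
  rcases Nat.lt_succ_iff_lt_or_eq.mp hi with h1 | rfl
  · exact hv i h1
  · exact h

theorem ValidSeq.update_succ {c : ℕ → ℕ} {k j : ℕ} (hv : ValidSeq c k)
    (h : Addable (shape c k) j) : ValidSeq (Function.update c k j) (k + 1) := by
  have h1 : ∀ i < k, c i = Function.update c k j i := fun i hi => by
    rw [Function.update_of_ne (by omega)]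
  refine (hv.congr h1).succ ?_
  rwa [Function.update_self, ← shape_congr h1]

theorem le_of_mem_shape {c : ℕ → ℕ} {k x : ℕ} (hv : ValidSeq c k) (hx : x ∈ shape c k) :
    x ≤ k := by
  induction k generalizing x with
  | zero => simp [shape] at hx
  | succ k ih =>
    have h1 := ih (hv.mono (Nat.le_succ k)) (x := x)
    rcases (mem_addBox.mp hx) with h2 | h2
    · rcases (hv k (by omega)).1 with h3 | h3
      · omega
      · have := ih (hv.mono (Nat.le_succ k)) h3
        omega
    · have := h1 h2.2
      omega

theorem ValidSeq.le {c : ℕ → ℕ} {k i : ℕ} (hv : ValidSeq c k) (hi : i < k) : c i ≤ i := by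
  rcases (hv i hi).1 with h3 | h3
  · omega
  · exact le_of_mem_shape (hv.mono hi.le) h3

theorem ValidSeq.succ_ne {c : ℕ → ℕ} {k i : ℕ} (hv : ValidSeq c k) (hi : i + 1 < k) :
    c (i + 1) ≠ c i :=
  Addable.ne_of_addBox (hv (i + 1) hi)

/-- Swapping the entries at positions `i` and `i + 1`. -/
def swapSeq {α : Type*} (i : ℕ) (c : ℕ → α) : ℕ → α := c ∘ Equiv.swap i (i + 1)

@[simp] theorem swapSeq_left {α : Type*} (i : ℕ) (c : ℕ → α) : swapSeq i c i = c (i + 1) := by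
  simp [swapSeq]

@[simp] theorem swapSeq_right {α : Type*} (i : ℕ) (c : ℕ → α) : swapSeq i c (i + 1) = c i := by
  simp [swapSeq]

theorem swapSeq_of_ne {α : Type*} {i j : ℕ} (c : ℕ → α) (h1 : j ≠ i) (h2 : j ≠ i + 1) :
    swapSeq i c j = c j := by simp [swapSeq, Equiv.swap_apply_of_ne_of_ne h1 h2]

@[simp] theorem swapSeq_swapSeq {α : Type*} (i : ℕ) (c : ℕ → α) : swapSeq i (swapSeq i c) = c := by
  ext j; simp [swapSeq]

theorem ValidSeq.swapSeq {c : ℕ → ℕ} {k i : ℕ} (hv : ValidSeq c k) (hi : i + 1 < k)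
    (h1 : c (i + 1) ≠ c i + 1) (h2 : c (i + 1) + 1 ≠ c i) :
    ValidSeq (swapSeq i c) k ∧ shape (swapSeq i c) k = shape c k := by
  have hlow : ∀ j ≤ i, shape (_root_.swapSeq i c) j = shape c j := fun j hj =>
    shape_congr fun l hl => swapSeq_of_ne c (by omega) (by omega)
  have hne := hv.succ_ne hi
  have ha := hv i (by omega)
  have hb : Addable (shape c i) (c (i + 1)) := by
    rcases ha.of_addBox (hv (i + 1) hi) with h | h | h
    · exact h
    · exact absurd h h1
    · exact absurd h h2
  have hmid : shape (_root_.swapSeq i c) (i + 1) = addBox (shape c i) (c (i + 1)) := by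
    rw [shape, hlow i le_rfl, swapSeq_left]
  have hhigh : ∀ j, i + 2 ≤ j → shape (_root_.swapSeq i c) j = shape c j := by
    intro j hj
    induction j, hj using Nat.le_induction with
    | base =>
      rw [shape, hmid, swapSeq_right, shape, shape]
      exact addBox_comm (by omega) (by omega)
    | succ j hj ih => rw [shape, ih, swapSeq_of_ne c (by omega) (by omega), shape]
  refine ⟨fun j hj => ?_, hhigh k (by omega)⟩
  rcases lt_trichotomy j i with h3 | rfl | h3
  · rw [hlow j h3.le, swapSeq_of_ne c (by omega) (by omega)]
    exact hv j hj
  · rw [hlow j le_rfl, swapSeq_left]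
    exact hb
  · by_cases h4 : j = i + 1
    · subst h4
      rw [hmid, swapSeq_right]
      exact hb.addBox_of_ne ha hne.symm
    · rw [hhigh j (by omega), swapSeq_of_ne c (by omega) (by omega)]
      exact hv j hj

/-- The properties of the eigenvalue function `f` needed for the representation theory in
rank `n`. -/
structure GoodParams (h : ℂ) (f : ℕ → ℂ) (n : ℕ) : Prop where
  h0 : h ≠ 0
  f_zero : f 0 = 2
  inj : ∀ i j, i ≤ n → j ≤ n → f i = f j → i = j
  sq_ne : ∀ j, 1 ≤ j → j < n → f j ^ 2 ≠ 4
  adj_zero : ∀ y, (f 0 - y) * (f 0 - y) - h * h * (f 0 * y - 4) = (y - f 1) * (y - f 0)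
  adj_succ : ∀ d y, (f (d + 1) - y) * (f (d + 1) - y) - h * h * (f (d + 1) * y - 4) =
    (y - f (d + 2)) * (y - f d)
  K₁ : ∀ k, k + 1 ≤ n → f (k + 1) ^ 2 + f k * f (k + 1) - 8 ≠ 0
  K₂ : ∀ k, k + 1 ≤ n → f k ^ 2 + f (k + 1) * f k - 8 ≠ 0

/-- The eigenvalues of `J + J⁻¹` for the Jucys–Murphy elements `J`. -/
noncomputable def eigval (q : ℂ) (k : ℕ) : ℂ :=
  2 * (q ^ (2 * k + 1) + (q ^ (2 * k + 1))⁻¹) / (q + q⁻¹)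

theorem goodParams_of_isPrimitiveRoot {N : ℕ} (hN : 2 ≤ N) {q : ℂ}
    (hq : IsPrimitiveRoot q (4 * N)) {n : ℕ} (hnN : n < N) :
    GoodParams (q - q⁻¹) (eigval q) n := by
  have q0 : q ≠ 0 := hq.ne_zero (by omega)
  have hpow : ∀ k, 0 < k → k < 4 * N → q ^ k ≠ 1 := fun k h1 h2 =>
    hq.pow_ne_one_of_pos_of_lt h1.ne' h2
  have g0 : q ^ 2 + 1 ≠ 0 := by
    intro h
    apply hpow 4 (by omega) (by omega)
    linear_combination (q ^ 2 - 1) * h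
  have f0 : eigval q 0 = 2 := by
    simp only [eigval]
    field_simp
    ring
  have finj : ∀ i j, i < j → j ≤ n → eigval q i ≠ eigval q j := by
    intro i j hij hj h
    obtain ⟨k, rfl⟩ := Nat.exists_eq_add_of_lt hij
    have hr : q ^ (2 * i + 1) ≠ 0 := pow_ne_zero _ q0
    have hs : q ^ (2 * k + 2) ≠ 0 := pow_ne_zero _ q0
    have e1 : q ^ (2 * (i + k + 1) + 1) = q ^ (2 * i + 1) * q ^ (2 * k + 2) := by
      rw [← pow_add]; ring_nf
    have : (q ^ (2 * k + 2) - 1) * (q ^ (2 * (2 * i + k + 2)) - 1) = 0 := by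
      have e2 : q ^ (2 * (2 * i + k + 2)) = (q ^ (2 * i + 1)) ^ 2 * q ^ (2 * k + 2) := by
        rw [← pow_mul, ← pow_add]; ring_nf
      rw [e2]
      simp only [eigval, e1] at h
      generalize q ^ (2 * i + 1) = r at *
      generalize q ^ (2 * k + 2) = s at *
      field_simp at h
      linear_combination -h
    rcases mul_eq_zero.mp this with h1 | h1
    · exact hpow _ (by omega) (by omega) (sub_eq_zero.mp h1)
    · exact hpow _ (by omega) (by omega) (sub_eq_zero.mp h1)
  refine ⟨?_, f0, ?_, ?_, ?_, ?_, ?_, ?_⟩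
  · intro h
    apply hpow 2 (by omega) (by omega)
    field_simp at h
    linear_combination h
  · intro i j hi hj h
    rcases lt_trichotomy i j with h1 | h1 | h1
    · exact absurd h (finj i j h1 hj)
    · exact h1
    · exact absurd h.symm (finj j i h1 hi)
  · intro j h1 hj h
    have h2 : (eigval q j - 2) * (eigval q j + 2) = 0 := by linear_combination h
    rcases mul_eq_zero.mp h2 with h3 | h3
    · exact finj 0 j (by omega) hj.le (by rw [f0]; linear_combination -h3)
    · have hr : q ^ (2 * j) ≠ 0 := pow_ne_zero _ q0
      have h4 : (q ^ (2 * j) + 1) * (q ^ (2 * j) * q ^ 2 + 1) = 0 := by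
        simp only [eigval, pow_succ q (2 * j)] at h3
        generalize q ^ (2 * j) = r at *
        field_simp at h3
        linear_combination h3 / 2
      rcases mul_eq_zero.mp h4 with h5 | h5
      · apply hpow (4 * j) (by omega) (by omega)
        rw [show 4 * j = 2 * j * 2 by ring, pow_mul]
        linear_combination (q ^ (2 * j) - 1) * h5
      · apply hpow (4 * (j + 1)) (by omega) (by omega)
        rw [show 4 * (j + 1) = 2 * j * 2 + 2 * 2 by ring, pow_add, pow_mul, pow_mul]
        linear_combination (q ^ (2 * j) * q ^ 2 - 1) * h5
  · intro y
    simp only [eigval]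
    field_simp
    ring
  · intro d y
    have hr : q ^ (2 * d) ≠ 0 := pow_ne_zero _ q0
    simp only [eigval, show 2 * (d + 1) + 1 = 2 * d + 3 by ring,
      show 2 * (d + 2) + 1 = 2 * d + 5 by ring, pow_add q (2 * d)]
    generalize q ^ (2 * d) = r at *
    field_simp
    ring
  · intro k hk h
    have hr : q ^ (2 * k) ≠ 0 := pow_ne_zero _ q0
    have h4 : (q ^ (2 * k) * q ^ (2 * k) * q ^ 4 - 1) *
        (q ^ (2 * k) * q ^ (2 * k) * q ^ 6 - 1) = 0 := by
      simp only [eigval, show 2 * (k + 1) + 1 = 2 * k + 3 by ring, pow_add q (2 * k)] at h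
      generalize q ^ (2 * k) = r at *
      field_simp at h
      apply mul_left_cancel₀ g0
      apply mul_left_cancel₀ (two_ne_zero (α := ℂ))
      apply mul_left_cancel₀ (two_ne_zero (α := ℂ))
      linear_combination h
    rcases mul_eq_zero.mp h4 with h5 | h5
    · apply hpow (2 * k + 2 * k + 4) (by omega) (by omega)
      rw [pow_add, pow_add]
      linear_combination h5
    · apply hpow (2 * k + 2 * k + 6) (by omega) (by omega)
      rw [pow_add, pow_add]
      linear_combination h5
  · intro k hk h
    have hr : q ^ (2 * k) ≠ 0 := pow_ne_zero _ q0
    have h4 : (q ^ (2 * k) * q ^ (2 * k) * q ^ 2 - 1) *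
        (q ^ (2 * k) * q ^ (2 * k) * q ^ 4 - 1) = 0 := by
      simp only [eigval, show 2 * (k + 1) + 1 = 2 * k + 3 by ring, pow_add q (2 * k)] at h
      generalize q ^ (2 * k) = r at *
      field_simp at h
      apply mul_left_cancel₀ g0
      apply mul_left_cancel₀ (two_ne_zero (α := ℂ))
      apply mul_left_cancel₀ (two_ne_zero (α := ℂ))
      linear_combination h
    rcases mul_eq_zero.mp h4 with h5 | h5
    · apply hpow (2 * k + 2 * k + 2) (by omega) (by omega)
      rw [pow_add, pow_add]
      linear_combination h5
    · apply hpow (2 * k + 2 * k + 4) (by omega) (by omega)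
      rw [pow_add, pow_add]
      linear_combination h5

theorem exists_joint_eigenvector {R : Type*} [Ring R] [Algebra ℂ R] [FiniteDimensional ℂ R]
    {X : ℕ → R} {k : ℕ} (hc : ∀ i < k, ∀ j < k, X i * X j = X j * X i)
    (hs : ∀ i < k, ∀ (y : ℂ) (m : R), (X i - y • 1) * ((X i - y • 1) * m) = 0 → X i * m = y • m)
    {p p' : Submodule ℂ R} (hp : ∀ i < k, ∀ m ∈ p, X i * m ∈ p) (h : ¬ p ≤ p') :
    ∃ m ∈ p, m ∉ p' ∧ ∃ y : ℕ → ℂ, ∀ i < k, X i * m = y i • m := by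
  induction k generalizing p with
  | zero =>
    obtain ⟨m, h1, h2⟩ := SetLike.not_le_iff_exists.mp h
    exact ⟨m, h1, h2, 0, by simp⟩
  | succ k ih =>
    set T : Module.End ℂ R := LinearMap.mulLeft ℂ (X k) with hT
    have hTs : ∀ (y : ℂ) (l : ℕ) (m : R), ((T - algebraMap ℂ _ y) ^ l) m = 0 →
        X k * m = y • m := by
      intro y l
      induction l with
      | zero => intro m hm; simp at hm; simp [hm]
      | succ l ihl =>
        intro m hm
        rw [pow_succ] at hm
        have h1 := ihl _ hm
        apply hs k (by omega)
        have h2 : (T - algebraMap ℂ _ y) m = (X k - y • 1) * m := by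
          simp [hT, sub_mul, Module.algebraMap_end_apply]
        rw [h2] at h1
        rw [sub_mul, h1]
        simp
    have htop := Module.End.iSup_maxGenEigenspace_eq_top T
    have h1 := Submodule.eq_iSup_inf_genEigenspace (p := p) (f := T) ⊤ (hp k (by omega)) (by
      exact htop)
    have : ∃ y, ¬ p ⊓ T.genEigenspace y ⊤ ≤ p' := by
      by_contra hcon
      push Not at hcon
      apply h
      rw [h1]
      exact iSup_le hcon
    obtain ⟨y, hy⟩ := this
    have hmem : ∀ m ∈ T.genEigenspace y ⊤, X k * m = y • m := by
      intro m hm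
      rw [Module.End.mem_genEigenspace_top] at hm
      obtain ⟨l, hl⟩ := hm
      exact hTs y l m hl
    have hmem' : ∀ m, X k * m = y • m → m ∈ T.genEigenspace y ⊤ := by
      intro m hm
      rw [Module.End.mem_genEigenspace_top]
      refine ⟨1, ?_⟩
      simp [hT, hm, LinearMap.mem_ker]
    obtain ⟨m, hm, hm', z, hz⟩ := ih (p := p ⊓ T.genEigenspace y ⊤)
      (fun i hi j hj => hc i (by omega) j (by omega)) (fun i hi => hs i (by omega))
      (fun i hi m hm => ⟨hp i (by omega) m hm.1, hmem' _ (by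
        rw [← mul_assoc, hc k (by omega) i (by omega), mul_assoc, hmem m hm.2, mul_smul_comm])⟩) hy
    refine ⟨m, hm.1, hm', Function.update z k y, fun i hi => ?_⟩
    by_cases hik : i = k
    · subst hik
      rw [Function.update_self]
      exact hmem m hm.2
    · rw [Function.update_of_ne hik]
      exact hz i (by omega)

section Weights

variable {R : Type*} [Ring R] [Algebra ℂ R]

/-- The sum of a Jucys–Murphy element and its inverse. -/
def jmSum (h : ℂ) (t v : ℕ → R) (i : ℕ) : R := jm h t v i + jmInv h t v i

/-- The correction term for the `i`-th braid generator. -/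
def jmPsi (h : ℂ) (t v : ℕ → R) (i : ℕ) : R :=
  psi (v i) (v (i + 1)) (jmInv h t v i) (jm h t v (i + 1)) (jmInv h t v (i + 1))

/-- The `i`-th intertwiner. -/
def jmPhi (h : ℂ) (t v : ℕ → R) (i : ℕ) : R :=
  phi h (t i) (v i) (v (i + 1)) (jm h t v i) (jmInv h t v i) (jm h t v (i + 1))
    (jmInv h t v (i + 1))

/-- Joint eigenvectors of the first `k` elements `jmSum`. -/
def wt (h : ℂ) (t v : ℕ → R) (y : ℕ → ℂ) (k : ℕ) : Submodule ℂ R where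
  carrier := {m | ∀ i < k, jmSum h t v i * m = y i • m}
  add_mem' h1 h2 i hi := by rw [mul_add, h1 i hi, h2 i hi, smul_add]
  zero_mem' i hi := by rw [mul_zero, smul_zero]
  smul_mem' c m h1 i hi := by rw [mul_smul_comm, h1 i hi, smul_comm]

end Weights

section

variable {R : Type*} [Ring R] [Algebra ℂ R] {h : ℂ} {n : ℕ} {t v : ℕ → R} {y y' : ℕ → ℂ}
  {k l : ℕ} {m : R}

theorem wt_congr (hy : ∀ i < k, y i = y' i) (hm : m ∈ wt h t v y k) : m ∈ wt h t v y' k :=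
  fun i hi => by rw [← hy i hi]; exact hm i hi

theorem wt_mono (hl : l ≤ k) (hm : m ∈ wt h t v y k) : m ∈ wt h t v y l :=
  fun i hi => hm i (by omega)

theorem wt_succ (hm : m ∈ wt h t v y k) (h1 : jmSum h t v k * m = y k • m) :
    m ∈ wt h t v y (k + 1) := by
  intro i hi
  rcases Nat.lt_succ_iff_lt_or_eq.mp hi with h2 | rfl
  · exact hm i h2
  · exact h1

theorem wt_update_succ {z : ℂ} (hm : m ∈ wt h t v y k) (h1 : jmSum h t v k * m = z • m) :
    m ∈ wt h t v (Function.update y k z) (k + 1) := by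
  refine wt_succ (wt_congr (fun i hi => ?_) hm) ?_
  · rw [Function.update_of_ne (by omega)]
  · rwa [Function.update_self]

theorem mul_mem_wt {g : R} (hg : ∀ i < k, Commute g (jmSum h t v i)) (hm : m ∈ wt h t v y k) :
    g * m ∈ wt h t v y k := by
  intro i hi
  rw [← mul_assoc, ← (hg i hi).eq, mul_assoc, hm i hi, mul_smul_comm]

namespace HC

variable (H : HC h n t v)
include H

theorem commute_jm_sum {i j : ℕ} (hi : i < n) (hj : j < n) :
    Commute (jm h t v i) (jmSum h t v j) :=
  have := H.commute_jm_jm hi hj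
  this.1.add_right this.2.1

theorem commute_jmInv_sum {i j : ℕ} (hi : i < n) (hj : j < n) :
    Commute (jmInv h t v i) (jmSum h t v j) :=
  have := H.commute_jm_jm hi hj
  this.2.2.1.add_right this.2.2.2

theorem commute_sum_sum {i j : ℕ} (hi : i < n) (hj : j < n) :
    Commute (jmSum h t v i) (jmSum h t v j) :=
  (H.commute_jm_sum hi hj).add_left (H.commute_jmInv_sum hi hj)

theorem commute_v_sum {i j : ℕ} (hi : i < n) (hj : j < n) : Commute (v i) (jmSum h t v j) := by
  by_cases hij : i = j
  · subst hij
    obtain ⟨-, -, h1, h2, -⟩ := H.jm_basic hi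
    show v i * _ = _ * v i
    rw [jmSum, mul_add, add_mul, h1, h2, add_comm]
  · have := H.commute_v_jm hj hi hij
    exact this.1.add_right this.2

theorem commute_t_sum {i j : ℕ} (hi : i < n) (hj : j + 1 < n) (h1 : i ≠ j) (h2 : i ≠ j + 1) :
    Commute (t j) (jmSum h t v i) :=
  have := H.commute_t_jm hi hj h1 h2
  this.1.add_right this.2

theorem commute_psi_of {g : R} {i : ℕ} (hi : i + 1 < n)
    (h1 : Commute g (v i * v (i + 1)))
    (h3 : ∀ j, j = i ∨ j = i + 1 → Commute g (jm h t v j)) : Commute g (jmPsi h t v i) := by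
  have ha := h3 i (Or.inl rfl)
  have hb := h3 (i + 1) (Or.inr rfl)
  have r := H.pair hi
  have ha' := ha.inverse_right r.aa' r.a'a
  have hb' := hb.inverse_right r.bb' r.b'b
  exact (hb.sub_right ha').sub_right ((hb'.sub_right ha').mul_right h1)

theorem commute_phi_of {g : R} {i : ℕ} (hi : i + 1 < n) (ht : Commute g (t i))
    (h1 : Commute g (v i * v (i + 1)))
    (h3 : ∀ j, j = i ∨ j = i + 1 → Commute g (jm h t v j)) : Commute g (jmPhi h t v i) := by
  have ha := h3 i (Or.inl rfl)
  have hb := h3 (i + 1) (Or.inr rfl)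
  have r := H.pair hi
  have ha' := ha.inverse_right r.aa' r.a'a
  have hb' := hb.inverse_right r.bb' r.b'b
  exact (((ha.add_right ha').sub_right (hb.add_right hb')).mul_right ht).add_right
    ((H.commute_psi_of hi h1 h3).smul_right h)

theorem commute_jm_phi {i j : ℕ} (hi : i + 1 < n) (hj : j < n) (h1 : j ≠ i) (h2 : j ≠ i + 1) :
    Commute (jm h t v j) (jmPhi h t v i) := by
  refine H.commute_phi_of hi (H.commute_t_jm hj hi h1 h2).1.symm ?_ ?_
  · exact ((H.commute_v_jm hj (by omega) h1.symm).1.mul_left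
      (H.commute_v_jm hj hi h2.symm).1).symm
  · rintro l (rfl | rfl)
    · exact (H.commute_jm_jm hj (by omega)).1
    · exact (H.commute_jm_jm hj hi).1

theorem commute_sum_phi {i j : ℕ} (hi : i + 1 < n) (hj : j < n) (h1 : j ≠ i) (h2 : j ≠ i + 1) :
    Commute (jmSum h t v j) (jmPhi h t v i) := by
  have := H.commute_jm_phi hi hj h1 h2
  obtain ⟨aa', a'a, -⟩ := H.jm_basic hj
  exact this.add_left (this.symm.inverse_right aa' a'a).symm

theorem commute_sum_psi {i j : ℕ} (hi : i + 1 < n) (hj : j < n) :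
    Commute (jmSum h t v j) (jmPsi h t v i) := by
  refine H.commute_psi_of hi ?_ ?_
  · exact ((H.commute_v_sum (by omega) hj).mul_left (H.commute_v_sum hi hj)).symm
  · rintro l (rfl | rfl)
    · exact (H.commute_jm_sum (by omega) hj).symm
    · exact (H.commute_jm_sum hi hj).symm

theorem phi_mul_sum {i : ℕ} (hi : i + 1 < n) :
    jmPhi h t v i * jmSum h t v i = jmSum h t v (i + 1) * jmPhi h t v i :=
  (H.pair hi).phi_relations.1

theorem phi_mul_sum_succ {i : ℕ} (hi : i + 1 < n) :
    jmPhi h t v i * jmSum h t v (i + 1) = jmSum h t v i * jmPhi h t v i :=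
  (H.pair hi).phi_relations.2.1

theorem phi_mul_jm_succ {i : ℕ} (hi : i + 1 < n) :
    jmPhi h t v i * jm h t v (i + 1) = jm h t v i * jmPhi h t v i :=
  (H.pair hi).phi_relations.2.2.1

theorem phi_mul_phi {i : ℕ} (hi : i + 1 < n) :
    jmPhi h t v i * jmPhi h t v i =
      (h * h) • (jmSum h t v i * jmSum h t v (i + 1) - (4 : ℂ) • 1) -
        (jmSum h t v i - jmSum h t v (i + 1)) * (jmSum h t v i - jmSum h t v (i + 1)) :=
  (H.pair hi).phi_relations.2.2.2

theorem t_mul_sum {i : ℕ} (hi : i + 1 < n) :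
    t i * jmSum h t v i = jmSum h t v (i + 1) * t i - h • jmPsi h t v i :=
  (H.pair hi).psi_relations.2.2.1

theorem t_mul_sum_succ {i : ℕ} (hi : i + 1 < n) :
    t i * jmSum h t v (i + 1) = jmSum h t v i * t i + h • jmPsi h t v i :=
  (H.pair hi).psi_relations.2.2.2.1

theorem phi_eq {i : ℕ} (hi : i + 1 < n) :
    jmPhi h t v i = t i * (jmSum h t v (i + 1) - jmSum h t v i) - h • jmPsi h t v i :=
  (H.pair hi).psi_relations.2.2.2.2

theorem phi_mem_wt {i : ℕ} (hi : i + 1 < k) (hk : k ≤ n) (hm : m ∈ wt h t v y k) :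
    jmPhi h t v i * m ∈ wt h t v (swapSeq i y) k := by
  intro j hj
  by_cases h1 : j = i
  · subst h1
    rw [← mul_assoc, ← H.phi_mul_sum_succ (by omega), mul_assoc, hm (j + 1) hi, mul_smul_comm,
      swapSeq_left]
  by_cases h2 : j = i + 1
  · subst h2
    rw [← mul_assoc, ← H.phi_mul_sum (by omega), mul_assoc, hm i (by omega), mul_smul_comm,
      swapSeq_right]
  rw [← mul_assoc, (H.commute_sum_phi (by omega) (by omega) h1 h2).eq, mul_assoc, hm j hj,
    mul_smul_comm, swapSeq_of_ne _ h1 h2]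

theorem phi_phi {i : ℕ} (hi : i + 1 < n) {x z : ℂ} (hx : jmSum h t v i * m = x • m)
    (hz : jmSum h t v (i + 1) * m = z • m) :
    jmPhi h t v i * (jmPhi h t v i * m) =
      -((x - z) * (x - z) - h * h * (x * z - 4)) • m := by
  have h1 : (jmSum h t v i - jmSum h t v (i + 1)) * m = (x - z) • m := by
    rw [sub_mul, hx, hz, sub_smul]
  rw [← mul_assoc, H.phi_mul_phi hi, sub_mul, smul_mul_assoc, sub_mul, mul_assoc, mul_assoc, hz,
    h1, mul_smul_comm, mul_smul_comm, hx, h1, smul_mul_assoc, one_mul]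
  module

end HC

namespace GoodParams

variable {f : ℕ → ℂ} (P : GoodParams h f n)
include P

theorem eq_of_adj {d : ℕ} {z : ℂ}
    (hz : (f d - z) * (f d - z) - h * h * (f d * z - 4) = 0) :
    z = f (d + 1) ∨ (d = 0 ∧ z = f 0) ∨ ∃ j, d = j + 1 ∧ z = f j := by
  rcases d with _ | d
  · rw [P.adj_zero] at hz
    rcases mul_eq_zero.mp hz with h1 | h1
    · exact Or.inl (sub_eq_zero.mp h1)
    · exact Or.inr (Or.inl ⟨rfl, sub_eq_zero.mp h1⟩)
  · rw [P.adj_succ] at hz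
    rcases mul_eq_zero.mp hz with h1 | h1
    · exact Or.inl (sub_eq_zero.mp h1)
    · exact Or.inr (Or.inr ⟨d, rfl, sub_eq_zero.mp h1⟩)

theorem adj_ne_zero {d j : ℕ} (hd : d < n) (hj : j < n) (h1 : j ≠ d) (h2 : j ≠ d + 1)
    (h3 : j + 1 ≠ d) : (f d - f j) * (f d - f j) - h * h * (f d * f j - 4) ≠ 0 := by
  intro hz
  rcases P.eq_of_adj hz with h4 | ⟨rfl, h4⟩ | ⟨l, rfl, h4⟩
  · exact h2 (P.inj _ _ hj.le (by omega) h4)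
  · exact h1 (P.inj _ _ hj.le (by omega) h4)
  · have := P.inj _ _ hj.le (by omega) h4
    omega

theorem adj_deriv_ne_zero {d j : ℕ} (hd : d < n) (hj : j ≤ n) (h1 : j ≠ d)
    (h0 : (f d - f j) * (f d - f j) - h * h * (f d * f j - 4) = 0) :
    h * h * f d + 2 * (f d - f j) ≠ 0 := by
  intro h5
  rcases d with _ | d
  · have e1 := P.adj_zero 0
    have e2 := P.adj_zero 1
    rw [P.adj_zero] at h0
    have e3 : (f 1 - f j) + (f 0 - f j) = 0 := by linear_combination h5 + e2 - e1
    have e4 : f j = f 0 := by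
      rcases mul_eq_zero.mp h0 with h6 | h6
      · linear_combination -e3 - h6
      · linear_combination h6
    exact h1 (P.inj _ _ hj (by omega) e4)
  · have e1 := P.adj_succ d 0
    have e2 := P.adj_succ d 1
    rw [P.adj_succ] at h0
    have e3 : (f (d + 2) - f j) + (f d - f j) = 0 := by linear_combination h5 + e2 - e1
    have e4 : f j = f d := by
      rcases mul_eq_zero.mp h0 with h6 | h6
      · linear_combination -e3 - h6
      · linear_combination h6
    have e5 : f (d + 2) = f d := by linear_combination e3 + 2 * e4
    have := P.inj _ _ (by omega) (by omega) e5
    omega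

end GoodParams

/-- Injectivity of the intertwiner on weight spaces with nonadjacent contents. -/
theorem HC.phi_injective (H : HC h n t v) {f : ℕ → ℂ} (P : GoodParams h f n) {i : ℕ}
    (hi : i + 1 < n) {d j : ℕ} (hd : d < n) (hj : j < n) (h1 : j ≠ d) (h2 : j ≠ d + 1)
    (h3 : j + 1 ≠ d) (hx : jmSum h t v i * m = f d • m) (hz : jmSum h t v (i + 1) * m = f j • m)
    (h0 : jmPhi h t v i * m = 0) : m = 0 := by
  have h4 := H.phi_phi hi hx hz
  rw [h0, mul_zero] at h4
  exact (smul_eq_zero.mp h4.symm).resolve_left (neg_ne_zero.mpr (P.adj_ne_zero hd hj h1 h2 h3))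

end

section

variable {R : Type*} [Ring R] [Algebra ℂ R] {h : ℂ} {n : ℕ} {t v : ℕ → R} {y y' : ℕ → ℂ}
  {k l : ℕ} {m : R} {f : ℕ → ℂ}

/-- The joint eigenvalues of the first `k` elements `jmSum` come from standard tableaux, and
these elements act semisimply. -/
structure WtSpec (h : ℂ) (t v : ℕ → R) (f : ℕ → ℂ) (k : ℕ) : Prop where
  val : ∀ y : ℕ → ℂ, ∀ m ∈ wt h t v y k, m ≠ 0 →
    ∃ c, ValidSeq c k ∧ (∀ i < k, y i = f (c i)) ∧ ∀ i < k, c i = 0 → jm h t v i * m = m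
  ss : ∀ i < k, ∀ (y : ℂ) (m : R),
    (jmSum h t v i - y • 1) * ((jmSum h t v i - y • 1) * m) = 0 → jmSum h t v i * m = y • m

theorem WtSpec.valid (S : WtSpec h t v f k) (P : GoodParams h f n) (hk : k ≤ n) {c : ℕ → ℕ}
    (hc : ∀ i < k, c i ≤ n) (hm : m ∈ wt h t v (f ∘ c) k) (h0 : m ≠ 0) :
    ValidSeq c k ∧ ∀ i < k, c i = 0 → jm h t v i * m = m := by
  obtain ⟨c', h1, h2, h3⟩ := S.val _ m hm h0
  have h4 : ∀ i < k, c' i = c i := fun i hi => by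
    have h5 := h1.le hi
    have h6 := hc i hi
    have h7 := h2 i hi
    exact (P.inj _ _ h6 (by omega) h7).symm
  exact ⟨h1.congr h4, fun i hi h5 => h3 i hi (by rw [h4 i hi, h5])⟩

namespace HC

variable (H : HC h n t v) (P : GoodParams h f n)
include H P

theorem exists_transport {a : ℕ} {c : ℕ → ℕ} (hk : k + 1 ≤ n) (hv : ValidSeq c (k + 1))
    (h1 : a + 1 ∈ shape c (k + 1)) (h2 : a = 0 ∨ a ∉ shape c (k + 1)) :
    ∃ (F : R) (c' : ℕ → ℕ), ValidSeq c' (k + 1) ∧ shape c' (k + 1) = shape c (k + 1) ∧ c' k = a ∧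
      (∀ m ∈ wt h t v (f ∘ c) (k + 1), F * m ∈ wt h t v (f ∘ c') (k + 1)) ∧
      (∀ m ∈ wt h t v (f ∘ c) (k + 1), F * m = 0 → m = 0) ∧
      ∀ g, (∀ i, i + 1 < k + 1 → Commute g (jmPhi h t v i)) → Commute g F := by
  induction k generalizing c with
  | zero =>
    refine ⟨1, c, hv, rfl, ?_, fun m hm => by rwa [one_mul], fun m _ hm => by rwa [one_mul] at hm,
      fun g _ => Commute.one_right g⟩
    rw [shape, mem_addBox] at h1
    rcases h1 with h1 | h1
    · omega
    · simp [shape] at h1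
  | succ k ih =>
    by_cases had : c (k + 1) = a
    · exact ⟨1, c, hv, rfl, had, fun m hm => by rwa [one_mul],
        fun m _ hm => by rwa [one_mul] at hm, fun g _ => Commute.one_right g⟩
    rw [shape, mem_addBox] at h1 h2
    have h3 : a + 1 ≠ c (k + 1) ∧ a + 1 ∈ shape c (k + 1) := by
      rcases h1 with h1 | h1
      · omega
      · exact h1
    have h4 : a = 0 ∨ a ∉ shape c (k + 1) := by
      rcases h2 with h2 | h2
      · exact Or.inl h2
      · right
        intro h4
        exact h2 (Or.inr ⟨Ne.symm had, h4⟩)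
    have h5 : a ≠ c (k + 1) + 1 := by
      rcases h2 with h2 | h2
      · omega
      · exact fun h6 => h2 (Or.inl h6)
    obtain ⟨F, c', hv', hs, ha, hF1, hF2, hF3⟩ :=
      ih (by omega) (hv.mono (Nat.le_succ _)) h3.2 h4
    set d := c (k + 1) with hd
    set c₂ := Function.update c' (k + 1) d with hc₂
    have hlow : ∀ i < k + 1, c' i = c₂ i := fun i hi => by
      rw [hc₂, Function.update_of_ne (by omega)]
    have htop : c₂ (k + 1) = d := by rw [hc₂, Function.update_self]
    have ha₂ : c₂ k = a := by rw [← hlow k (by omega), ha]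
    have hv₂ : ValidSeq c₂ (k + 2) := hv'.update_succ (by rw [hs]; exact hv (k + 1) (by omega))
    obtain ⟨hv₃, hs₃⟩ := hv₂.swapSeq (i := k) (by omega) (by rw [htop, ha₂]; omega)
      (by rw [htop, ha₂]; omega)
    have hFmem : ∀ m ∈ wt h t v (f ∘ c) (k + 2), F * m ∈ wt h t v (f ∘ c₂) (k + 2) := by
      intro m hm
      refine wt_succ (wt_congr (fun i hi => ?_) (hF1 m (wt_mono (by omega) hm))) ?_
      · simp only [Function.comp, hlow i hi]
      · have hcomm := hF3 (jmSum h t v (k + 1)) (fun i hi =>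
          H.commute_sum_phi (by omega) (by omega) (by omega) (by omega))
        rw [← mul_assoc, hcomm.eq, mul_assoc, hm (k + 1) (by omega), mul_smul_comm]
        simp only [Function.comp, htop, hd]
    refine ⟨jmPhi h t v k * F, swapSeq k c₂, hv₃, ?_, by rw [swapSeq_right, ha₂], ?_, ?_, ?_⟩
    · rw [hs₃, shape, htop, ← shape_congr hlow, hs]
      rfl
    · intro m hm
      rw [mul_assoc]
      exact H.phi_mem_wt (by omega) (by omega) (hFmem m hm)
    · intro m hm h0
      apply hF2 m (wt_mono (by omega) hm)
      have hw := hFmem m hm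
      rw [mul_assoc] at h0
      have ha_le := hv₂.le (i := k) (by omega)
      have hd_le := hv₂.le (i := k + 1) (by omega)
      rw [ha₂] at ha_le
      rw [htop] at hd_le
      refine H.phi_injective P (i := k) (d := a) (j := d) (by omega) (by omega) (by omega)
        (by omega) (by omega) (by omega) ?_ ?_ h0
      · have := hw k (by omega)
        simpa only [Function.comp, ha₂] using this
      · have := hw (k + 1) (by omega)
        simpa only [Function.comp, htop] using this
    · intro g hg
      exact (hg k (by omega)).mul_right (hF3 g fun i hi => hg i (by omega))

omit P in
theorem jm_mem_wt {i : ℕ} (hi : i < n) (hk : k ≤ n) (hm : m ∈ wt h t v y k) :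
    jm h t v i * m ∈ wt h t v y k :=
  mul_mem_wt (fun j hj => H.commute_jm_sum hi (by omega)) hm

omit P in
theorem jmInv_mem_wt {i : ℕ} (hi : i < n) (hk : k ≤ n) (hm : m ∈ wt h t v y k) :
    jmInv h t v i * m ∈ wt h t v y k :=
  mul_mem_wt (fun j hj => H.commute_jmInv_sum hi (by omega)) hm

omit P in
theorem v_mem_wt {i : ℕ} (hi : i < n) (hk : k ≤ n) (hm : m ∈ wt h t v y k) :
    v i * m ∈ wt h t v y k :=
  mul_mem_wt (fun j hj => H.commute_v_sum hi (by omega)) hm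

omit P in
theorem vv_mem_wt {i j : ℕ} (hi : i < n) (hj : j < n) (hk : k ≤ n) (hm : m ∈ wt h t v y k) :
    v i * v j * m ∈ wt h t v y k := by
  rw [mul_assoc]
  exact H.v_mem_wt hi hk (H.v_mem_wt hj hk hm)

omit P in
theorem vv_mul_vv {i j : ℕ} (hi : i < n) (hj : j < n) (hij : i ≠ j) :
    v i * v j * (v i * v j) = -1 := by
  rw [mul_assoc, ← mul_assoc (v j), H.vanti j i hj hi hij.symm, neg_mul, mul_neg, mul_assoc,
    H.vsq j hj, mul_one, H.vsq i hi]

/-- Two consecutive elements `jmSum` have no common eigenvalue on a weight vector. -/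
theorem eq_zero_of_eq_eigenvalue (S : WtSpec h t v f (k + 1)) (hk : k + 1 < n) {c : ℕ → ℕ}
    (hv : ValidSeq c (k + 1)) (hm : m ∈ wt h t v (f ∘ c) (k + 1))
    (hm' : jmSum h t v (k + 1) * m = f (c k) • m) : m = 0 := by
  set y := f (c k) with hy
  set c₂ := Function.update c (k + 1) (c k) with hc₂
  have hlow : ∀ i < k + 1, c i = c₂ i := fun i hi => by
    rw [hc₂, Function.update_of_ne (by omega)]
  have htop : c₂ (k + 1) = c k := by rw [hc₂, Function.update_self]
  set U := wt h t v (f ∘ c₂) (k + 2) with hU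
  have hmU : m ∈ U := wt_succ (wt_congr (fun i hi => by
    simp only [Function.comp, hlow i hi]) hm) (by
    simp only [Function.comp, htop]; exact hm')
  have hx : ∀ m ∈ U, jmSum h t v k * m = y • m := fun m hm => by
    rw [hm k (by omega), Function.comp, ← hlow k (by omega)]
  have hx' : ∀ m ∈ U, jmSum h t v (k + 1) * m = y • m := fun m hm => by
    rw [hm (k + 1) (by omega), Function.comp, htop]
  have htx : ∀ m ∈ U, jmSum h t v k * (t k * m) = y • (t k * m) - h • (jmPsi h t v k * m) := by
    intro m hm
    have := congrArg (· * m) (H.t_mul_sum_succ hk)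
    simp only [mul_assoc, hx' m hm, add_mul, smul_mul_assoc, mul_smul_comm] at this
    rw [this]; abel
  have hpsix : ∀ m ∈ U, jmSum h t v k * (jmPsi h t v k * m) = y • (jmPsi h t v k * m) := by
    intro m hm
    rw [← mul_assoc, (H.commute_sum_psi hk (by omega)).eq, mul_assoc, hx m hm, mul_smul_comm]
  have hss : ∀ m ∈ U, jmSum h t v k * (t k * m) = y • (t k * m) := by
    intro m hm
    apply S.ss k (by omega)
    have : (jmSum h t v k - y • 1) * (t k * m) = - h • (jmPsi h t v k * m) := by
      rw [sub_mul, htx m hm, smul_mul_assoc, one_mul]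
      module
    rw [this, mul_smul_comm, sub_mul, hpsix m hm, smul_mul_assoc, one_mul, sub_self, smul_zero]
  have hpsi : ∀ m ∈ U, jmPsi h t v k * m = 0 := by
    intro m hm
    have h1 := htx m hm
    rw [hss m hm] at h1
    have h2 : h • (jmPsi h t v k * m) = 0 := by
      linear_combination (norm := module) h1
    exact (smul_eq_zero.mp h2).resolve_left P.h0
  have hpair := H.pair hk
  have ha : ∀ m ∈ U, jm h t v k * m + jmInv h t v k * m = y • m := fun m hm => by
    rw [← hx m hm, jmSum, add_mul]
  have hb : ∀ m ∈ U, jm h t v (k + 1) * m + jmInv h t v (k + 1) * m = y • m := fun m hm => by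
    rw [← hx' m hm, jmSum, add_mul]
  have hUe : ∀ m ∈ U, v k * v (k + 1) * m ∈ U := fun m hm =>
    H.vv_mem_wt (by omega) hk (by omega) hm
  have h3 : ∀ m ∈ U, jm h t v (k + 1) * m - jmInv h t v k * m =
      jm h t v k * (v k * v (k + 1) * m) - jm h t v (k + 1) * (v k * v (k + 1) * m) := by
    intro m hm
    have h1 := hpsi m hm
    have h2 := ha _ (hUe m hm)
    have h4 := hb _ (hUe m hm)
    rw [jmPsi, psi, sub_mul, mul_assoc, sub_mul, sub_mul] at h1
    linear_combination (norm := module) h1 + h4 - h2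
  have hee := H.vv_mul_vv (i := k) (j := k + 1) (by omega) hk (by omega)
  have h4 : (y ^ 2 - 4) • m = 0 := by
    refine sq_sub_four_smul_eq_zero (U := U) hpair.aa' hpair.a'a hee ?_ ?_ ?_ hpair.ba.symm
      hpair.ba'.symm (fun m hm => H.jm_mem_wt (by omega) (by omega) hm)
      (fun m hm => H.jmInv_mem_wt (by omega) (by omega) hm)
      (fun m hm => H.jm_mem_wt (by omega) (by omega) hm) hUe ha hb h3 hmU
    · rw [mul_assoc, ← hpair.aw, ← mul_assoc, ← hpair.a'v, mul_assoc]
    · rw [mul_assoc, ← hpair.a'w, ← mul_assoc, ← hpair.av, mul_assoc]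
    · rw [mul_assoc, ← hpair.b'w, ← mul_assoc, ← hpair.b'v, mul_assoc]
  have hck := hv.le (i := k) (by omega)
  by_cases hc0 : c k = 0
  · have hJ : ∀ m ∈ U, jm h t v k * m = m := by
      intro m hm
      by_cases hm0 : m = 0
      · rw [hm0, mul_zero]
      refine (S.valid P (by omega) (c := c) (fun i hi => ?_) ?_ hm0).2 k (by omega) hc0
      · have := hv.le hi
        omega
      · exact wt_congr (fun i hi => by simp only [Function.comp, hlow i hi])
          (wt_mono (Nat.le_succ _) hm)
    have hJ' : ∀ m ∈ U, jmInv h t v k * m = m := by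
      intro m hm
      nth_rw 1 [← hJ m hm]
      rw [← mul_assoc, hpair.a'a, one_mul]
    have hb1 : jm h t v (k + 1) * m = m := mul_eq_self_of_forall hee hUe hJ hJ' h3 hmU
    have htm : t k * m ∈ U := by
      intro i hi
      rcases Nat.lt_succ_iff_lt_or_eq.mp hi with hi | rfl
      · rcases Nat.lt_succ_iff_lt_or_eq.mp hi with hi | rfl
        · rw [← mul_assoc, ← (H.commute_t_sum (by omega) hk (by omega) (by omega)).eq, mul_assoc,
            hmU i (by omega), mul_smul_comm]
        · rw [hss m hmU, Function.comp, ← hlow i (by omega)]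
      · have := congrArg (· * m) (H.t_mul_sum hk)
        simp only [mul_assoc, hx m hmU, sub_mul, smul_mul_assoc, mul_smul_comm, hpsi m hmU,
          smul_zero, sub_zero] at this
        rw [← this, Function.comp, htop]
    have hb2 : (t k + h • (v k * v (k + 1))) * (jm h t v k * (t k * m)) = m := by
      rw [← mul_assoc, ← mul_assoc]
      exact hb1
    rw [hJ _ htm, add_mul, ← mul_assoc (t k), H.quad k hk, add_mul, one_mul, smul_mul_assoc,
      smul_mul_assoc] at hb2
    have h5 : h • (t k * m + v k * v (k + 1) * (t k * m)) = 0 := by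
      linear_combination (norm := module) hb2
    have h6 := (smul_eq_zero.mp h5).resolve_left P.h0
    have h7 : v k * v (k + 1) * (t k * m + v k * v (k + 1) * (t k * m)) = 0 := by
      rw [h6, mul_zero]
    rw [mul_add, ← mul_assoc (v k * v (k + 1)) (v k * v (k + 1)), hee, neg_one_mul] at h7
    have h8 : (2 : ℂ) • (t k * m) = 0 := by
      linear_combination (norm := module) h6 - h7
    have h9 := (smul_eq_zero.mp h8).resolve_left two_ne_zero
    have h10 : t k * (t k * m) = m + h • (t k * m) := by
      rw [← mul_assoc, H.quad k hk, add_mul, one_mul, smul_mul_assoc]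
    rw [h9, mul_zero, smul_zero, add_zero] at h10
    exact h10.symm
  · refine (smul_eq_zero.mp h4).resolve_left (sub_ne_zero.mpr ?_)
    exact P.sq_ne _ (by omega) (by omega)

end HC

end

section

variable {R : Type*} [Ring R] [Algebra ℂ R] {h : ℂ} {n : ℕ} {t v : ℕ → R} {y y' : ℕ → ℂ}
  {k l : ℕ} {m : R} {f : ℕ → ℂ}

theorem swapSeq_comp {α β : Type*} (g : α → β) (i : ℕ) (c : ℕ → α) :
    swapSeq i (g ∘ c) = g ∘ swapSeq i c := rfl

namespace HC

variable (H : HC h n t v) (P : GoodParams h f n)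
include H P

/-- On three consecutive positions with contents `j, d, j`, the content `j` must be zero. -/
theorem eq_zero_and_jm_mul_eq_self (S : WtSpec h t v f (k + 2)) (hk : k + 2 < n) {c : ℕ → ℕ}
    (hv : ValidSeq c (k + 2)) (hadj : c (k + 1) = c k + 1 ∨ c k = c (k + 1) + 1)
    (hm : m ∈ wt h t v (f ∘ c) (k + 2)) (hm' : jmSum h t v (k + 2) * m = f (c k) • m)
    (hm0 : m ≠ 0) : c k = 0 ∧ jm h t v (k + 2) * m = m := by
  set j := c k with hj
  set d := c (k + 1) with hd
  have hjn := hv.le (i := k) (by omega)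
  have hdn := hv.le (i := k + 1) (by omega)
  rw [← hj] at hjn
  rw [← hd] at hdn
  set c₃ := Function.update c (k + 2) j with hc₃
  have hlow : ∀ i < k + 2, c i = c₃ i := fun i hi => by
    rw [hc₃, Function.update_of_ne (by omega)]
  have htop : c₃ (k + 2) = j := by rw [hc₃, Function.update_self]
  have hk0 : c₃ k = j := (hlow k (by omega)).symm
  have hk1 : c₃ (k + 1) = d := (hlow (k + 1) (by omega)).symm
  have hle : ∀ i < k + 3, c₃ i ≤ n := by
    intro i hi
    by_cases h1 : i = k + 2
    · rw [h1, htop]; omega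
    · rw [← hlow i (by omega)]
      have := hv.le (i := i) (by omega)
      omega
  set U := wt h t v (f ∘ c₃) (k + 3) with hU
  have hmU : m ∈ U := wt_succ (wt_congr (fun i hi => by
    simp only [Function.comp, hlow i hi]) hm) (by
    simp only [Function.comp, htop]; exact hm')
  have hφ₂ : ∀ u ∈ U, jmPhi h t v (k + 1) * u = 0 := by
    intro u hu
    by_contra h0
    have h1 := H.phi_mem_wt (i := k + 1) (by omega) (by omega) hu
    have h2 := wt_mono (l := k + 2) (by omega) h1
    rw [swapSeq_comp] at h2
    have h3 := (S.valid P (by omega) (c := swapSeq (k + 1) c₃) ?_ h2 h0).1.succ_ne (i := k)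
      (by omega)
    · rw [swapSeq_left, swapSeq_of_ne _ (by omega) (by omega), htop, hk0] at h3
      exact h3 rfl
    · intro i hi
      by_cases h4 : i = k + 1
      · rw [h4, swapSeq_left, htop]; omega
      · rw [swapSeq_of_ne _ h4 (by omega)]
        exact hle i (by omega)
  have hφ₁ : ∀ u ∈ U, jmPhi h t v k * u = 0 := by
    intro u hu
    by_contra h0
    have h1 := H.phi_mem_wt (i := k) (by omega) (by omega) hu
    have h2 := wt_mono (l := k + 2) (by omega) h1
    rw [swapSeq_comp] at h1 h2
    have h3 := (S.valid P (by omega) (c := swapSeq k c₃) ?_ h2 h0).1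
    · refine h0 (H.eq_zero_of_eq_eigenvalue P S hk h3 h2 ?_)
      rw [h1 (k + 2) (by omega), Function.comp, swapSeq_of_ne _ (by omega) (by omega), htop,
        swapSeq_right, hk0]
    · intro i hi
      by_cases h4 : i = k
      · rw [h4, swapSeq_left, hk1]; omega
      · by_cases h5 : i = k + 1
        · rw [h5, swapSeq_right, hk0]; omega
        · rw [swapSeq_of_ne _ h4 h5]
          exact hle i (by omega)
  have hX : ∀ i, i < k + 3 → ∀ u ∈ U, jm h t v i * u + jmInv h t v i * u = f (c₃ i) • u := by
    intro i hi u hu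
    have := hu i hi
    rwa [jmSum, add_mul] at this
  have hUJ : ∀ i, i < k + 3 → ∀ u ∈ U, jm h t v i * u ∈ U := fun i hi u hu =>
    H.jm_mem_wt (by omega) (by omega) hu
  have hUJ' : ∀ i, i < k + 3 → ∀ u ∈ U, jmInv h t v i * u ∈ U := fun i hi u hu =>
    H.jmInv_mem_wt (by omega) (by omega) hu
  have hUv : ∀ i, i < k + 3 → ∀ u ∈ U, v i * u ∈ U := fun i hi u hu =>
    H.v_mem_wt (by omega) (by omega) hu
  have ha : ∀ u ∈ U, jm h t v k * u + jmInv h t v k * u = f j • u := by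
    simpa only [hk0] using hX k (by omega)
  have hb : ∀ u ∈ U, jm h t v (k + 1) * u + jmInv h t v (k + 1) * u = f d • u := by
    simpa only [hk1] using hX (k + 1) (by omega)
  have hc : ∀ u ∈ U, jm h t v (k + 2) * u + jmInv h t v (k + 2) * u = f j • u := by
    simpa only [htop] using hX (k + 2) (by omega)
  have htri := H.triple hk
  have hne : f j ≠ f d := fun h1 => by
    have := P.inj _ _ (by omega) (by omega) h1
    omega
  have hK : f d ^ 2 + f j * f d - 8 ≠ 0 := by
    rcases hadj with h1 | h1
    · rw [h1]
      exact P.K₁ j (by omega)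
    · rw [h1]
      exact P.K₂ d (by omega)
  have h3 : ∀ u ∈ U, jm h t v (k + 2) * u - jmInv h t v k * u =
      jm h t v k * (v k * v (k + 2) * u) - jm h t v (k + 2) * (v k * v (k + 2) * u) :=
    fun u hu => htri.dichotomy P.h0 hne hK (hUJ _ (by omega)) (hUJ' _ (by omega))
      (hUJ _ (by omega)) (hUJ' _ (by omega)) (hUJ _ (by omega)) (hUJ' _ (by omega))
      (hUv _ (by omega)) (hUv _ (by omega)) (hUv _ (by omega)) ha hb hc hφ₁ hφ₂ hu
  have hUe : ∀ u ∈ U, v k * v (k + 2) * u ∈ U := fun u hu =>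
    H.vv_mem_wt (by omega) hk (by omega) hu
  have hee := H.vv_mul_vv (i := k) (j := k + 2) (by omega) hk (by omega)
  have hj0 : j = 0 := by
    by_contra hj0
    have h4 : (f j ^ 2 - 4) • m = 0 := by
      refine sq_sub_four_smul_eq_zero (U := U) htri.r₁.aa' htri.r₁.a'a hee ?_ ?_ ?_ htri.ca.symm
        htri.ca'.symm (hUJ _ (by omega)) (hUJ' _ (by omega)) (hUJ _ (by omega)) hUe ha hc h3 hmU
      · rw [mul_assoc, ← htri.av₃, ← mul_assoc, ← htri.r₁.a'v, mul_assoc]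
      · rw [mul_assoc, ← htri.a'v₃, ← mul_assoc, ← htri.r₁.av, mul_assoc]
      · rw [mul_assoc, ← htri.r₂.b'w, ← mul_assoc, ← htri.c'v₁, mul_assoc]
    exact hm0 ((smul_eq_zero.mp h4).resolve_left
      (sub_ne_zero.mpr (P.sq_ne _ (by omega) (by omega))))
  refine ⟨hj0, ?_⟩
  have hJ : ∀ u ∈ U, jm h t v k * u = u := by
    intro u hu
    by_cases hu0 : u = 0
    · rw [hu0, mul_zero]
    refine (S.valid P (by omega) (c := c₃) (fun i hi => hle i (by omega))
      (wt_mono (by omega) hu) hu0).2 k (by omega) (by rw [hk0, hj0])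
  have hJ' : ∀ u ∈ U, jmInv h t v k * u = u := by
    intro u hu
    nth_rw 1 [← hJ u hu]
    rw [← mul_assoc, htri.r₁.a'a, one_mul]
  exact mul_eq_self_of_forall hee hUe hJ hJ' h3 hmU

/-- A nonzero weight vector which is also an eigenvector of the next element `jmSum` has an
addable content. -/
theorem exists_addable (S : WtSpec h t v f (k + 1)) (hk : k + 1 < n) {c : ℕ → ℕ}
    (hv : ValidSeq c (k + 1)) (hm : m ∈ wt h t v (f ∘ c) (k + 1)) (hm0 : m ≠ 0) {y : ℂ}
    (hm' : jmSum h t v (k + 1) * m = y • m) :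
    ∃ j, Addable (shape c (k + 1)) j ∧ y = f j ∧ (j = 0 → jm h t v (k + 1) * m = m) := by
  set d := c k with hd
  have hadd := hv k (by omega)
  rw [← hd] at hadd
  have hdk := hv.le (i := k) (by omega)
  rw [← hd] at hdk
  have hxd : jmSum h t v k * m = f d • m := hm k (by omega)
  have hyd : y ≠ f d := by
    rintro rfl
    exact hm0 (H.eq_zero_of_eq_eigenvalue P S hk hv hm hm')
  have hsh : shape c (k + 1) = addBox (shape c k) d := rfl
  by_cases hφ : jmPhi h t v k * m = 0
  · have h1 := H.phi_phi hk hxd hm'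
    rw [hφ, mul_zero] at h1
    have h2 := neg_eq_zero.mp ((smul_eq_zero.mp h1.symm).resolve_right hm0)
    have key : ∀ j, y = f j → (j + 1 = d ∨ j = d + 1) → j + 1 ∈ shape c k →
        (j = 0 ∨ j ∉ shape c k) → j = 0 ∧ d = 1 ∧ jm h t v (k + 1) * m = m := by
      intro j hy hj hj1 hj2
      rcases k with _ | k
      · simp [shape] at hj1
      obtain ⟨F, c', hv', hs', ha', hF1, hF2, hF3⟩ :=
        H.exists_transport P (k := k) (a := j) (by omega) (hv.mono (by omega)) hj1 hj2
      set c₂ := Function.update c' (k + 1) d with hc₂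
      have hlow : ∀ i < k + 1, c' i = c₂ i := fun i hi => by
        rw [hc₂, Function.update_of_ne (by omega)]
      have htop : c₂ (k + 1) = d := by rw [hc₂, Function.update_self]
      have ha₂ : c₂ k = j := by rw [← hlow k (by omega), ha']
      have hv₂ : ValidSeq c₂ (k + 2) := hv'.update_succ (by rw [hs']; exact hadd)
      have hFX : ∀ i, i < n → k + 1 ≤ i → Commute (jmSum h t v i) F := fun i hi hki =>
        hF3 _ (fun l hl => H.commute_sum_phi (by omega) hi (by omega) (by omega))
      have hFm0 : F * m ≠ 0 := fun h0 => hm0 (hF2 m (wt_mono (by omega) hm) h0)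
      have hFm : F * m ∈ wt h t v (f ∘ c₂) (k + 2) := by
        refine wt_succ (wt_congr (fun i hi => ?_) (hF1 m (wt_mono (by omega) hm))) ?_
        · simp only [Function.comp, hlow i hi]
        · rw [← mul_assoc, (hFX (k + 1) (by omega) le_rfl).eq, mul_assoc, hxd, mul_smul_comm]
          simp only [Function.comp, htop]
      have hFm' : jmSum h t v (k + 2) * (F * m) = f (c₂ k) • (F * m) := by
        rw [← mul_assoc, (hFX (k + 2) (by omega) (by omega)).eq, mul_assoc, hm', mul_smul_comm,
          ha₂, hy]
      obtain ⟨h3, h4⟩ := H.eq_zero_and_jm_mul_eq_self P S hk hv₂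
        (by rw [ha₂, htop]; omega) hFm hFm' hFm0
      rw [ha₂] at h3
      have hd1 : d = 1 := by
        rcases hj with h5 | h5
        · omega
        · exfalso
          omega
      refine ⟨h3, hd1, ?_⟩
      have hFJ : Commute (jm h t v (k + 2)) F :=
        hF3 _ (fun l hl => H.commute_jm_phi (by omega) (by omega) (by omega) (by omega))
      have h5 : F * (jm h t v (k + 2) * m - m) = 0 := by
        rw [mul_sub, ← mul_assoc, ← hFJ.eq, mul_assoc, h4, sub_self]
      exact sub_eq_zero.mp (hF2 _ (Submodule.sub_mem _
        (wt_mono (by omega) (H.jm_mem_wt (by omega) (by omega) hm)) (wt_mono (by omega) hm)) h5)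
    rcases P.eq_of_adj h2 with h3 | ⟨h3, h4⟩ | ⟨j, h3, h4⟩
    · refine ⟨d + 1, ⟨Or.inr (mem_addBox.mpr (Or.inl rfl)), fun h5 => ?_⟩, h3, by omega⟩
      rw [hsh, mem_addBox] at h5
      have := key (d + 1) h3 (Or.inr rfl) (by
        rcases h5 with h5 | h5
        · omega
        · exact h5.2) (Or.inr hadd.2)
      omega
    · exact absurd (by rw [h4, h3]) hyd
    · have hjD : j + 1 ∈ shape c k := by
        rcases hadd.1 with h5 | h5
        · omega
        · rwa [h3] at h5
      have hjA : j + 1 ∉ shape c (k + 1) := by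
        rw [hsh, mem_addBox]
        omega
      by_cases h6 : j = 0 ∨ j ∉ shape c k
      · obtain ⟨h7, -, h8⟩ := key j h4 (Or.inl h3.symm) hjD h6
        exact ⟨j, ⟨Or.inl h7, hjA⟩, h4, fun _ => h8⟩
      · push Not at h6
        refine ⟨j, ⟨Or.inr ?_, hjA⟩, h4, fun h7 => absurd h7 h6.1⟩
        rw [hsh, mem_addBox]
        exact Or.inr ⟨by omega, h6.2⟩
  · set yc : ℕ → ℂ := Function.update (f ∘ c) (k + 1) y with hyc
    have hmU : m ∈ wt h t v yc (k + 2) := wt_update_succ hm hm'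
    have hφm := H.phi_mem_wt (i := k) (by omega) (by omega) hmU
    obtain ⟨c', hv', hy', hJ'⟩ := S.val _ _ (wt_mono (l := k + 1) (by omega) hφm) hφ
    have hlow : ∀ i < k, c' i = c i := by
      intro i hi
      have h1 := hy' i (by omega)
      rw [swapSeq_of_ne _ (by omega) (by omega), hyc, Function.update_of_ne (by omega)] at h1
      have h2 := hv.le (i := i) (by omega)
      have h3 := hv'.le (i := i) (by omega)
      exact (P.inj _ _ (by omega) (by omega) h1).symm
    have hyj : y = f (c' k) := by
      have h1 := hy' k (by omega)
      rwa [swapSeq_left, hyc, Function.update_self] at h1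
    have hadd' : Addable (shape c k) (c' k) := by
      rw [← shape_congr hlow]
      exact hv' k (by omega)
    have hne : c' k ≠ d := fun h1 => hyd (by rw [hyj, h1])
    refine ⟨c' k, hadd.addBox_of_ne hadd' hne, hyj, fun h0 => ?_⟩
    have h1 := hJ' k (by omega) h0
    have h2 : jmPhi h t v k * (jm h t v (k + 1) * m - m) = 0 := by
      rw [mul_sub, ← mul_assoc, H.phi_mul_jm_succ hk, mul_assoc, h1, sub_self]
    have h3 : jm h t v (k + 1) * m - m ∈ wt h t v yc (k + 2) :=
      Submodule.sub_mem _ (H.jm_mem_wt hk (by omega) hmU) hmU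
    have hjn := hv'.le (i := k) (by omega)
    have hnon := hadd.nonadjacent hadd' hne
    refine sub_eq_zero.mp (H.phi_injective P hk (d := d) (j := c' k) (by omega) (by omega) hne
      hnon.1 hnon.2 ?_ ?_ h2)
    · rw [h3 k (by omega), hyc, Function.update_of_ne (by omega)]
      rfl
    · rw [h3 (k + 1) (by omega), hyc, Function.update_self, hyj]

/-- The next element `jmSum` acts semisimply. -/
theorem jmSum_mul_eq_smul [FiniteDimensional ℂ R] (S : WtSpec h t v f (k + 1)) (hk : k + 1 < n)
    {y : ℂ} (hm : (jmSum h t v (k + 1) - y • 1) * ((jmSum h t v (k + 1) - y • 1) * m) = 0) :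
    jmSum h t v (k + 1) * m = y • m := by
  by_contra hne
  set T : R := jmSum h t v (k + 1) - y • 1 with hT
  let p : Submodule ℂ R := LinearMap.ker (LinearMap.mulLeft ℂ (T * T))
  let p' : Submodule ℂ R := LinearMap.ker (LinearMap.mulLeft ℂ T)
  have hp : ∀ x, x ∈ p ↔ T * (T * x) = 0 := fun x => by
    simp [p, LinearMap.mem_ker]
  have hp' : ∀ x, x ∈ p' ↔ T * x = 0 := fun x => by simp [p', LinearMap.mem_ker]
  have hTx : ∀ x, T * x = jmSum h t v (k + 1) * x - y • x := fun x => by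
    rw [hT, sub_mul, smul_mul_assoc, one_mul]
  have hcomm : ∀ i < k + 1, Commute (jmSum h t v i) T := fun i hi =>
    (H.commute_sum_sum (by omega) hk).sub_right
      (by simpa using (Commute.one_right (jmSum h t v i)).smul_right y)
  have hnle : ¬ p ≤ p' := fun h1 => by
    have h2 := (hp' m).mp (h1 ((hp m).mpr hm))
    rw [hTx] at h2
    exact hne (sub_eq_zero.mp h2)
  obtain ⟨x, hx, hx', ys, hys⟩ := exists_joint_eigenvector (X := jmSum h t v) (k := k + 1)
    (fun i hi j hj => (H.commute_sum_sum (by omega) (by omega)).eq) S.ss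
    (p := p) (p' := p') (fun i hi u hu => by
      rw [hp] at hu ⊢
      rw [← mul_assoc T (jmSum h t v i), ← (hcomm i hi).eq, mul_assoc,
        ← mul_assoc T (jmSum h t v i), ← (hcomm i hi).eq, mul_assoc, hu, mul_zero]) hnle
  rw [hp] at hx
  rw [hp'] at hx'
  have hx0 : x ≠ 0 := by
    rintro rfl
    exact hx' (mul_zero _)
  obtain ⟨c, hv, hyc, -⟩ := S.val ys x hys hx0
  have hxw : x ∈ wt h t v (f ∘ c) (k + 1) := wt_congr (fun i hi => hyc i hi) hys
  have hTxw : T * x ∈ wt h t v (f ∘ c) (k + 1) :=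
    mul_mem_wt (fun i hi => (hcomm i hi).symm) hxw
  have hTxy : jmSum h t v (k + 1) * (T * x) = y • (T * x) := by
    rw [hTx (T * x)] at hx
    exact sub_eq_zero.mp hx
  obtain ⟨j, hj, hyj, -⟩ := H.exists_addable P S hk hv hTxw hx' hTxy
  set d := c k with hd
  have hadd := hv k (by omega)
  rw [← hd] at hadd
  have hdk := hv.le (i := k) (by omega)
  rw [← hd] at hdk
  have hjd : j ≠ d := hj.ne_of_addBox
  have hjn : j ≤ n := by
    have := (hv.update_succ hj).le (i := k + 1) (by omega)
    rw [Function.update_self] at this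
    omega
  have hxd : jmSum h t v k * x = f d • x := hxw k (by omega)
  have hTxd : jmSum h t v k * (T * x) = f d • (T * x) := hTxw k (by omega)
  have hshift : (jmSum h t v k - y • 1) * (jmPhi h t v k * x) = jmPhi h t v k * (T * x) := by
    rw [hTx, mul_sub, sub_mul, ← mul_assoc (jmSum h t v k), ← H.phi_mul_sum_succ hk,
      smul_mul_assoc, one_mul, mul_smul_comm, mul_assoc]
  have hφT : jmPhi h t v k * (T * x) = 0 := by
    have h2 : (jmSum h t v k - y • 1) * (jmPhi h t v k * (T * x)) = 0 := by
      rw [sub_mul, ← mul_assoc, ← H.phi_mul_sum_succ hk, mul_assoc, hTxy, smul_mul_assoc, one_mul,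
        mul_smul_comm, sub_self]
    have h3 := S.ss k (by omega) y (jmPhi h t v k * x) (by rw [hshift, h2])
    rw [← hshift, sub_mul, h3, smul_mul_assoc, one_mul, sub_self]
  have hADJ : (f d - f j) * (f d - f j) - h * h * (f d * f j - 4) = 0 := by
    have h1 := H.phi_phi hk hTxd (hyj ▸ hTxy)
    rw [hφT, mul_zero] at h1
    exact neg_eq_zero.mp ((smul_eq_zero.mp h1.symm).resolve_right hx')
  have hφφ : jmPhi h t v k * (jmPhi h t v k * x) =
      (h * h * f d + 2 * (f d - f j)) • (T * x) := by
    have e1 : jmSum h t v (k + 1) * x = f j • x + T * x := by rw [hTx, hyj]; abel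
    have e2 : jmSum h t v (k + 1) * (T * x) = f j • (T * x) := by rw [hTxy, hyj]
    rw [← mul_assoc, H.phi_mul_phi hk]
    simp only [sub_mul, mul_sub, smul_mul_assoc, mul_assoc, one_mul, e1, e2, hxd, hTxd, mul_add,
      mul_smul_comm]
    have h4 : ((f d - f j) * (f d - f j) - h * h * (f d * f j - 4)) • x = 0 := by
      rw [hADJ, zero_smul]
    linear_combination (norm := module) -h4
  have hφx : jmPhi h t v k * x ≠ 0 := by
    intro h1
    rw [h1, mul_zero] at hφφ
    exact (smul_ne_zero (P.adj_deriv_ne_zero (by omega) hjn hjd hADJ) hx') hφφ.symm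
  have hφw : jmPhi h t v k * x ∈ wt h t v (f ∘ Function.update c k j) (k + 1) := by
    refine wt_succ (fun i hi => ?_) ?_
    · rw [← mul_assoc, (H.commute_sum_phi hk (by omega) (by omega) (by omega)).eq, mul_assoc,
        hxw i (by omega), mul_smul_comm, Function.comp, Function.comp,
        Function.update_of_ne (by omega)]
    · rw [hφT, sub_mul, smul_mul_assoc, one_mul] at hshift
      rw [sub_eq_zero.mp hshift, Function.comp, Function.update_self, hyj]
  have hv' := (S.valid P (by omega) (fun i hi => ?_) hφw hφx).1
  · have hadd' := hv' k (by omega)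
    rw [Function.update_self, shape_congr (c' := c) (fun i hi => by
      rw [Function.update_of_ne (by omega)])] at hadd'
    have hnon := hadd.nonadjacent hadd' hjd
    have hjn' := hv'.le (i := k) (by omega)
    rw [Function.update_self] at hjn'
    exact P.adj_ne_zero (by omega) (by omega) hjd hnon.1 hnon.2 hADJ
  · by_cases h1 : i = k
    · rw [h1, Function.update_self]; exact hjn
    · rw [Function.update_of_ne h1]
      have := hv.le hi
      omega

theorem wtSpec [FiniteDimensional ℂ R] (hk : k ≤ n) : WtSpec h t v f k := by
  induction k with
  | zero =>
    exact ⟨fun y m _ _ => ⟨0, fun i hi => absurd hi (by omega), fun i hi => absurd hi (by omega),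
      fun i hi => absurd hi (by omega)⟩, fun i hi => absurd hi (by omega)⟩
  | succ k ih =>
    rcases k with _ | k
    · have hX : jmSum h t v 0 = (2 : ℂ) • 1 := by
        rw [jmSum, jm, jmInv, two_smul]
      constructor
      · intro y m hm h0
        refine ⟨0, fun i hi => ?_, fun i hi => ?_, fun i hi _ => ?_⟩
        · obtain rfl : i = 0 := by omega
          simp [Addable, shape]
        · obtain rfl : i = 0 := by omega
          have h1 := hm 0 (by omega)
          rw [hX, smul_mul_assoc, one_mul] at h1
          rw [Pi.zero_apply, P.f_zero]
          exact (smul_left_injective ℂ h0 h1).symm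
        · obtain rfl : i = 0 := by omega
          rw [jm, one_mul]
      · intro i hi y m h1
        obtain rfl : i = 0 := by omega
        rw [hX, ← sub_smul, smul_mul_assoc, one_mul, smul_mul_assoc, one_mul] at h1
        rw [hX, smul_mul_assoc, one_mul]
        rcases smul_eq_zero.mp h1 with h2 | h2
        · rw [sub_eq_zero.mp h2]
        · rw [sub_smul] at h2
          exact sub_eq_zero.mp h2
    · have S := ih (by omega)
      constructor
      · intro y m hm h0
        obtain ⟨c, hv, hyc, hJ⟩ := S.val y m (wt_mono (by omega) hm) h0
        obtain ⟨j, hj, hyj, hj0⟩ := H.exists_addable P S (by omega) hv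
          (wt_congr (fun i hi => hyc i hi) (wt_mono (by omega) hm)) h0 (hm (k + 1) (by omega))
        refine ⟨Function.update c (k + 1) j, hv.update_succ hj, fun i hi => ?_, fun i hi => ?_⟩
        · by_cases h1 : i = k + 1
          · rw [h1, Function.update_self, hyj]
          · rw [Function.update_of_ne h1]
            exact hyc i (by omega)
        · by_cases h1 : i = k + 1
          · rw [h1, Function.update_self]
            exact hj0
          · rw [Function.update_of_ne h1]
            exact hJ i (by omega)
      · intro i hi y m hm
        rcases Nat.lt_succ_iff_lt_or_eq.mp hi with h1 | rfl
        · exact S.ss i h1 y m hm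
        · exact H.jmSum_mul_eq_smul P S (by omega) hm

end HC

end

section

variable {R : Type*} [Ring R] [Algebra ℂ R] {h : ℂ} {n : ℕ} {t v : ℕ → R} {k l : ℕ}

/-- The subalgebra generated by the first generators of both kinds. -/
def hcAdjoin (t v : ℕ → R) (k l : ℕ) : Subalgebra ℂ R :=
  Algebra.adjoin ℂ ({x | ∃ i, i + 1 < k ∧ x = t i} ∪ {x | ∃ j < l, x = v j})

theorem t_mem_hcAdjoin {i : ℕ} (hi : i + 1 < k) : t i ∈ hcAdjoin t v k l :=
  Algebra.subset_adjoin (Or.inl ⟨i, hi, rfl⟩)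

theorem v_mem_hcAdjoin {j : ℕ} (hj : j < l) : v j ∈ hcAdjoin t v k l :=
  Algebra.subset_adjoin (Or.inr ⟨j, hj, rfl⟩)

theorem hcAdjoin_le {A : Subalgebra ℂ R} (h1 : ∀ i, i + 1 < k → t i ∈ A) (h2 : ∀ j < l, v j ∈ A) :
    hcAdjoin t v k l ≤ A := by
  refine Algebra.adjoin_le ?_
  rintro _ (⟨i, hi, rfl⟩ | ⟨j, hj, rfl⟩)
  · exact h1 i hi
  · exact h2 j hj

theorem hcAdjoin_mono {k' l' : ℕ} (hk : k ≤ k') (hl : l ≤ l') :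
    hcAdjoin t v k l ≤ hcAdjoin t v k' l' :=
  hcAdjoin_le (fun i hi => t_mem_hcAdjoin (by omega)) (fun j hj => v_mem_hcAdjoin (by omega))

/-- The elements which can be moved past `g` from right to left, staying in a subalgebra. -/
theorem exists_mul_eq_mul {A : Subalgebra ℂ R} {s : Set R} {g : R}
    (hs : ∀ x ∈ s, ∃ y ∈ A, g * x = y * g) {x : R} (hx : x ∈ Algebra.adjoin ℂ s) :
    ∃ y ∈ A, g * x = y * g := by
  induction hx using Algebra.adjoin_induction with
  | mem x hx => exact hs x hx
  | algebraMap r => exact ⟨algebraMap ℂ R r, A.algebraMap_mem r, (Algebra.commutes r g).symm⟩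
  | add x y _ _ h1 h2 =>
    obtain ⟨a, ha, h1⟩ := h1
    obtain ⟨b, hb, h2⟩ := h2
    exact ⟨a + b, A.add_mem ha hb, by rw [mul_add, h1, h2, add_mul]⟩
  | mul x y _ _ h1 h2 =>
    obtain ⟨a, ha, h1⟩ := h1
    obtain ⟨b, hb, h2⟩ := h2
    exact ⟨a * b, A.mul_mem ha hb, by rw [← mul_assoc, h1, mul_assoc, h2, mul_assoc]⟩

theorem commute_of_mem_adjoin {s : Set R} {g : R} (hs : ∀ x ∈ s, Commute g x) {x : R}
    (hx : x ∈ Algebra.adjoin ℂ s) : Commute g x := by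
  induction hx using Algebra.adjoin_induction with
  | mem x hx => exact hs x hx
  | algebraMap r => exact Algebra.commutes' r g |>.symm
  | add x y _ _ h1 h2 => exact h1.add_right h2
  | mul x y _ _ h1 h2 => exact h1.mul_right h2

theorem commute_of_mem_hcAdjoin {g : R} (h1 : ∀ i, i + 1 < k → Commute g (t i))
    (h2 : ∀ j < l, Commute g (v j)) {x : R} (hx : x ∈ hcAdjoin t v k l) : Commute g x := by
  refine commute_of_mem_adjoin ?_ hx
  rintro _ (⟨i, hi, rfl⟩ | ⟨j, hj, rfl⟩)
  · exact h1 i hi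
  · exact h2 j hj

/-- A subspace stable under generators is stable under the subalgebra they generate. -/
theorem mul_mem_of_mem_hcAdjoin {Q : Submodule ℂ R} (h1 : ∀ i, i + 1 < k → ∀ q ∈ Q, t i * q ∈ Q)
    (h2 : ∀ j < l, ∀ q ∈ Q, v j * q ∈ Q) {x : R} (hx : x ∈ hcAdjoin t v k l) :
    ∀ q ∈ Q, x * q ∈ Q := by
  induction hx using Algebra.adjoin_induction with
  | mem x hx =>
    rcases hx with ⟨i, hi, rfl⟩ | ⟨j, hj, rfl⟩
    · exact h1 i hi
    · exact h2 j hj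
  | algebraMap r =>
    intro q hq
    rw [← Algebra.smul_def]
    exact Q.smul_mem r hq
  | add x y _ _ h1 h2 =>
    intro q hq
    rw [add_mul]
    exact Q.add_mem (h1 q hq) (h2 q hq)
  | mul x y _ _ h1 h2 =>
    intro q hq
    rw [mul_assoc]
    exact h1 _ (h2 q hq)

/-- The decomposition into double cosets with respect to the smaller subalgebra. -/
def DoubleCoset (t v : ℕ → R) (k : ℕ) : Prop :=
  Subalgebra.toSubmodule (hcAdjoin t v (k + 2) (k + 2)) ≤
    Subalgebra.toSubmodule (hcAdjoin t v (k + 1) (k + 2)) ⊔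
      Subalgebra.toSubmodule (hcAdjoin t v (k + 1) (k + 1)) * Submodule.span ℂ {t k} *
        Subalgebra.toSubmodule (hcAdjoin t v (k + 1) (k + 2))

namespace HC

variable (H : HC h n t v)
include H

theorem v_mul_eq_mul_v (hk : k < n) {x : R} (hx : x ∈ hcAdjoin t v k k) :
    ∃ y ∈ hcAdjoin t v k k, v k * x = y * v k := by
  refine exists_mul_eq_mul ?_ hx
  rintro _ (⟨i, hi, rfl⟩ | ⟨j, hj, rfl⟩)
  · exact ⟨t i, t_mem_hcAdjoin hi, (H.tvcomm i k (by omega) hk (by omega) (by omega)).symm⟩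
  · exact ⟨-v j, neg_mem (v_mem_hcAdjoin hj), by
      rw [neg_mul, H.vanti k j hk (by omega) (by omega)]⟩

/-- Adding one Clifford generator. -/
theorem hcAdjoin_succ_right (hk : k < n) {x : R} (hx : x ∈ hcAdjoin t v k (k + 1)) :
    ∃ a ∈ hcAdjoin t v k k, ∃ b ∈ hcAdjoin t v k k, x = a + b * v k := by
  have hmem : ∀ z ∈ hcAdjoin t v k k, ∀ a ∈ hcAdjoin t v k k, ∀ b ∈ hcAdjoin t v k k,
      ∃ a' ∈ hcAdjoin t v k k, ∃ b' ∈ hcAdjoin t v k k, z * (a + b * v k) = a' + b' * v k :=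
    fun z hz a ha b hb => ⟨z * a, mul_mem hz ha, z * b, mul_mem hz hb, by
      rw [mul_add, mul_assoc]⟩
  let Q : Submodule ℂ R :=
    { carrier := {x | ∃ a ∈ hcAdjoin t v k k, ∃ b ∈ hcAdjoin t v k k, x = a + b * v k}
      add_mem' := by
        rintro _ _ ⟨a, ha, b, hb, rfl⟩ ⟨a', ha', b', hb', rfl⟩
        exact ⟨a + a', add_mem ha ha', b + b', add_mem hb hb', by rw [add_mul]; abel⟩
      zero_mem' := ⟨0, zero_mem _, 0, zero_mem _, by simp⟩
      smul_mem' := by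
        rintro c _ ⟨a, ha, b, hb, rfl⟩
        exact ⟨c • a, Subalgebra.smul_mem _ ha c, c • b, Subalgebra.smul_mem _ hb c, by
          rw [smul_add, smul_mul_assoc]⟩ }
  have h1 : x * 1 ∈ Q := by
    refine mul_mem_of_mem_hcAdjoin (Q := Q) ?_ ?_ hx 1 ⟨1, one_mem _, 0, zero_mem _, by simp⟩
    · rintro i hi _ ⟨a, ha, b, hb, rfl⟩
      exact hmem _ (t_mem_hcAdjoin hi) a ha b hb
    · rintro j hj _ ⟨a, ha, b, hb, rfl⟩
      rcases Nat.lt_succ_iff_lt_or_eq.mp hj with hj | rfl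
      · exact hmem _ (v_mem_hcAdjoin hj) a ha b hb
      · obtain ⟨a', ha', h1⟩ := H.v_mul_eq_mul_v hk ha
        obtain ⟨b', hb', h2⟩ := H.v_mul_eq_mul_v hk hb
        exact ⟨b', hb', a', ha', by
          rw [mul_add, h1, ← mul_assoc, h2, mul_assoc, H.vsq _ hk, mul_one, add_comm]⟩
  rwa [mul_one] at h1

/-- Moving a braid generator to the left. -/
theorem mul_t_eq (hk : k + 1 < n) {x : R} (hx : x ∈ hcAdjoin t v k (k + 1)) :
    ∃ a ∈ hcAdjoin t v (k + 1) (k + 2), ∃ b ∈ hcAdjoin t v (k + 1) (k + 2),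
      x * t k = t k * a + b := by
  have hle : hcAdjoin t v k (k + 1) ≤ hcAdjoin t v (k + 1) (k + 2) :=
    hcAdjoin_mono (by omega) (by omega)
  have hvk : v k ∈ hcAdjoin t v (k + 1) (k + 2) := v_mem_hcAdjoin (by omega)
  have hvk' : v (k + 1) ∈ hcAdjoin t v (k + 1) (k + 2) := v_mem_hcAdjoin (by omega)
  induction hx using Algebra.adjoin_induction with
  | mem x hx =>
    rcases hx with ⟨i, hi, rfl⟩ | ⟨j, hj, rfl⟩
    · exact ⟨t i, t_mem_hcAdjoin (by omega), 0, zero_mem _, by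
        rw [add_zero, (H.commute_tt (by omega) hk (by omega) (by omega)).eq]⟩
    · rcases Nat.lt_succ_iff_lt_or_eq.mp hj with hj | rfl
      · exact ⟨v j, v_mem_hcAdjoin (by omega), 0, zero_mem _, by
          rw [add_zero, H.tvcomm k j hk (by omega) (by omega) (by omega)]⟩
      · exact ⟨v (j + 1), hvk', h • (v j - v (j + 1)),
          Subalgebra.smul_mem _ (sub_mem hvk hvk') h, by rw [H.tw j hk]; abel⟩
  | algebraMap r =>
    exact ⟨algebraMap ℂ R r, Subalgebra.algebraMap_mem _ r, 0, zero_mem _, by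
      rw [add_zero, Algebra.commutes]⟩
  | add x y _ _ h1 h2 =>
    obtain ⟨a, ha, b, hb, h1⟩ := h1
    obtain ⟨a', ha', b', hb', h2⟩ := h2
    exact ⟨a + a', add_mem ha ha', b + b', add_mem hb hb', by
      rw [add_mul, h1, h2, mul_add]; abel⟩
  | mul x y hx _ h1 h2 =>
    obtain ⟨a, ha, b, hb, h1⟩ := h1
    obtain ⟨a', ha', b', hb', h2⟩ := h2
    exact ⟨a * a', mul_mem ha ha', b * a' + x * b',
      add_mem (mul_mem hb ha') (mul_mem (hle hx) hb'), by
        rw [mul_assoc, h2, mul_add, ← mul_assoc, h1, add_mul, mul_assoc, add_assoc]⟩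

theorem hcAdjoin_add_two_le_of (hk : k + 1 < n) (ih : ∀ l, k = l + 1 → DoubleCoset t v l) :
    DoubleCoset t v k := by
  show Subalgebra.toSubmodule (hcAdjoin t v (k + 2) (k + 2)) ≤
    Subalgebra.toSubmodule (hcAdjoin t v (k + 1) (k + 2)) ⊔
        Subalgebra.toSubmodule (hcAdjoin t v (k + 1) (k + 1)) * Submodule.span ℂ {t k} *
          Subalgebra.toSubmodule (hcAdjoin t v (k + 1) (k + 2))
  set Q := Subalgebra.toSubmodule (hcAdjoin t v (k + 1) (k + 2)) ⊔
        Subalgebra.toSubmodule (hcAdjoin t v (k + 1) (k + 1)) * Submodule.span ℂ {t k} *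
          Subalgebra.toSubmodule (hcAdjoin t v (k + 1) (k + 2)) with hQ
  have hleAB : hcAdjoin t v (k + 1) (k + 1) ≤ hcAdjoin t v (k + 1) (k + 2) :=
    hcAdjoin_mono (by omega) (by omega)
  have hB : ∀ b ∈ hcAdjoin t v (k + 1) (k + 2), b ∈ Q := fun b hb =>
    Submodule.mem_sup_left hb
  have hAB : ∀ a ∈ hcAdjoin t v (k + 1) (k + 1), ∀ b ∈ hcAdjoin t v (k + 1) (k + 2),
      a * t k * b ∈ Q := fun a ha b hb => Submodule.mem_sup_right
    (Submodule.mul_mem_mul (Submodule.mul_mem_mul ha (Submodule.mem_span_singleton_self _)) hb)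
  have hind : ∀ T : R →ₗ[ℂ] R, (∀ b ∈ hcAdjoin t v (k + 1) (k + 2), T b ∈ Q) →
      (∀ a ∈ hcAdjoin t v (k + 1) (k + 1), ∀ b ∈ hcAdjoin t v (k + 1) (k + 2),
        T (a * t k * b) ∈ Q) → ∀ q ∈ Q, T q ∈ Q := by
    intro T h1 h2 q hq
    have : Q ≤ Q.comap T := by
      rw [hQ, sup_le_iff]
      refine ⟨h1, Submodule.mul_le.mpr fun x hx b hb => ?_⟩
      obtain ⟨a, ha, rfl⟩ := Submodule.mem_mul_span_singleton.mp hx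
      exact h2 a ha b hb
    exact this hq
  have hleft : ∀ x ∈ hcAdjoin t v (k + 1) (k + 1), ∀ q ∈ Q, x * q ∈ Q := fun x hx =>
    hind (LinearMap.mulLeft ℂ x) (fun b hb => hB _ (mul_mem (hleAB hx) hb))
      (fun a ha b hb => by
        rw [LinearMap.mulLeft_apply, ← mul_assoc, ← mul_assoc]
        exact hAB _ (mul_mem hx ha) b hb)
  have hright : ∀ x ∈ hcAdjoin t v (k + 1) (k + 2), ∀ q ∈ Q, q * x ∈ Q := fun x hx =>
    hind (LinearMap.mulRight ℂ x) (fun b hb => hB _ (mul_mem hb hx))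
      (fun a ha b hb => by
        rw [LinearMap.mulRight_apply, mul_assoc]
        exact hAB a ha _ (mul_mem hb hx))
  have htB : ∀ b ∈ hcAdjoin t v (k + 1) (k + 2), t k * b ∈ Q := fun b hb => by
    have := hAB 1 (one_mem _) b hb
    rwa [one_mul] at this
  have hsmall : ∀ x ∈ hcAdjoin t v k (k + 1), t k * x * t k ∈ Q := by
    intro x hx
    obtain ⟨a, ha, b, hb, h1⟩ := H.mul_t_eq hk hx
    rw [mul_assoc, h1, mul_add, ← mul_assoc, H.quad k hk, add_mul, one_mul, smul_mul_assoc]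
    exact Q.add_mem (Q.add_mem (hB a ha) (Q.smul_mem h (htB a ha))) (htB b hb)
  have htat : ∀ a ∈ hcAdjoin t v (k + 1) (k + 1), t k * a * t k ∈ Q := by
    rcases k with _ | k
    · exact fun a ha => hsmall a (hcAdjoin_le (fun i hi => absurd hi (by omega))
        (fun j hj => v_mem_hcAdjoin hj) ha)
    · intro a ha
      have h1 := ih k rfl ha
      let T : R →ₗ[ℂ] R := LinearMap.mulRight ℂ (t (k + 1)) ∘ₗ LinearMap.mulLeft ℂ (t (k + 1))
      suffices h2 : _ ≤ Q.comap T from h2 h1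
      refine sup_le hsmall (Submodule.mul_le.mpr fun x hx b hb => ?_)
      obtain ⟨a, ha, rfl⟩ := Submodule.mem_mul_span_singleton.mp hx
      obtain ⟨c, hc, d, hd, h3⟩ := H.mul_t_eq hk hb
      have hcomm : Commute (t (k + 1)) a := commute_of_mem_hcAdjoin
        (fun i hi => H.commute_tt hk (by omega) (by omega) (by omega))
        (fun j hj => H.tvcomm _ _ hk (by omega) (by omega) (by omega)) ha
      have ha' : a ∈ hcAdjoin t v (k + 2) (k + 2) := hcAdjoin_mono (by omega) (by omega) ha
      have htk : t k ∈ hcAdjoin t v (k + 2) (k + 2) := t_mem_hcAdjoin (by omega)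
      have h4 : T (a * t k * b) = a * (t k * t (k + 1) * (t k * c)) +
          a * (1 * t (k + 1) * (t k * d)) := by
        show t (k + 1) * (a * t k * b) * t (k + 1) = _
        rw [mul_assoc (t (k + 1)), mul_assoc (a * t k) b, h3, mul_assoc a, ← mul_assoc, hcomm.eq,
          mul_assoc a, ← mul_add, one_mul, mul_add, mul_add, ← mul_assoc (t k * t (k + 1)),
          H.braid k hk]
        simp only [mul_assoc]
      show T _ ∈ Q
      rw [h4]
      exact Q.add_mem (hleft a ha' _ (hAB _ htk _ (mul_mem (hleAB htk) hc)))
        (hleft a ha' _ (hAB _ (one_mem _) _ (mul_mem (hleAB htk) hd)))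
  intro x hx
  rw [← mul_one x]
  refine mul_mem_of_mem_hcAdjoin (Q := Q) ?_ ?_ hx 1 (hB 1 (one_mem _))
  · intro i hi
    rcases Nat.lt_succ_iff_lt_or_eq.mp (show i < k + 1 by omega) with h1 | rfl
    · exact hleft _ (t_mem_hcAdjoin (by omega))
    · refine hind (LinearMap.mulLeft ℂ (t i)) htB (fun a ha b hb => ?_)
      rw [LinearMap.mulLeft_apply, ← mul_assoc, ← mul_assoc]
      exact hright b hb _ (htat a ha)
  · intro j hj
    rcases Nat.lt_succ_iff_lt_or_eq.mp hj with h1 | rfl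
    · exact hleft _ (v_mem_hcAdjoin h1)
    · refine hind (LinearMap.mulLeft ℂ (v (k + 1)))
        (fun b hb => hB _ (mul_mem (v_mem_hcAdjoin (by omega)) hb)) (fun a ha b hb => ?_)
      obtain ⟨a', ha', h1⟩ := H.v_mul_eq_mul_v hk ha
      rw [LinearMap.mulLeft_apply, ← mul_assoc, ← mul_assoc, h1, mul_assoc a', ← H.tv k hk,
        ← mul_assoc, mul_assoc _ _ b]
      exact hAB a' ha' _ (mul_mem (v_mem_hcAdjoin (by omega)) hb)

theorem hcAdjoin_add_two_le (hk : k + 1 < n) : DoubleCoset t v k := by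
  induction k with
  | zero => exact H.hcAdjoin_add_two_le_of hk fun l hl => absurd hl (by omega)
  | succ k ih =>
    refine H.hcAdjoin_add_two_le_of hk fun l hl => ?_
    obtain rfl : k = l := by omega
    exact ih (by omega)

theorem hcAdjoin_fg (hk : k ≤ n) : (Subalgebra.toSubmodule (hcAdjoin t v k k)).FG := by
  have hstep : ∀ k < n, (Subalgebra.toSubmodule (hcAdjoin t v k k)).FG →
      (Subalgebra.toSubmodule (hcAdjoin t v k (k + 1))).FG := by
    intro k hk h1
    have h2 : (Subalgebra.toSubmodule (hcAdjoin t v k k) ⊔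
        Subalgebra.toSubmodule (hcAdjoin t v k k) * Submodule.span ℂ {v k}).FG :=
      h1.sup (h1.mul (Submodule.fg_span_singleton _))
    refine Submodule.FG.of_le h2 fun x hx => ?_
    obtain ⟨a, ha, b, hb, rfl⟩ := H.hcAdjoin_succ_right hk hx
    exact Submodule.add_mem_sup ha
      (Submodule.mul_mem_mul hb (Submodule.mem_span_singleton_self _))
  induction k with
  | zero =>
    have : hcAdjoin t v 0 0 = ⊥ := le_bot_iff.mp
      (hcAdjoin_le (fun i hi => absurd hi (by omega)) (fun j hj => absurd hj (by omega)))
    rw [this]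
    exact Subalgebra.fg_bot_toSubmodule
  | succ k ih =>
    have h1 := hstep k (by omega) (ih (by omega))
    rcases k with _ | k
    · refine Submodule.FG.of_le h1 ?_
      exact hcAdjoin_le (fun i hi => absurd hi (by omega)) (fun j hj => v_mem_hcAdjoin hj)
    · exact Submodule.FG.of_le (h1.sup (((ih (by omega)).mul
        (Submodule.fg_span_singleton _)).mul h1)) (H.hcAdjoin_add_two_le (by omega))

theorem finiteDimensional (htop : hcAdjoin t v n n = ⊤) : FiniteDimensional ℂ R := by
  have := H.hcAdjoin_fg le_rfl
  rw [htop, Algebra.top_toSubmodule] at this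
  exact ⟨this⟩

end HC

end

section

variable {R : Type*} [Ring R] [Algebra ℂ R] {h : ℂ} {n : ℕ} {t v : ℕ → R} {k l : ℕ} {f : ℕ → ℂ}
  {c : ℕ → ℕ} {L : Submodule ℂ R} {m : R}

theorem jm_mem_hcAdjoin (k : ℕ) :
    jm h t v k ∈ hcAdjoin t v (k + 1) (k + 1) ∧ jmInv h t v k ∈ hcAdjoin t v (k + 1) (k + 1) := by
  induction k with
  | zero => exact ⟨one_mem _, one_mem _⟩
  | succ k ih =>
    have hle : hcAdjoin t v (k + 1) (k + 1) ≤ hcAdjoin t v (k + 2) (k + 2) :=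
      hcAdjoin_mono (by omega) (by omega)
    have ht : t k ∈ hcAdjoin t v (k + 2) (k + 2) := t_mem_hcAdjoin (by omega)
    have hvv : h • (v k * v (k + 1)) ∈ hcAdjoin t v (k + 2) (k + 2) :=
      Subalgebra.smul_mem _ (mul_mem (v_mem_hcAdjoin (by omega)) (v_mem_hcAdjoin (by omega))) h
    have h1 : h • (1 : R) ∈ hcAdjoin t v (k + 2) (k + 2) := Subalgebra.smul_mem _ (one_mem _) h
    constructor
    · exact mul_mem (mul_mem (add_mem ht hvv) (hle ih.1)) ht
    · exact mul_mem (mul_mem (sub_mem ht h1) (hle ih.2)) (sub_mem (add_mem ht hvv) h1)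

theorem jmSum_mem_hcAdjoin (hk : k < l) : jmSum h t v k ∈ hcAdjoin t v l l :=
  hcAdjoin_mono (by omega) (by omega)
    (add_mem (jm_mem_hcAdjoin (h := h) (t := t) (v := v) k).1 (jm_mem_hcAdjoin k).2)

theorem hcAdjoin_zero : hcAdjoin t v 0 0 = ⊥ := le_bot_iff.mp
  (hcAdjoin_le (fun i hi => absurd hi (by omega)) (fun j hj => absurd hj (by omega)))

theorem le_toSubmodule_mul (A : Subalgebra ℂ R) (L : Submodule ℂ R) :
    L ≤ Subalgebra.toSubmodule A * L := fun x hx => by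
  rw [← one_mul x]
  exact Submodule.mul_mem_mul (one_mem A) hx

namespace HC

variable (H : HC h n t v) (P : GoodParams h f n)
include H

theorem jm_commute_of_mem (hk : k < n) {x : R} (hx : x ∈ hcAdjoin t v k k) :
    Commute (jm h t v k) x ∧ Commute (jmInv h t v k) x := by
  constructor
  · exact commute_of_mem_hcAdjoin
      (fun i hi => (H.commute_t_jm hk (by omega) (by omega) (by omega)).1.symm)
      (fun j hj => (H.commute_v_jm hk (by omega) (by omega)).1.symm) hx
  · exact commute_of_mem_hcAdjoin
      (fun i hi => (H.commute_t_jm hk (by omega) (by omega) (by omega)).2.symm)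
      (fun j hj => (H.commute_v_jm hk (by omega) (by omega)).2.symm) hx

theorem jmSum_commute_of_mem (hk : k < n) {x : R} (hx : x ∈ hcAdjoin t v k k) :
    Commute (jmSum h t v k) x :=
  (H.jm_commute_of_mem hk hx).1.add_left (H.jm_commute_of_mem hk hx).2

omit H in
theorem jmInv_mul_mem (hk : k < n) (hL : L ≤ wt h t v (f ∘ c) n)
    (hJ : ∀ i < n, ∀ m ∈ L, jm h t v i * m ∈ L) (hm : m ∈ L) : jmInv h t v k * m ∈ L := by
  have h1 := hL hm k hk
  rw [jmSum, add_mul] at h1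
  rw [eq_sub_of_add_eq' h1]
  exact L.sub_mem (L.smul_mem _ hm) (hJ k hk m hm)

include P in
theorem toSubmodule_mul_inf_le [FiniteDimensional ℂ R] (hk : k < n) (hL : L ≤ wt h t v (f ∘ c) n)
    (hJ : ∀ i < n, ∀ m ∈ L, jm h t v i * m ∈ L) (hv : ∀ i < n, ∀ m ∈ L, v i * m ∈ L)
    (hm : m ∈ Subalgebra.toSubmodule (hcAdjoin t v (k + 1) (k + 1)) * L)
    (hm' : jmSum h t v k * m = f (c k) • m) :
    m ∈ Subalgebra.toSubmodule (hcAdjoin t v k k) * L := by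
  rcases k with _ | k
  · refine le_toSubmodule_mul _ L ?_
    suffices h1 : Subalgebra.toSubmodule (hcAdjoin t v 1 1) * L ≤ L from h1 hm
    refine Submodule.mul_le.mpr fun a ha l hl => ?_
    exact mul_mem_of_mem_hcAdjoin (fun i hi => absurd hi (by omega))
      (fun j hj => hv j (by omega)) ha l hl
  have S := H.wtSpec P (k := k + 1) (by omega)
  set A := hcAdjoin t v (k + 1) (k + 1) with hA
  set Y := Subalgebra.toSubmodule A * L with hY
  set y := f (c (k + 1)) with hy
  set T : Module.End ℂ R := LinearMap.mulLeft ℂ (jmSum h t v (k + 1)) with hT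
  set Z : Submodule ℂ R := ⨆ z, ⨆ (_ : z ≠ y), T.eigenspace z with hZ
  have hmemT : ∀ z x, x ∈ T.eigenspace z ↔ jmSum h t v (k + 1) * x = z • x := fun z x => by
    rw [Module.End.mem_eigenspace_iff, hT, LinearMap.mulLeft_apply]
  have hind : ∀ {Q : Submodule ℂ R} (g : R), (∀ a ∈ A, ∀ l ∈ L, g * (a * l) ∈ Q) →
      ∀ x ∈ Y, g * x ∈ Q := by
    intro Q g h1 x hx
    suffices h2 : Y ≤ Q.comap (LinearMap.mulLeft ℂ g) from h2 hx
    exact Submodule.mul_le.mpr h1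
  have hmemY : ∀ a ∈ A, ∀ l ∈ L, a * l ∈ Y := fun a ha l hl => Submodule.mul_mem_mul ha hl
  have hAY : ∀ a ∈ A, ∀ x ∈ Y, a * x ∈ Y := fun a ha => hind a fun b hb l hl => by
    rw [← mul_assoc]
    exact hmemY _ (mul_mem ha hb) l hl
  have hcY : ∀ g : R, (∀ a ∈ A, Commute g a) → (∀ l ∈ L, g * l ∈ L) → ∀ x ∈ Y, g * x ∈ Y :=
    fun g h1 h2 => hind g fun b hb l hl => by
      rw [← mul_assoc, (h1 b hb).eq, mul_assoc]
      exact hmemY b hb _ (h2 l hl)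
  have hJY : ∀ x ∈ Y, jm h t v (k + 1) * x ∈ Y :=
    hcY _ (fun a ha => (H.jm_commute_of_mem hk ha).1) (hJ _ hk)
  have hJY' : ∀ x ∈ Y, jmInv h t v (k + 1) * x ∈ Y :=
    hcY _ (fun a ha => (H.jm_commute_of_mem hk ha).2) (fun l hl => jmInv_mul_mem hk hL hJ hl)
  have hvY : ∀ x ∈ Y, v (k + 1) * x ∈ Y := hind _ fun b hb l hl => by
    obtain ⟨b', hb', h1⟩ := H.v_mul_eq_mul_v hk hb
    rw [← mul_assoc, h1, mul_assoc]
    exact hmemY b' hb' _ (hv _ hk l hl)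
  have hYy : ∀ x ∈ Y, jmSum h t v (k + 1) * x = y • x := by
    intro x hx
    suffices h2 : Y ≤ T.eigenspace y from (hmemT y x).mp (h2 hx)
    refine Submodule.mul_le.mpr fun a ha l hl => ?_
    rw [hmemT, ← mul_assoc, (H.jmSum_commute_of_mem hk ha).eq, mul_assoc, hL hl (k + 1) hk,
      mul_smul_comm, Function.comp]
  have hBY : ∀ b ∈ hcAdjoin t v (k + 1) (k + 2), ∀ x ∈ Y, b * x ∈ Y := by
    intro b hb x hx
    obtain ⟨a, ha, a', ha', rfl⟩ := H.hcAdjoin_succ_right hk hb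
    rw [add_mul, mul_assoc]
    exact Y.add_mem (hAY a ha x hx) (hAY a' ha' _ (hvY x hx))
  have hAZ : ∀ a ∈ A, ∀ x ∈ Z, a * x ∈ Z := by
    intro a ha x hx
    suffices h2 : Z ≤ Z.comap (LinearMap.mulLeft ℂ a) from h2 hx
    refine iSup₂_le fun z hz w hw => ?_
    refine Submodule.mem_iSup_of_mem z (Submodule.mem_iSup_of_mem hz ?_)
    rw [hmemT] at hw
    rw [hmemT, LinearMap.mulLeft_apply, ← mul_assoc, (H.jmSum_commute_of_mem hk ha).eq, mul_assoc,
      hw, mul_smul_comm]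
  have hψY : ∀ x ∈ Y, jmPsi h t v k * x ∈ Y := by
    intro x hx
    have hJk := (jm_mem_hcAdjoin (h := h) (t := t) (v := v) k).2
    have h1 : v k * (v (k + 1) * x) ∈ Y := hAY _ (v_mem_hcAdjoin (by omega)) _ (hvY _ hx)
    rw [jmPsi, psi, sub_mul, sub_mul, mul_assoc, mul_assoc, sub_mul]
    exact Y.sub_mem (Y.sub_mem (hJY _ hx) (hAY _ hJk _ hx))
      (Y.sub_mem (hJY' _ h1) (hAY _ hJk _ h1))
  have htY : ∀ x ∈ Y, t k * x ∈ Y ⊔ Z := by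
    by_contra hcon
    obtain ⟨w, hw, hw', ys, hys⟩ := exists_joint_eigenvector (X := jmSum h t v) (k := k + 1)
      (p := Y) (p' := (Y ⊔ Z).comap (LinearMap.mulLeft ℂ (t k)))
      (fun i hi j hj => (H.commute_sum_sum (by omega) (by omega)).eq) S.ss
      (fun i hi => hAY _ (jmSum_mem_hcAdjoin hi)) hcon
    have hw0 : w ≠ 0 := by
      rintro rfl
      exact hw' (Submodule.zero_mem _)
    obtain ⟨c', hv', hyc, -⟩ := S.val ys w hys hw0
    have hne : y - f (c' k) ≠ 0 := sub_ne_zero.mpr fun h1 => hw0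
      (H.eq_zero_of_eq_eigenvalue P S hk hv' (wt_congr hyc hys) (by rw [hYy w hw, h1]))
    have hxk : jmSum h t v k * w = f (c' k) • w := by
      rw [hys k (by omega), hyc k (by omega)]
    have hφ : jmPhi h t v k * w = (y - f (c' k)) • (t k * w) - h • (jmPsi h t v k * w) := by
      rw [H.phi_eq hk, sub_mul, mul_assoc, sub_mul, hYy w hw, hxk, smul_mul_assoc, ← sub_smul,
        mul_smul_comm]
    have hφZ : jmPhi h t v k * w ∈ Z := by
      refine Submodule.mem_iSup_of_mem (f (c' k)) (Submodule.mem_iSup_of_mem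
        (fun h1 => hne (by rw [h1, sub_self])) ?_)
      rw [hmemT, ← mul_assoc, ← H.phi_mul_sum hk, mul_assoc, hxk, mul_smul_comm]
    have h1 : t k * w = (y - f (c' k))⁻¹ • (h • (jmPsi h t v k * w) + jmPhi h t v k * w) := by
      rw [hφ, add_sub_cancel, inv_smul_smul₀ hne]
    refine hw' ?_
    show t k * w ∈ Y ⊔ Z
    rw [h1]
    exact Submodule.smul_mem _ _ (Submodule.add_mem_sup (Y.smul_mem _ (hψY w hw)) hφZ)
  have hmYZ : m ∈ Y ⊔ Z := by
    suffices h1 : Subalgebra.toSubmodule (hcAdjoin t v (k + 2) (k + 2)) * L ≤ Y ⊔ Z from h1 hm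
    refine Submodule.mul_le.mpr fun x hx l hl => ?_
    have hl' : l ∈ Y := le_toSubmodule_mul A L hl
    have h1 := H.hcAdjoin_add_two_le hk hx
    suffices h2 : _ ≤ (Y ⊔ Z).comap (LinearMap.mulRight ℂ l) from h2 h1
    refine sup_le (fun b hb => Submodule.mem_sup_left (hBY b hb l hl'))
      (Submodule.mul_le.mpr fun g hg b hb => ?_)
    obtain ⟨a, ha, rfl⟩ := Submodule.mem_mul_span_singleton.mp hg
    rw [Submodule.mem_comap, LinearMap.mulRight_apply, mul_assoc, mul_assoc]
    obtain ⟨y₁, hy₁, z₁, hz₁, h3⟩ := Submodule.mem_sup.mp (htY _ (hBY b hb l hl'))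
    rw [← h3, mul_add]
    exact Submodule.add_mem_sup (hAY a ha y₁ hy₁) (hAZ a ha z₁ hz₁)
  obtain ⟨u, hu, z, hz, rfl⟩ := Submodule.mem_sup.mp hmYZ
  have hzy : z ∈ T.eigenspace y := by
    have h1 := hYy u hu
    rw [mul_add, smul_add, h1] at hm'
    exact (hmemT y z).mpr (add_left_cancel hm')
  have hz0 : z = 0 := (Submodule.disjoint_def.mp (T.eigenspaces_iSupIndep y)) z hzy hz
  rw [hz0, add_zero]
  exact hu

include P in
/-- The left ideal generated by a stable subspace of a weight space meets that weight space in the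
subspace. -/
theorem mem_of_mem_mul_wt [FiniteDimensional ℂ R] (hL : L ≤ wt h t v (f ∘ c) n)
    (hJ : ∀ i < n, ∀ m ∈ L, jm h t v i * m ∈ L) (hv : ∀ i < n, ∀ m ∈ L, v i * m ∈ L)
    (hm : m ∈ Subalgebra.toSubmodule (hcAdjoin t v n n) * L) (hm' : m ∈ wt h t v (f ∘ c) n) :
    m ∈ L := by
  have key : ∀ k ≤ n, m ∈ Subalgebra.toSubmodule (hcAdjoin t v k k) * L → m ∈ L := by
    intro k hk
    induction k with
    | zero =>
      rw [hcAdjoin_zero, Algebra.toSubmodule_bot, one_mul]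
      exact id
    | succ k ih =>
      intro h1
      exact ih (by omega) (H.toSubmodule_mul_inf_le P hk hL hJ hv h1 (hm' k (by omega)))
  exact key n le_rfl hm

end HC

end

section

variable {R : Type*} [Ring R] [Algebra ℂ R]

/-- A projection onto `N` can be averaged so as to commute with anticommuting or commuting elements
having scalar squares. -/
theorem exists_equivariant_projection {ι : Type*} (s : Finset ι) {g : ι → R} {W N : Submodule ℂ R}
    (hNW : N ≤ W) (hN : ∀ i ∈ s, ∀ x ∈ N, g i * x ∈ N) (hW : ∀ i ∈ s, ∀ x ∈ W, g i * x ∈ W)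
    (hsq : ∀ i ∈ s, (∀ x ∈ W, g i * x = 0) ∨ ∃ z : ℂ, z ≠ 0 ∧ ∀ x ∈ W, g i * (g i * x) = z • x)
    (hcomm : ∀ i ∈ s, ∀ j ∈ s, ∃ e : ℂ, e * e = 1 ∧
      ∀ x, g i * (g j * x) = e • (g j * (g i * x))) :
    ∃ p : R →ₗ[ℂ] R, (∀ x ∈ N, p x = x) ∧ (∀ x ∈ W, p x ∈ N) ∧
      ∀ i ∈ s, ∀ x ∈ W, p (g i * x) = g i * p x := by
  classical
  induction s using Finset.induction_on with
  | empty =>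
    obtain ⟨p, hp⟩ := N.subtype.exists_leftInverse_of_injective
      (LinearMap.ker_eq_bot.mpr N.injective_subtype)
    refine ⟨N.subtype ∘ₗ p, fun x hx => ?_, fun x _ => (p x).2, by simp⟩
    exact congrArg Subtype.val (LinearMap.congr_fun hp ⟨x, hx⟩)
  | insert a s _ ih =>
    obtain ⟨p, hp1, hp2, hp3⟩ := ih (fun i hi => hN i (Finset.mem_insert_of_mem hi))
      (fun i hi => hW i (Finset.mem_insert_of_mem hi))
      (fun i hi => hsq i (Finset.mem_insert_of_mem hi))
      (fun i hi j hj => hcomm i (Finset.mem_insert_of_mem hi) j (Finset.mem_insert_of_mem hj))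
    have ha := Finset.mem_insert_self a s
    rcases hsq a ha with h0 | ⟨z, hz, hz'⟩
    · refine ⟨p, hp1, hp2, fun i hi x hx => ?_⟩
      rcases Finset.mem_insert.mp hi with rfl | hi
      · rw [h0 x hx, map_zero, h0 _ (hNW (hp2 x hx))]
      · exact hp3 i hi x hx
    · let p' : R →ₗ[ℂ] R := (2⁻¹ : ℂ) • (p + z⁻¹ • (LinearMap.mulLeft ℂ (g a) ∘ₗ p ∘ₗ
        LinearMap.mulLeft ℂ (g a)))
      have hp' : ∀ x, p' x = (2⁻¹ : ℂ) • (p x + z⁻¹ • (g a * p (g a * x))) := fun x => rfl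
      refine ⟨p', fun x hx => ?_, fun x hx => ?_, fun i hi x hx => ?_⟩
      · rw [hp', hp1 x hx, hp1 _ (hN a ha x hx), hz' x (hNW hx), inv_smul_smul₀ hz, ← two_smul ℂ,
          inv_smul_smul₀ two_ne_zero]
      · rw [hp']
        exact N.smul_mem _ (N.add_mem (hp2 x hx)
          (N.smul_mem _ (hN a ha _ (hp2 _ (hW a ha x hx)))))
      rw [hp', hp', mul_smul_comm, mul_add, mul_smul_comm]
      rcases Finset.mem_insert.mp hi with rfl | hi
      · rw [hz' x hx, map_smul, mul_smul_comm, inv_smul_smul₀ hz,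
          hz' _ (hNW (hp2 _ (hW i ha x hx))), inv_smul_smul₀ hz, add_comm]
      · obtain ⟨e, he, he'⟩ := hcomm a ha i (Finset.mem_insert_of_mem hi)
        rw [he', map_smul, hp3 i hi x hx, hp3 i hi _ (hW a ha x hx), mul_smul_comm, he',
          smul_smul e, he, one_smul]

end

section

variable {R : Type*} [Ring R] [Algebra ℂ R] {h : ℂ} {n : ℕ} {t v : ℕ → R} {f : ℕ → ℂ} {c : ℕ → ℕ}
  {N : Submodule ℂ R}

namespace HC

variable (H : HC h n t v) (P : GoodParams h f n)
include H P

theorem exists_stable_compl [FiniteDimensional ℂ R] (hc : ValidSeq c n)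
    (hNW : N ≤ wt h t v (f ∘ c) n)
    (hJ : ∀ i < n, ∀ m ∈ N, jm h t v i * m ∈ N) (hv : ∀ i < n, ∀ m ∈ N, v i * m ∈ N) :
    ∃ L ≤ wt h t v (f ∘ c) n, (∀ i < n, ∀ m ∈ L, jm h t v i * m ∈ L) ∧
      (∀ i < n, ∀ m ∈ L, v i * m ∈ L) ∧ N ⊓ L = ⊥ ∧ wt h t v (f ∘ c) n ≤ N ⊔ L := by
  set W := wt h t v (f ∘ c) n with hWdef
  have hX : ∀ i < n, ∀ x ∈ W, jm h t v i * x + jmInv h t v i * x = f (c i) • x := fun i hi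
      x hx => by
    rw [← add_mul]; exact hx i hi
  let g : ℕ ⊕ ℕ → R := Sum.elim v fun i => jm h t v i - jmInv h t v i
  have hJ' : ∀ i < n, ∀ m ∈ N, jmInv h t v i * m ∈ N := fun i hi m hm =>
    jmInv_mul_mem hi hNW hJ hm
  have hcomm : ∀ {a b : R} {e : ℂ}, e * e = 1 → a * b = e • (b * a) →
      ∃ e : ℂ, e * e = 1 ∧ ∀ x, a * (b * x) = e • (b * (a * x)) := fun {a b e} h1 h2 =>
    ⟨e, h1, fun x => by rw [← mul_assoc, h2, smul_mul_assoc, mul_assoc]⟩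
  have hdv : ∀ i < n, ∀ j < n, ∃ e : ℂ, e * e = 1 ∧
      v i * (jm h t v j - jmInv h t v j) = e • ((jm h t v j - jmInv h t v j) * v i) := by
    intro i hi j hj
    obtain ⟨-, -, h3, h4, h5, h6⟩ := H.jm_basic hj
    rw [mul_sub, sub_mul]
    by_cases hij : i = j
    · subst hij
      refine ⟨-1, by norm_num, ?_⟩
      rw [h3, h4, neg_one_smul, neg_sub]
    · refine ⟨1, by norm_num, ?_⟩
      rw [h5 i hi hij, h6 i hi hij, one_smul]
  have hproj := exists_equivariant_projection
    ((Finset.range n).disjSum (Finset.range n)) (g := g) hNW ?_ ?_ ?_ ?_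
  · obtain ⟨p, hp1, hp2, hp3⟩ := hproj
    have hpv : ∀ i < n, ∀ x ∈ W, p (v i * x) = v i * p x := fun i hi =>
      hp3 (Sum.inl i) (Finset.inl_mem_disjSum.mpr (Finset.mem_range.mpr hi))
    have hpd : ∀ i < n, ∀ x ∈ W, p ((jm h t v i - jmInv h t v i) * x) =
        (jm h t v i - jmInv h t v i) * p x := fun i hi =>
      hp3 (Sum.inr i) (Finset.inr_mem_disjSum.mpr (Finset.mem_range.mpr hi))
    have hjm : ∀ i < n, ∀ x ∈ W, jm h t v i * x =
        (2⁻¹ : ℂ) • (f (c i) • x + (jm h t v i - jmInv h t v i) * x) := fun i hi x hx => by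
      rw [← hX i hi x hx, sub_mul, add_add_sub_cancel, ← two_smul ℂ, inv_smul_smul₀ two_ne_zero]
    refine ⟨W ⊓ LinearMap.ker p, inf_le_left, fun i hi m hm => ⟨H.jm_mem_wt hi le_rfl hm.1, ?_⟩,
      fun i hi m hm => ⟨H.v_mem_wt hi le_rfl hm.1, ?_⟩, ?_, fun x hx => ?_⟩
    · show p _ = 0
      rw [hjm i hi m hm.1, map_smul, map_add, map_smul, hpd i hi m hm.1,
        show p m = 0 from hm.2, smul_zero, mul_zero, add_zero, smul_zero]
    · show p _ = 0
      rw [hpv i hi m hm.1, show p m = 0 from hm.2, mul_zero]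
    · rw [eq_bot_iff]
      rintro x ⟨hx, -, hx'⟩
      exact (hp1 x hx).symm.trans hx'
    · have h1 := hp2 x hx
      rw [← add_sub_cancel (p x) x]
      refine Submodule.add_mem_sup h1 ⟨W.sub_mem hx (hNW h1), ?_⟩
      show p _ = 0
      rw [map_sub, hp1 _ h1, sub_self]
  · rintro (i | i) hi x hx
    · exact hv i (by simpa using hi) x hx
    · have hi : i < n := by simpa using hi
      show (_ - _) * x ∈ N
      rw [sub_mul]
      exact N.sub_mem (hJ i hi x hx) (hJ' i hi x hx)
  · rintro (i | i) hi x hx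
    · exact H.v_mem_wt (by simpa using hi) le_rfl hx
    · have hi : i < n := by simpa using hi
      show (_ - _) * x ∈ W
      rw [sub_mul]
      exact W.sub_mem (H.jm_mem_wt hi le_rfl hx) (H.jmInv_mem_wt hi le_rfl hx)
  · rintro (i | i) hi
    · refine Or.inr ⟨1, one_ne_zero, fun x _ => ?_⟩
      show v i * (v i * x) = _
      rw [← mul_assoc, H.vsq i (by simpa using hi), one_mul, one_smul]
    · have hi : i < n := by simpa using hi
      obtain ⟨h1, h2, -⟩ := H.jm_basic hi
      by_cases h0 : c i = 0
      · left
        intro x hx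
        show (_ - _) * x = 0
        by_cases hx0 : x = 0
        · rw [hx0, mul_zero]
        have h3 := ((H.wtSpec P le_rfl).valid P le_rfl (fun i hi => (hc.le hi).trans hi.le)
          hx hx0).2 i hi h0
        have h4 : jmInv h t v i * x = x := by
          nth_rewrite 1 [← h3]
          rw [← mul_assoc, h2, one_mul]
        rw [sub_mul, h3, h4, sub_self]
      · right
        refine ⟨f (c i) ^ 2 - 4, sub_ne_zero.mpr (P.sq_ne _ (by omega)
          ((hc.le hi).trans_lt hi)), fun x hx => ?_⟩
        have h3 : (jm h t v i - jmInv h t v i) * (jm h t v i - jmInv h t v i) =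
            jmSum h t v i * jmSum h t v i - (4 : ℂ) • 1 := by
          simp only [jmSum, sub_mul, mul_sub, add_mul, mul_add, h1, h2]
          module
        show (_ - _) * ((_ - _) * x) = _
        rw [← mul_assoc, h3, sub_mul, mul_assoc, hx i hi, mul_smul_comm, hx i hi, smul_mul_assoc,
          one_mul, smul_smul, ← sub_smul, sq]
        rfl
  · rintro (i | i) hi (j | j) hj
    · have hi : i < n := by simpa using hi
      have hj : j < n := by simpa using hj
      by_cases hij : i = j
      · subst hij
        exact hcomm (e := 1) (by norm_num) (one_smul _ _).symm
      · exact hcomm (e := -1) (by norm_num) ((H.vanti i j hi hj hij).trans (neg_one_smul _ _).symm)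
    · obtain ⟨e, h1, h2⟩ := hdv i (by simpa using hi) j (by simpa using hj)
      exact hcomm h1 h2
    · obtain ⟨e, h1, h2⟩ := hdv j (by simpa using hj) i (by simpa using hi)
      refine hcomm (e := e) h1 ?_
      show (_ - _) * v j = e • (v j * (_ - _))
      rw [h2, smul_smul, h1, one_smul]
    · obtain ⟨h1, h2, h3, h4⟩ := H.commute_jm_jm (i := i) (j := j) (by simpa using hi)
        (by simpa using hj)
      refine hcomm (e := 1) (by norm_num) ?_
      rw [one_smul]
      exact (h1.sub_right h2).sub_left (h3.sub_right h4)

end HC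

end

section

variable {R : Type*} [Ring R] [Algebra ℂ R] {h : ℂ} {n : ℕ} {t v : ℕ → R} {f : ℕ → ℂ}
  {c c' : ℕ → ℕ} {m : R}

/-- One content sequence is obtained from the other by exchanging two neighbouring contents which
are not adjacent. -/
def SwapStep (n : ℕ) (c c' : ℕ → ℕ) : Prop :=
  ValidSeq c n ∧ ∃ i, i + 1 < n ∧ c (i + 1) ≠ c i + 1 ∧ c (i + 1) + 1 ≠ c i ∧ c' = swapSeq i c

/-- One content sequence is obtained from the other by admissible exchanges. -/
def Linked (n : ℕ) : (ℕ → ℕ) → (ℕ → ℕ) → Prop := Relation.ReflTransGen (SwapStep n)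

theorem Linked.valid (hl : Linked n c' c) (hc : ValidSeq c n) : ValidSeq c' n := by
  rcases Relation.ReflTransGen.cases_head hl with rfl | ⟨_, h1, -⟩
  · exact hc
  · exact h1.1

namespace HC

variable (H : HC h n t v)
include H

theorem psi_mul_mem_wt {y : ℕ → ℂ} {i : ℕ} (hi : i + 1 < n) (hm : m ∈ wt h t v y n) :
    jmPsi h t v i * m ∈ wt h t v y n :=
  mul_mem_wt (fun _ hj => (H.commute_sum_psi hi hj).symm) hm

theorem exists_eq_of_mem_iSup_wt {S : Set (ℕ → ℕ)} {y : ℕ → ℂ} (hm : m ∈ wt h t v y n)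
    (hm0 : m ≠ 0) (hS : m ∈ ⨆ c ∈ S, wt h t v (f ∘ c) n) : ∃ c ∈ S, ∀ i < n, y i = f (c i) := by
  by_contra! hcon
  let T : Fin n → Module.End ℂ R := fun i => LinearMap.mulLeft ℂ (jmSum h t v i)
  have hle : ∀ z : ℕ → ℂ, wt h t v z n ≤ ⨅ i, (T i).maxGenEigenspace (z i) := fun z x hx => by
    refine (Submodule.mem_iInf _).mpr fun i => ?_
    refine (T i).mem_maxGenEigenspace _ _ |>.mpr ⟨1, ?_⟩
    rw [pow_one, LinearMap.sub_apply]
    exact sub_eq_zero.mpr (hx i i.2)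
  have hind := Module.End.independent_iInf_maxGenEigenspace_of_forall_mapsTo T fun i j φ =>
    Module.End.mapsTo_maxGenEigenspace_of_comm (f := T j) (g := T i) (LinearMap.ext fun x => by
      show jmSum h t v j * (jmSum h t v i * x) = jmSum h t v i * (jmSum h t v j * x)
      rw [← mul_assoc, (H.commute_sum_sum j.2 i.2).eq, mul_assoc]) φ
  refine hm0 (Submodule.disjoint_def.mp (hind fun i : Fin n => y i) m (hle y hm) ?_)
  suffices h1 : ⨆ c ∈ S, wt h t v (f ∘ c) n ≤ _ from h1 hS
  refine iSup₂_le fun c hc => ?_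
  obtain ⟨i, hi, h2⟩ := hcon c hc
  refine (hle (f ∘ c)).trans (le_iSup₂_of_le (fun i : Fin n => (f ∘ c) i) (fun h3 => h2 ?_) le_rfl)
  exact (congrFun h3 ⟨i, hi⟩).symm

variable (P : GoodParams h f n)
include P

/-- The sum of the weight spaces in a linkage class is a left ideal. -/
theorem mul_mem_iSup_wt [FiniteDimensional ℂ R] (hc : ValidSeq c n) {x : R}
    (hx : x ∈ hcAdjoin t v n n) (hm : m ∈ ⨆ c' ∈ {c' | Linked n c' c}, wt h t v (f ∘ c') n) :
    x * m ∈ ⨆ c' ∈ {c' | Linked n c' c}, wt h t v (f ∘ c') n := by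
  set Q := ⨆ c' ∈ {c' | Linked n c' c}, wt h t v (f ∘ c') n with hQ
  have hle : ∀ c', Linked n c' c → wt h t v (f ∘ c') n ≤ Q := fun c' hc' =>
    le_iSup₂_of_le c' hc' le_rfl
  have hind : ∀ g : R, (∀ c', Linked n c' c → ∀ m ∈ wt h t v (f ∘ c') n, g * m ∈ Q) →
      ∀ m ∈ Q, g * m ∈ Q := by
    intro g hg m hm
    suffices h1 : Q ≤ Q.comap (LinearMap.mulLeft ℂ g) from h1 hm
    exact iSup₂_le hg
  refine mul_mem_of_mem_hcAdjoin (fun i hi => hind _ fun c' hc' w hw => ?_)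
    (fun j hj => hind _ fun c' hc' w hw => hle c' hc' (H.v_mem_wt hj le_rfl hw)) hx m hm
  have hv := hc'.valid hc
  by_cases hw0 : w = 0
  · rw [hw0, mul_zero]
    exact Q.zero_mem
  have hle1 := hv.le hi
  have hle2 := hv.le (i := i) (by omega)
  have hδ : f (c' (i + 1)) - f (c' i) ≠ 0 := sub_ne_zero.mpr fun h1 =>
    hv.succ_ne hi (P.inj _ _ (by omega) (by omega) h1)
  have hψ := H.psi_mul_mem_wt hi hw
  have hφQ : jmPhi h t v i * w ∈ Q := by
    have h1 := H.phi_mem_wt hi le_rfl hw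
    by_cases hadj : c' (i + 1) ≠ c' i + 1 ∧ c' (i + 1) + 1 ≠ c' i
    · refine hle (swapSeq i c') (Relation.ReflTransGen.head ?_ hc') h1
      refine ⟨(hv.swapSeq hi hadj.1 hadj.2).1, i, hi, ?_, ?_, (swapSeq_swapSeq i c').symm⟩
      · rw [swapSeq_left, swapSeq_right]
        exact hadj.2.symm
      · rw [swapSeq_left, swapSeq_right]
        exact hadj.1.symm
    · have h2 : jmPhi h t v i * w = 0 := by
        by_contra hne
        have hb : ∀ j < n, swapSeq i c' j ≤ n := by
          intro j hj
          have hj' := hv.le hj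
          by_cases h3 : j = i
          · subst h3
            rw [swapSeq_left]
            omega
          by_cases h4 : j = i + 1
          · subst h4
            rw [swapSeq_right]
            omega
          rw [swapSeq_of_ne _ h3 h4]
          omega
        rw [swapSeq_comp] at h1
        have h3 := ((H.wtSpec P le_rfl).valid P le_rfl hb h1 hne).1
        have a1 := hv i (by omega)
        have a2 := hv (i + 1) hi
        have b1 := h3 i (by omega)
        rw [swapSeq_left, shape_congr fun j hj => swapSeq_of_ne c' (by omega) (by omega)] at b1
        have h4 := a1.nonadjacent b1 (hv.succ_ne hi)
        exact hadj h4
      rw [h2]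
      exact Q.zero_mem
  have h2 : t i * w = (f (c' (i + 1)) - f (c' i))⁻¹ •
      (jmPhi h t v i * w + h • (jmPsi h t v i * w)) := by
    rw [H.phi_eq hi, sub_mul, mul_assoc, sub_mul, hw _ hi, hw i (by omega), smul_mul_assoc,
      sub_add_cancel, ← sub_smul, mul_smul_comm]
    exact (inv_smul_smul₀ hδ _).symm
  rw [h2]
  exact Q.smul_mem _ (Q.add_mem hφQ (Q.smul_mem _ (hle c' hc' hψ)))

theorem exists_mem_wt_of_linked (hl : Linked n c' c) {Q : Submodule R R} (hm : m ∈ Q)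
    (hm' : m ∈ wt h t v (f ∘ c') n) (hm0 : m ≠ 0) :
    ∃ m ∈ Q, m ∈ wt h t v (f ∘ c) n ∧ m ≠ 0 := by
  induction hl with
  | refl => exact ⟨m, hm, hm', hm0⟩
  | tail _ hs ih =>
    obtain ⟨hv, i, hi, h1, h2, rfl⟩ := hs
    obtain ⟨w, hw, hw', hw0⟩ := ih
    refine ⟨jmPhi h t v i * w, Q.smul_mem _ hw, ?_, fun h0 => hw0 ?_⟩
    · rw [← swapSeq_comp]
      exact H.phi_mem_wt hi le_rfl hw'
    · exact H.phi_injective P hi ((hv.le (by omega)).trans_lt (by omega))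
        ((hv.le hi).trans_lt hi) (hv.succ_ne hi) h1 h2 (hw' i (by omega)) (hw' _ hi) h0

theorem isSemisimpleRing (htop : hcAdjoin t v n n = ⊤) : IsSemisimpleRing R := by
  have hfd : FiniteDimensional ℂ R := H.finiteDimensional htop
  have hart : IsNoetherianRing R := isNoetherian_of_tower ℂ inferInstance
  have S := H.wtSpec P (k := n) le_rfl
  have hcX : ∀ i < n, ∀ j < n, jmSum h t v i * jmSum h t v j = jmSum h t v j * jmSum h t v i :=
    fun i hi j hj => (H.commute_sum_sum hi hj).eq
  have hrs : ∀ (Q : Submodule R R) (x m : R), m ∈ Q → x * m ∈ Q := fun Q x m hm => Q.smul_mem x hm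
  have : ComplementedLattice (Submodule R R) := by
    refine ⟨fun N => ?_⟩
    obtain ⟨K, hK, hmax⟩ := WellFounded.has_min
      (wellFounded_gt (α := Submodule R R)) {K | Disjoint N K} ⟨⊥, disjoint_bot_right⟩
    refine ⟨K, hK, codisjoint_iff.mpr ?_⟩
    by_contra hne
    have hK0 : ∀ x ∈ N, x ∈ K → x = 0 := fun x h1 h2 => (Submodule.disjoint_def.mp hK) x h1 h2
    obtain ⟨m, -, hm, y, hy⟩ := exists_joint_eigenvector hcX S.ss
      (p := ⊤) (p' := (N ⊔ K).restrictScalars ℂ) (fun _ _ _ _ => trivial)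
      (fun h1 => hne (eq_top_iff.mpr h1))
    have hm0 : m ≠ 0 := by
      rintro rfl
      exact hm (N ⊔ K).zero_mem
    obtain ⟨c, hc, hyc, -⟩ := S.val y m hy hm0
    set W := wt h t v (f ∘ c) n with hW
    have hmW : m ∈ W := wt_congr hyc hy
    set M : Submodule ℂ R := (N ⊔ K).restrictScalars ℂ ⊓ W with hM
    obtain ⟨L, hLW, hLJ, hLv, hML, hWML⟩ := H.exists_stable_compl P hc (N := M) inf_le_right
      (fun i hi x hx => ⟨hrs (N ⊔ K) _ x hx.1, H.jm_mem_wt hi le_rfl hx.2⟩)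
      (fun i hi x hx => ⟨hrs (N ⊔ K) _ x hx.1, H.v_mem_wt hi le_rfl hx.2⟩)
    set A := Subalgebra.toSubmodule (hcAdjoin t v n n) * L with hA
    let G : Submodule R R :=
      { A with
        smul_mem' := fun x a ha => by
          suffices h1 : A ≤ A.comap (LinearMap.mulLeft ℂ x) from h1 ha
          refine Submodule.mul_le.mpr fun b hb l hl => ?_
          show x * (b * l) ∈ A
          rw [← mul_assoc]
          refine Submodule.mul_mem_mul ?_ hl
          rw [htop]
          trivial }
    have hLG : ∀ l ∈ L, l ∈ G := fun l hl => le_toSubmodule_mul _ L hl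
    have hnd : ¬ Disjoint N (K ⊔ G) := by
      intro hd
      refine hmax (K ⊔ G) hd (lt_of_le_of_ne le_sup_left fun h1 => hm ?_)
      have hGK : G ≤ K := by rw [h1]; exact le_sup_right
      have h2 : W ≤ M := hWML.trans (sup_le le_rfl fun l hl =>
        ⟨(le_sup_right : K ≤ N ⊔ K) (hGK (hLG l hl)), hLW hl⟩)
      exact (h2 hmW).1
    have hQ : ¬ ((N ⊔ K) ⊓ G).restrictScalars ℂ ≤ ⊥ := by
      intro hbot
      refine hnd (Submodule.disjoint_def.mpr fun p hp hp' => ?_)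
      obtain ⟨k, hk, l, hl, rfl⟩ := Submodule.mem_sup.mp hp'
      have h1 : l = 0 := by
        refine hbot ⟨?_, hl⟩
        rw [show l = (k + l) - k by abel]
        exact Submodule.sub_mem _ ((le_sup_left : N ≤ N ⊔ K) hp) ((le_sup_right : K ≤ N ⊔ K) hk)
      rw [h1, add_zero] at hp ⊢
      exact hK0 k hp hk
    obtain ⟨l, hl, hl0, z, hz⟩ := exists_joint_eigenvector hcX S.ss
      (fun i _ x hx => hrs ((N ⊔ K) ⊓ G) _ x hx) hQ
    have hAle : A ≤ ⨆ c' ∈ {c' | Linked n c' c}, wt h t v (f ∘ c') n :=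
      Submodule.mul_le.mpr fun x hx l hl => H.mul_mem_iSup_wt P hc hx
        ((le_iSup₂_of_le c Relation.ReflTransGen.refl le_rfl :
          W ≤ ⨆ c' ∈ {c' | Linked n c' c}, wt h t v (f ∘ c') n) (hLW hl))
    obtain ⟨c', hc', hzc⟩ := H.exists_eq_of_mem_iSup_wt hz (fun h1 => hl0 h1) (hAle hl.2)
    obtain ⟨l', hl', hlW, hl0'⟩ := H.exists_mem_wt_of_linked P hc' (Q := (N ⊔ K) ⊓ G) hl
      (wt_congr hzc hz)
      (fun h1 => hl0 h1)
    have hlL : l' ∈ L := H.mem_of_mem_mul_wt P hLW hLJ hLv hl'.2 hlW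
    have : l' ∈ M ⊓ L := ⟨⟨hl'.1, hlW⟩, hlL⟩
    rw [hML] at this
    exact hl0' this
  exact (isSemisimpleModule_iff R R).mpr this

end HC

end

section

variable {R : Type*} [Ring R] [Algebra ℂ R]

/-- The even part of a semisimple superalgebra with an odd involution is semisimple. -/
theorem isSemisimpleRing_of_odd_involution [IsSemisimpleRing R] (A : Subalgebra ℂ R)
    (α : R →ₐ[ℂ] R) {u : R} (hu : u * u = 1) (hαu : α u = -u) (hαA : ∀ a ∈ A, α a = a)
    (hconj : ∀ a ∈ A, u * a * u ∈ A) (htop : ∀ x, ∃ a ∈ A, ∃ b ∈ A, x = a + u * b) :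
    IsSemisimpleRing A := by
  have hswap : ∀ a : R, a * u = u * (u * a * u) := fun a => by
    rw [← mul_assoc, ← mul_assoc, hu, one_mul]
  have : ComplementedLattice (Submodule A A) := by
    refine ⟨fun I => ?_⟩
    have hmul : ∀ a ∈ A, ∀ i ∈ I, ∃ j ∈ I, (j : R) = a * i := fun a ha i hi =>
      ⟨⟨a, ha⟩ * i, I.smul_mem ⟨a, ha⟩ hi, rfl⟩
    let J : Submodule R R :=
      { carrier := {x | ∃ i ∈ I, ∃ j ∈ I, x = i + u * j}
        zero_mem' := ⟨0, I.zero_mem, 0, I.zero_mem, by simp⟩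
        add_mem' := by
          rintro _ _ ⟨i, hi, j, hj, rfl⟩ ⟨i', hi', j', hj', rfl⟩
          refine ⟨i + i', I.add_mem hi hi', j + j', I.add_mem hj hj', ?_⟩
          push_cast
          rw [mul_add]
          abel
        smul_mem' := by
          rintro x _ ⟨i, hi, j, hj, rfl⟩
          obtain ⟨a, ha, b, hb, rfl⟩ := htop x
          obtain ⟨i₁, hi₁, e₁⟩ := hmul a ha i hi
          obtain ⟨i₂, hi₂, e₂⟩ := hmul _ (hconj b hb) j hj
          obtain ⟨j₁, hj₁, e₃⟩ := hmul _ (hconj a ha) j hj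
          obtain ⟨j₂, hj₂, e₄⟩ := hmul b hb i hi
          refine ⟨i₁ + i₂, I.add_mem hi₁ hi₂, j₁ + j₂, I.add_mem hj₁ hj₂, ?_⟩
          push_cast
          rw [smul_eq_mul, e₁, e₂, e₃, e₄]
          simp only [add_mul, mul_add, mul_assoc, mul_mul_of_mul_eq hu, one_mul]
          abel }
    obtain ⟨J', hJ⟩ := exists_isCompl J
    have h1 : (1 : R) ∈ J ⊔ J' := by
      rw [hJ.sup_eq_top]
      trivial
    obtain ⟨_, ⟨e, he, e', he', rfl⟩, d, hd, hed⟩ := Submodule.mem_sup.mp h1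
    have hfix : ∀ i ∈ I, i * e = i := by
      intro i hi
      have hiJ : (i : R) ∈ J := ⟨i, hi, 0, I.zero_mem, by simp⟩
      have h2 : (i : R) * (e + u * e') ∈ J := J.smul_mem _ ⟨e, he, e', he', rfl⟩
      have h3 : (i : R) * d = i - i * (e + u * e') := by
        rw [eq_sub_of_add_eq' hed, mul_sub, mul_one]
      have h4 : (i : R) * d = 0 := Submodule.disjoint_def.mp hJ.disjoint _
        (h3 ▸ J.sub_mem hiJ h2) (J'.smul_mem _ hd)
      rw [h4, mul_add, ← mul_assoc, hswap, mul_assoc] at h3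
      obtain ⟨b, hb, h5⟩ : ∃ b ∈ A, u * b = i - i * e :=
        ⟨(u * i * u) * e', mul_mem (hconj _ i.2) e'.2, by
          rw [eq_comm, ← sub_eq_zero, sub_sub]
          exact h3.symm⟩
      have h6 := congrArg α h5
      rw [map_mul, hαu, hαA b hb, hαA _ (sub_mem i.2 (mul_mem i.2 e.2)), neg_mul, h5] at h6
      have h7 : (i : R) - i * e = 0 := eq_zero_of_eq_neg h6.symm
      exact Subtype.ext (sub_eq_zero.mp h7).symm
    refine ⟨LinearMap.ker (LinearMap.toSpanSingleton A A e), ?_, ?_⟩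
    · refine Submodule.disjoint_def.mpr fun x hx hx' => ?_
      rw [← hfix x hx]
      exact hx'
    · rw [codisjoint_iff, eq_top_iff]
      intro x _
      have h2 : x * e ∈ I := I.smul_mem x he
      rw [← add_sub_cancel (x * e) x]
      refine Submodule.add_mem_sup h2 ?_
      show (x - x * e) * e = 0
      rw [sub_mul, hfix _ h2, sub_self]
  exact (isSemisimpleModule_iff A A).mpr this

end

section

variable {R : Type*} [Ring R] [Algebra ℂ R] {h : ℂ} {n : ℕ} {t v : ℕ → R} {f : ℕ → ℂ}

namespace HC

variable (H : HC h n t v)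
include H

theorem isSemisimpleRing_even [IsSemisimpleRing R] (hn : 0 < n) (htop : hcAdjoin t v n n = ⊤)
    {A : Subalgebra ℂ R} (htA : ∀ i, i + 1 < n → t i ∈ A)
    (hvA : ∀ i, i + 1 < n → v i * v (i + 1) ∈ A)
    (hA : A ≤ Algebra.adjoin ℂ ({x | ∃ i, i + 1 < n ∧ x = t i} ∪
      {x | ∃ i, i + 1 < n ∧ x = v i * v (i + 1)}))
    (α : R →ₐ[ℂ] R) (hαt : ∀ i, i + 1 < n → α (t i) = t i) (hαv : ∀ i < n, α (v i) = -v i) :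
    IsSemisimpleRing A := by
  have h0v : ∀ j < n, v 0 * v j ∈ A := by
    intro j hj
    induction j with
    | zero =>
      rw [H.vsq 0 hn]
      exact one_mem A
    | succ j ih =>
      have h1 : v 0 * v (j + 1) = v 0 * v j * (v j * v (j + 1)) := by
        rw [mul_assoc, mul_mul_of_mul_eq (H.vsq j (by omega)), one_mul]
      rw [h1]
      exact mul_mem (ih (by omega)) (hvA j hj)
  have hv0 : ∀ j < n, v j * v 0 ∈ A := by
    intro j hj
    by_cases h1 : j = 0
    · subst h1
      exact h0v 0 hn
    · rw [H.vanti j 0 hj hn h1]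
      exact neg_mem (h0v j hj)
  have hconj : ∀ a ∈ A, v 0 * a * v 0 ∈ A := by
    intro a ha
    replace ha := hA ha
    induction ha using Algebra.adjoin_induction with
    | mem x hx =>
      rcases hx with ⟨i, hi, rfl⟩ | ⟨i, hi, rfl⟩
      · by_cases h1 : i = 0
        · subst h1
          rw [mul_assoc, H.tv 0 hi, ← mul_assoc]
          exact mul_mem (hvA 0 hi) (htA 0 hi)
        · rw [mul_assoc, H.tvcomm i 0 hi hn (by omega) (by omega), ← mul_assoc, H.vsq 0 hn,
            one_mul]
          exact htA i hi
      · rw [← mul_assoc, mul_assoc]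
        exact mul_mem (h0v i (by omega)) (hv0 (i + 1) hi)
    | algebraMap r =>
      rw [← Algebra.commutes, mul_assoc, H.vsq 0 hn, mul_one]
      exact A.algebraMap_mem r
    | add x y _ _ h1 h2 =>
      rw [mul_add, add_mul]
      exact add_mem h1 h2
    | mul x y _ _ h1 h2 =>
      have h3 : v 0 * (x * y) * v 0 = v 0 * x * v 0 * (v 0 * y * v 0) := by
        simp only [mul_assoc, mul_mul_of_mul_eq (H.vsq 0 hn), one_mul]
      rw [h3]
      exact mul_mem h1 h2
  refine isSemisimpleRing_of_odd_involution A α (H.vsq 0 hn) (hαv 0 hn) (fun a ha => ?_) hconj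
    fun x => ?_
  · replace ha := hA ha
    induction ha using Algebra.adjoin_induction with
    | mem x hx =>
      rcases hx with ⟨i, hi, rfl⟩ | ⟨i, hi, rfl⟩
      · exact hαt i hi
      · rw [map_mul, hαv i (by omega), hαv _ hi, neg_mul_neg]
    | algebraMap r => exact α.commutes r
    | add x y _ _ h1 h2 => rw [map_add, h1, h2]
    | mul x y _ _ h1 h2 => rw [map_mul, h1, h2]
  · let Q : Submodule ℂ R := Subalgebra.toSubmodule A ⊔
      (Subalgebra.toSubmodule A).map (LinearMap.mulLeft ℂ (v 0))
    have hQ : ∀ a ∈ A, ∀ b ∈ A, a + v 0 * b ∈ Q := fun a ha b hb =>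
      Submodule.add_mem_sup ha ⟨b, hb, rfl⟩
    have hQ' : ∀ x ∈ Q, ∃ a ∈ A, ∃ b ∈ A, x = a + v 0 * b := by
      intro x hx
      obtain ⟨a, ha, _, ⟨b, hb, rfl⟩, rfl⟩ := Submodule.mem_sup.mp hx
      exact ⟨a, ha, b, hb, rfl⟩
    have h1 : (1 : R) ∈ Q := Submodule.mem_sup_left (one_mem A)
    have hx : x ∈ hcAdjoin t v n n := htop ▸ Algebra.mem_top
    have h2 := mul_mem_of_mem_hcAdjoin (Q := Q) (fun i hi q hq => ?_) (fun j hj q hq => ?_) hx 1 h1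
    · rw [mul_one] at h2
      exact hQ' x h2
    · obtain ⟨a, ha, b, hb, rfl⟩ := hQ' q hq
      have h3 : t i * (a + v 0 * b) = t i * a + v 0 * (v 0 * t i * v 0 * b) := by
        simp only [mul_add, mul_assoc, mul_mul_of_mul_eq (H.vsq 0 hn), one_mul]
      rw [h3]
      exact hQ _ (mul_mem (htA i hi) ha) _ (mul_mem (hconj _ (htA i hi)) hb)
    · obtain ⟨a, ha, b, hb, rfl⟩ := hQ' q hq
      have h3 : v j * (a + v 0 * b) = v j * v 0 * b + v 0 * (v 0 * v j * a) := by
        simp only [mul_add, mul_assoc, mul_mul_of_mul_eq (H.vsq 0 hn), one_mul]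
        rw [add_comm]
      rw [h3]
      exact hQ _ (mul_mem (hv0 j hj) hb) _ (mul_mem (h0v j hj) ha)

end HC

end

/-- The generators `t_i` indexed by natural numbers. -/
def hcT (q : ℂ) (n : ℕ) (i : ℕ) : HeckeClifford q n := if h : i < n - 1 then HCt q n ⟨i, h⟩ else 0

/-- The generators `v_j` indexed by natural numbers. -/
def hcV (q : ℂ) (n : ℕ) (j : ℕ) : HeckeClifford q n := if h : j < n then HCv q n ⟨j, h⟩ else 0

section

variable {q : ℂ} {n : ℕ}

theorem hcT_eq {i : ℕ} (hi : i + 1 < n) : hcT q n i = HCt q n ⟨i, by omega⟩ :=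
  dif_pos (by omega)

theorem hcV_eq {j : ℕ} (hj : j < n) : hcV q n j = HCv q n ⟨j, hj⟩ := dif_pos hj

theorem hcT_val (i : Fin (n - 1)) : hcT q n i = HCt q n i := dif_pos i.2

theorem hcV_val (j : Fin n) : hcV q n j = HCv q n j := dif_pos j.2

theorem hc_heckeClifford (q : ℂ) (n : ℕ) : HC (q - q⁻¹) n (hcT q n) (hcV q n) where
  braid i hi := by
    rw [hcT_eq (by omega), hcT_eq (by omega)]
    simpa [HCt] using RingQuot.mkAlgHom_rel ℂ (HCrel.braid (q := q) (n := n)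
      ⟨i, by omega⟩ ⟨i + 1, by omega⟩ rfl)
  tcomm i j hij hj := by
    rw [hcT_eq (by omega), hcT_eq hj]
    simpa [HCt] using RingQuot.mkAlgHom_rel ℂ (HCrel.tcomm (q := q) (n := n)
      ⟨i, by omega⟩ ⟨j, by omega⟩ (Or.inl hij))
  quad i hi := by
    rw [hcT_eq hi]
    simpa [HCt] using RingQuot.mkAlgHom_rel ℂ (HCrel.quad (q := q) (n := n) ⟨i, by omega⟩)
  vsq j hj := by
    rw [hcV_eq hj]
    simpa [HCv] using RingQuot.mkAlgHom_rel ℂ (HCrel.vsq (q := q) (n := n) ⟨j, hj⟩)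
  vanti i j hi hj hij := by
    rw [hcV_eq hj, hcV_eq hi]
    simpa [HCv] using RingQuot.mkAlgHom_rel ℂ (HCrel.vanti (q := q) (n := n) ⟨i, hi⟩ ⟨j, hj⟩
      (by simpa using hij))
  tv i hi := by
    rw [hcT_eq hi, hcV_eq hi, hcV_eq (Nat.lt_of_succ_lt hi)]
    simpa [HCt, HCv] using RingQuot.mkAlgHom_rel ℂ (HCrel.tv₁ (q := q) (n := n) ⟨i, by omega⟩
      ⟨i, by omega⟩ ⟨i + 1, hi⟩ rfl rfl)
  tw i hi := by
    rw [hcT_eq hi, hcV_eq hi, hcV_eq (Nat.lt_of_succ_lt hi)]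
    have := RingQuot.mkAlgHom_rel ℂ (HCrel.tv₂ (q := q) (n := n) ⟨i, by omega⟩
      ⟨i, by omega⟩ ⟨i + 1, hi⟩ rfl rfl)
    rwa [map_mul, map_sub, map_mul, map_smul, map_sub] at this
  tvcomm i l hi hl h1 h2 := by
    rw [hcT_eq hi, hcV_eq hl]
    simpa [HCt, HCv] using RingQuot.mkAlgHom_rel ℂ (HCrel.tvcomm (q := q) (n := n)
      ⟨i, by omega⟩ ⟨l, hl⟩ ⟨h1, h2⟩)

theorem hcAdjoin_heckeClifford (q : ℂ) (n : ℕ) : hcAdjoin (hcT q n) (hcV q n) n n = ⊤ := by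
  rw [eq_top_iff]
  rintro x -
  obtain ⟨y, rfl⟩ := RingQuot.mkAlgHom_surjective ℂ (HCrel q n) x
  induction y using FreeAlgebra.induction with
  | grade0 r =>
    rw [AlgHom.commutes]
    exact Subalgebra.algebraMap_mem _ r
  | grade1 x =>
    rcases x with i | j
    · rw [show RingQuot.mkAlgHom ℂ (HCrel q n) (FreeAlgebra.ι ℂ (Sum.inl i)) = hcT q n i from
        (hcT_val i).symm]
      exact t_mem_hcAdjoin (by omega)
    · rw [show RingQuot.mkAlgHom ℂ (HCrel q n) (FreeAlgebra.ι ℂ (Sum.inr j)) = hcV q n j from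
        (hcV_val j).symm]
      exact v_mem_hcAdjoin j.2
  | mul a b h1 h2 =>
    rw [map_mul]
    exact mul_mem h1 h2
  | add a b h1 h2 =>
    rw [map_add]
    exact add_mem h1 h2

theorem exists_parity_lift {R : Type*} [Ring R] [Algebra ℂ R]
    (φ : FreeAlgebra ℂ (HCgen n) →ₐ[ℂ] R) (hφ : ∀ x y, HCrel q n x y → φ x = φ y) :
    ∃ β : FreeAlgebra ℂ (HCgen n) →ₐ[ℂ] R, (∀ i, β (tF n i) = φ (tF n i)) ∧
      (∀ j, β (vF n j) = -φ (vF n j)) ∧ ∀ ⦃x y⦄, HCrel q n x y → β x = β y := by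
  let β : FreeAlgebra ℂ (HCgen n) →ₐ[ℂ] R :=
    FreeAlgebra.lift ℂ (Sum.elim (fun i => φ (tF n i)) fun j => -φ (vF n j))
  have hβt : ∀ i, β (tF n i) = φ (tF n i) := fun i => by simp [β, tF]
  have hβv : ∀ j, β (vF n j) = -φ (vF n j) := fun j => by simp [β, vF]
  refine ⟨β, hβt, hβv, fun x y hxy => ?_⟩
  have h1 := hφ x y hxy
  cases hxy <;> simp only [map_mul, map_add, map_sub, map_neg, map_smul, map_one, hβt, hβv,
    mul_neg, neg_mul, neg_neg] at h1 ⊢ <;> rw [h1]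
  module

/-- The parity automorphism exists. -/
theorem exists_parity (q : ℂ) (n : ℕ) : ∃ α : HeckeClifford q n →ₐ[ℂ] HeckeClifford q n,
    (∀ i, α (HCt q n i) = HCt q n i) ∧ ∀ j, α (HCv q n j) = -HCv q n j := by
  obtain ⟨β, hβt, hβv, hβ⟩ := exists_parity_lift (q := q) (RingQuot.mkAlgHom ℂ (HCrel q n))
    fun _ _ => RingQuot.mkAlgHom_rel ℂ
  refine ⟨RingQuot.liftAlgHom ℂ ⟨β, hβ⟩, fun i => ?_, fun j => ?_⟩
  · rw [HCt, RingQuot.liftAlgHom_mkAlgHom_apply]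
    exact hβt i
  · rw [HCv, RingQuot.liftAlgHom_mkAlgHom_apply]
    exact hβv j

end

/-- if `q` is a primitive `4N`-th root of unity (`N ≥ 2`), then for every
`n` with `2 ≤ n < N` both `G_n(q)` and its even subalgebra `G_n[0]` are semisimple. -/
theorem heckeClifford_semisimple_of_primitiveRoot
    (N : ℕ) (hN : 2 ≤ N) (q : ℂ) (hq : IsPrimitiveRoot q (4 * N))
    (n : ℕ) (hn : 2 ≤ n) (hnN : n < N) :
    IsSemisimpleRing (HeckeClifford q n) ∧ IsSemisimpleRing (HCeven q n) := by
  have H := hc_heckeClifford q n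
  have htop := hcAdjoin_heckeClifford q n
  have hss : IsSemisimpleRing (HeckeClifford q n) :=
    H.isSemisimpleRing (goodParams_of_isPrimitiveRoot hN hq hnN) htop
  obtain ⟨α, hαt, hαv⟩ := exists_parity q n
  have he : ∀ i (hi : i + 1 < n), hcV q n i * hcV q n (i + 1) = HCe q n ⟨i, by omega⟩ :=
    fun i hi => by
      rw [hcV_eq hi, hcV_eq (Nat.lt_of_succ_lt hi)]
      rfl
  refine ⟨hss, H.isSemisimpleRing_even (by omega) htop (fun i hi => ?_) (fun i hi => ?_) ?_ α
    (fun i hi => ?_) fun i hi => ?_⟩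
  · rw [hcT_eq hi]
    exact Algebra.subset_adjoin (Or.inl ⟨_, rfl⟩)
  · rw [he i hi]
    exact Algebra.subset_adjoin (Or.inr ⟨_, rfl⟩)
  · refine Algebra.adjoin_mono (Set.union_subset_union ?_ ?_)
    · rintro _ ⟨i, rfl⟩
      exact ⟨i, by omega, (hcT_val i).symm⟩
    · rintro _ ⟨i, rfl⟩
      exact ⟨i, by omega, (he i (by omega)).symm⟩
  · rw [hcT_eq hi, hαt]
  · rw [hcV_eq hi, hαv]
end

section
/- Let q ∈ ℂ with q ≠ 0 and q^4 ≠ 1, let a, b ∈ ℤ, and let x, y ∈ ℂ be nonzero with x + x^{−1} = 2{a} and y + y^{−1} = 2{b}. Assume xy ≠ 1, xy^{−1} ≠ 1, [a+b+1] ≠ 0 and [a−b] ≠ 0. Then 1 − (q − q^{−1})^2 · ( xy^{−1}/( xy^{−1} − 1)^2 + xy/( xy − 1)^2 ) = [a+b+2][a+b][a−b+1][a−b−1] / ( [a+b+1]^2 [a−b]^2 ). In particular this quantity is unchanged if x is replaced by x^{−1} or y by y^{−1}. -/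
noncomputable section

/-- The quantum integer `[k] = [k]_q = (q^k - q^{-k})/(q - q⁻¹)`. -/
def qnum (q : ℂ) (k : ℤ) : ℂ := (q ^ k - q ^ (-k)) / (q - q⁻¹)

/-- The quantum integer at `q²`: `[k]_{q²} = (q^{2k} - q^{-2k})/(q² - q^{-2})`. -/
def qnum2 (q : ℂ) (k : ℤ) : ℂ := (q ^ (2 * k) - q ^ (-(2 * k))) / (q ^ 2 - q⁻¹ ^ 2)

/-- The quantity `{m} = (q^{2m+1} + q^{-2m-1})/(q + q⁻¹)`. -/
def qbrace (q : ℂ) (m : ℤ) : ℂ := (q ^ (2 * m + 1) + q ^ (-(2 * m + 1))) / (q + q⁻¹)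

end

noncomputable section
/-- The quantity `β` of Jones–Nazarov, as a function of `q`, `x = q_k`, `y = q_{k+1}`. -/
def betaExpr (q x y : ℂ) : ℂ :=
  1 - (q - q⁻¹) ^ 2 * (x * y⁻¹ / (x * y⁻¹ - 1) ^ 2 + x * y / (x * y - 1) ^ 2)
end

theorem betaExpr_eq_of_ne (q : ℂ) {x y : ℂ} (hx : x ≠ 0) (hy : y ≠ 0)
    (hxy : x * y ≠ 1) (hxy' : x * y⁻¹ ≠ 1) :
    betaExpr q x y =
      1 - (q - q⁻¹) ^ 2 * (((x + x⁻¹) * (y + y⁻¹) - 4) / (x + x⁻¹ - (y + y⁻¹)) ^ 2) := by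
  have h₁ : x * y - 1 ≠ 0 := sub_ne_zero.mpr hxy
  have h₂ : x - y ≠ 0 := by
    intro h
    rw [sub_eq_zero.mp h] at hxy'
    exact hxy' (mul_inv_cancel₀ hy)
  have h₃ : x * y⁻¹ - 1 = (x - y) / y := by field_simp
  have h₄ : x + x⁻¹ - (y + y⁻¹) = (x - y) * (x * y - 1) / (x * y) := by
    field_simp
    ring
  rw [betaExpr, h₃, h₄]
  congr 2
  field_simp
  ring

/-- The closed form in terms of the powers `C = q ^ (a + b + 1)` and `D = q ^ (a - b)`. -/
theorem one_sub_eq_div_of_ne {q C D : ℂ} (hq : q ≠ 0) (hC : C ≠ 0) (hD : D ≠ 0)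
    (hm : q - q⁻¹ ≠ 0) (hp : q + q⁻¹ ≠ 0) (hC' : C - C⁻¹ ≠ 0) (hD' : D - D⁻¹ ≠ 0) :
    1 - (q - q⁻¹) ^ 2 *
        ((2 * ((C * D + (C * D)⁻¹) / (q + q⁻¹)) * (2 * ((C / D + (C / D)⁻¹) / (q + q⁻¹))) - 4) /
          (2 * ((C * D + (C * D)⁻¹) / (q + q⁻¹)) - 2 * ((C / D + (C / D)⁻¹) / (q + q⁻¹))) ^ 2) =
      (C * q - (C * q)⁻¹) / (q - q⁻¹) * ((C / q - (C / q)⁻¹) / (q - q⁻¹)) *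
          ((D * q - (D * q)⁻¹) / (q - q⁻¹)) * ((D / q - (D / q)⁻¹) / (q - q⁻¹)) /
        (((C - C⁻¹) / (q - q⁻¹)) ^ 2 * ((D - D⁻¹) / (q - q⁻¹)) ^ 2) := by
  have hden : 2 * ((C * D + (C * D)⁻¹) / (q + q⁻¹)) - 2 * ((C / D + (C / D)⁻¹) / (q + q⁻¹)) =
      2 * ((C - C⁻¹) * (D - D⁻¹)) / (q + q⁻¹) := by
    field_simp
    ring
  have hnum : 2 * ((C * D + (C * D)⁻¹) / (q + q⁻¹)) *
        (2 * ((C / D + (C / D)⁻¹) / (q + q⁻¹))) - 4 =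
      4 * ((C * D + (C * D)⁻¹) * (C / D + (C / D)⁻¹) - (q + q⁻¹) ^ 2) / (q + q⁻¹) ^ 2 := by
    generalize q + q⁻¹ = p at hp ⊢
    field_simp
    ring
  have hprod : (C * q - (C * q)⁻¹) * (C / q - (C / q)⁻¹) * (D * q - (D * q)⁻¹) *
        (D / q - (D / q)⁻¹) =
      (C - C⁻¹) ^ 2 * (D - D⁻¹) ^ 2 -
        (q - q⁻¹) ^ 2 * ((C * D + (C * D)⁻¹) * (C / D + (C / D)⁻¹) - (q + q⁻¹) ^ 2) := by
    field_simp
    ring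
  have hrhs (s t u v c d m : ℂ) (hm : m ≠ 0) (hc : c ≠ 0) (hd : d ≠ 0) :
      s / m * (t / m) * (u / m) * (v / m) / ((c / m) ^ 2 * (d / m) ^ 2) =
        s * t * u * v / (c ^ 2 * d ^ 2) := by
    field_simp
  rw [hden, hnum, hrhs _ _ _ _ _ _ _ hm hC' hD', hprod]
  generalize (C * D + (C * D)⁻¹) * (C / D + (C / D)⁻¹) - (q + q⁻¹) ^ 2 = N
  generalize q + q⁻¹ = p at hp ⊢
  generalize q - q⁻¹ = m
  generalize C - C⁻¹ = c at hC' ⊢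
  generalize D - D⁻¹ = d at hD' ⊢
  field_simp
  ring

/-- explicit formula for `β` in terms of quantum integers, and its
invariance under `x ↦ x⁻¹` and `y ↦ y⁻¹`. -/
theorem betaExpr_eq_qnum (q : ℂ) (hq0 : q ≠ 0) (hq4 : q ^ 4 ≠ 1) (a b : ℤ) (x y : ℂ)
    (hx0 : x ≠ 0) (hy0 : y ≠ 0)
    (hx : x + x⁻¹ = 2 * qbrace q a) (hy : y + y⁻¹ = 2 * qbrace q b)
    (hxy : x * y ≠ 1) (hxy' : x * y⁻¹ ≠ 1)
    (h1 : qnum q (a + b + 1) ≠ 0) (h2 : qnum q (a - b) ≠ 0) :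
    betaExpr q x y =
      qnum q (a + b + 2) * qnum q (a + b) * qnum q (a - b + 1) * qnum q (a - b - 1) /
        (qnum q (a + b + 1) ^ 2 * qnum q (a - b) ^ 2) ∧
    betaExpr q x⁻¹ y = betaExpr q x y ∧
    betaExpr q x y⁻¹ = betaExpr q x y := by
  have hyx : x⁻¹ * y ≠ 1 := by
    rw [← inv_ne_one]
    simpa [mul_comm] using hxy'
  have hyx' : x⁻¹ * y⁻¹ ≠ 1 := by
    rwa [← mul_inv, inv_ne_one]
  have hβ := betaExpr_eq_of_ne q hx0 hy0 hxy hxy'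
  refine ⟨?_, ?_, ?_⟩
  · have hm : q - q⁻¹ ≠ 0 := by
      intro h
      simp [qnum, h] at h2
    have hp : q + q⁻¹ ≠ 0 := by
      intro h
      apply hq4
      field_simp at h
      linear_combination (q ^ 2 - 1) * h
    have hC' : q ^ (a + b + 1) - (q ^ (a + b + 1))⁻¹ ≠ 0 := by
      intro h
      simp only [qnum, zpow_neg, h, zero_div, ne_eq, not_true_eq_false] at h1
    have hD' : q ^ (a - b) - (q ^ (a - b))⁻¹ ≠ 0 := by
      intro h
      simp only [qnum, zpow_neg, h, zero_div, ne_eq, not_true_eq_false] at h2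
    have e₁ : q ^ (2 * a + 1) = q ^ (a + b + 1) * q ^ (a - b) := by
      rw [← zpow_add₀ hq0]; ring_nf
    have e₂ : q ^ (2 * b + 1) = q ^ (a + b + 1) / q ^ (a - b) := by
      rw [← zpow_sub₀ hq0]; ring_nf
    have e₃ : q ^ (a + b + 2) = q ^ (a + b + 1) * q := by
      rw [← zpow_add_one₀ hq0]; ring_nf
    have e₄ : q ^ (a + b) = q ^ (a + b + 1) / q := by
      rw [zpow_add_one₀ hq0, mul_div_cancel_right₀ _ hq0]
    have e₅ : q ^ (a - b + 1) = q ^ (a - b) * q := zpow_add_one₀ hq0 _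
    have e₆ : q ^ (a - b - 1) = q ^ (a - b) / q := by
      rw [zpow_sub_one₀ hq0, div_eq_mul_inv]
    rw [hβ, hx, hy]
    simp only [qbrace, qnum, zpow_neg]
    rw [e₁, e₂, e₃, e₄, e₅, e₆]
    exact one_sub_eq_div_of_ne hq0 (zpow_ne_zero _ hq0) (zpow_ne_zero _ hq0) hm hp hC' hD'
  · rw [hβ, betaExpr_eq_of_ne q (inv_ne_zero hx0) hy0 hyx hyx', inv_inv, add_comm x⁻¹ x]
  · rw [hβ, betaExpr_eq_of_ne q hx0 (inv_ne_zero hy0) hxy' (by rwa [inv_inv]), inv_inv,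
      add_comm y⁻¹ y]
end

section
/- Let N ≥ 2 and let q ∈ ℂ be a primitive 4N-th root of unity. If a and b are distinct integers with 0 ≤ a, b ≤ N and {a, b} ≠ {N−1, N}, then {a} ≠ {b}. -/
theorem zpow_add_zpow_neg_eq_iff {K : Type*} [Field K] {q : K} (hq : q ≠ 0) (x y : ℤ) :
    q ^ x + q ^ (-x) = q ^ y + q ^ (-y) ↔ q ^ (x - y) = 1 ∨ q ^ (x + y) = 1 := by
  have factor : q ^ x + q ^ (-x) - (q ^ y + q ^ (-y)) =
      q ^ (-x) * ((q ^ (x - y) - 1) * (q ^ (x + y) - 1)) := by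
    rw [zpow_neg, zpow_neg, zpow_sub₀ hq, zpow_add₀ hq]
    field_simp
    ring
  rw [← sub_eq_zero, factor, mul_eq_zero, mul_eq_zero, sub_eq_zero, sub_eq_zero]
  simp [zpow_ne_zero, hq]

theorem IsPrimitiveRoot.add_inv_ne_zero {K : Type*} [Field K] {q : K} {n : ℕ}
    (hq : IsPrimitiveRoot q n) (hq0 : q ≠ 0) (hn : ¬n ∣ 4) : q + q⁻¹ ≠ 0 := by
  intro h
  field_simp at h
  exact hn (hq.dvd_of_pow_eq_one 4 (by linear_combination (q ^ 2 - 1) * h))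

/-- for `q` a primitive `4N`-th root of unity (`N ≥ 2`) and distinct
integers `0 ≤ a, b ≤ N` with `{a, b} ≠ {N-1, N}`, one has `{a} ≠ {b}`. -/
theorem qbrace_injective_at_primitive_root (N : ℕ) (hN : 2 ≤ N) (q : ℂ)
    (hq : IsPrimitiveRoot q (4 * N)) (a b : ℤ) (hab : a ≠ b)
    (ha0 : 0 ≤ a) (haN : a ≤ (N : ℤ)) (hb0 : 0 ≤ b) (hbN : b ≤ (N : ℤ))
    (hne : ¬((a = (N : ℤ) - 1 ∧ b = (N : ℤ)) ∨ (a = (N : ℤ) ∧ b = (N : ℤ) - 1))) :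
    qbrace q a ≠ qbrace q b := by
  have hq0 : q ≠ 0 := hq.ne_zero (by omega)
  have h4 : ¬4 * N ∣ 4 := fun h => by
    have := Nat.le_of_dvd (by norm_num) h
    omega
  have hden := hq.add_inv_ne_zero hq0 h4
  rw [qbrace, qbrace, Ne, div_left_inj' hden, zpow_add_zpow_neg_eq_iff hq0,
    hq.zpow_eq_one_iff_dvd, hq.zpow_eq_one_iff_dvd]
  push_cast
  rintro (h | h)
  · have := Int.eq_zero_of_abs_lt_dvd h (by rw [abs_lt]; constructor <;> omega)
    omega
  · have := Int.le_of_dvd (by omega) h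
    omega
end

section
/- Let q ∈ ℂ be nonzero and not a root of unity. For integers a > b ≥ 0 set q_{(a,b)} := q_{(a)} · q_{(b)} · [a−b]/[a+b] (interpreting q_{(a,0)} = q_{(a)}). Then for all integers λ₁ > λ₂ ≥ 1 one has q_{(λ₁,λ₂)} = q_{(λ₁)} q_{(λ₂)} − q_{(λ₁+1)} q_{(λ₂−1)} − q_{(λ₁+1, λ₂−1)}. -/
noncomputable section

/-- The one-row quantity `q_{(m)} = ∏_{j=1}^m i (q^{j-1} + q^{1-j})/(q^j - q^{-j})`. -/
def qrow (q : ℂ) (m : ℕ) : ℂ :=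
  ∏ j ∈ Finset.Icc 1 m,
    Complex.I * (q ^ ((j : ℤ) - 1) + q ^ (1 - (j : ℤ))) / (q ^ (j : ℤ) - q ^ (-(j : ℤ)))

/-- The quantity `q_λ` attached to a strict partition `λ = (λ₁ > … > λ_r > 0)`
(given as a function `Fin r → ℕ`):
`q_λ = ∏_j q_{(λ_j)} ∏_{i<j} [λ_i - λ_j]/[λ_i + λ_j]`. -/
def qpart (q : ℂ) {r : ℕ} (lam : Fin r → ℕ) : ℂ :=
  (∏ j, qrow q (lam j)) *
    ∏ p ∈ Finset.univ.filter (fun p : Fin r × Fin r => p.1 < p.2),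
      qnum q ((lam p.1 : ℤ) - (lam p.2 : ℤ)) / qnum q ((lam p.1 : ℤ) + (lam p.2 : ℤ))

end

noncomputable section
/-- The two-row quantity `q_{(a,b)} = q_{(a)} q_{(b)} [a-b]/[a+b]`, interpreted as
`q_{(a)}` when `b = 0`. -/
def qpairRow (q : ℂ) (a b : ℕ) : ℂ :=
  if b = 0 then qrow q a
  else qrow q a * qrow q b * (qnum q ((a : ℤ) - (b : ℤ)) / qnum q ((a : ℤ) + (b : ℤ)))
end

theorem zpow_sub_zpow_neg_ne_zero {q : ℂ} (hq0 : q ≠ 0) (hq : ∀ k : ℕ, 0 < k → q ^ k ≠ 1)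
    {n : ℕ} (hn : 0 < n) : q ^ (n : ℤ) - q ^ (-(n : ℤ)) ≠ 0 := by
  intro h
  refine hq (n + n) (by omega) ?_
  rw [sub_eq_zero, zpow_neg, zpow_natCast] at h
  rw [pow_add]
  nth_rewrite 1 [h]
  exact inv_mul_cancel₀ (pow_ne_zero n hq0)

theorem qnum_natCast_ne_zero {q : ℂ} (hq0 : q ≠ 0) (hq : ∀ k : ℕ, 0 < k → q ^ k ≠ 1)
    {n : ℕ} (hn : 0 < n) : qnum q n ≠ 0 := by
  refine div_ne_zero (zpow_sub_zpow_neg_ne_zero hq0 hq hn) ?_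
  simpa using zpow_sub_zpow_neg_ne_zero hq0 hq one_pos

theorem qrow_succ (q : ℂ) (m : ℕ) :
    qrow q (m + 1) = qrow q m *
      (Complex.I * (q ^ (m : ℤ) + q ^ (-(m : ℤ))) /
        (q ^ ((m : ℤ) + 1) - q ^ (-((m : ℤ) + 1)))) := by
  unfold qrow
  rw [Finset.prod_Icc_succ_top (by omega)]
  push_cast
  rw [show (m : ℤ) + 1 - 1 = m by ring, show (1 : ℤ) - (m + 1) = -m by ring]

theorem qpairRow_eq {q : ℂ} (hq0 : q ≠ 0) (hq : ∀ k : ℕ, 0 < k → q ^ k ≠ 1)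
    {a : ℕ} (ha : 0 < a) (b : ℕ) :
    qpairRow q a b =
      qrow q a * qrow q b * (qnum q ((a : ℤ) - (b : ℤ)) / qnum q ((a : ℤ) + (b : ℤ))) := by
  unfold qpairRow
  split_ifs with hb
  · subst hb
    simp [qrow, div_self (qnum_natCast_ne_zero hq0 hq ha)]
  · rfl

theorem qnum_add_sub_qnum_sub {q : ℂ} (hq0 : q ≠ 0) (a b : ℤ) :
    qnum q (a + b) - qnum q (a - b) =
      (q ^ a + q ^ (-a)) * (q ^ b - q ^ (-b)) / (q - q⁻¹) := by
  unfold qnum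
  rw [← sub_div, neg_add, neg_sub, sub_eq_add_neg a b, sub_eq_add_neg b a]
  simp only [zpow_add₀ hq0]
  ring

theorem qnum_add_add_qnum_sub {q : ℂ} (hq0 : q ≠ 0) (a b : ℤ) :
    qnum q (a + b) + qnum q (a - b) =
      (q ^ a - q ^ (-a)) * (q ^ b + q ^ (-b)) / (q - q⁻¹) := by
  unfold qnum
  rw [← add_div, neg_add, neg_sub, sub_eq_add_neg a b, sub_eq_add_neg b a]
  simp only [zpow_add₀ hq0]
  ring

/-- the recursion `q_{(λ₁,λ₂)} = q_{(λ₁)}q_{(λ₂)} - q_{(λ₁+1)}q_{(λ₂-1)}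
- q_{(λ₁+1,λ₂-1)}` for `λ₁ > λ₂ ≥ 1`, when `q` is nonzero and not a root of unity. -/
theorem qpairRow_recursion (q : ℂ) (hq0 : q ≠ 0) (hq : ∀ k : ℕ, 0 < k → q ^ k ≠ 1)
    (l₁ l₂ : ℕ) (h2 : 1 ≤ l₂) (h12 : l₂ < l₁) :
    qpairRow q l₁ l₂ =
      qrow q l₁ * qrow q l₂ - qrow q (l₁ + 1) * qrow q (l₂ - 1)
        - qpairRow q (l₁ + 1) (l₂ - 1) := by
  obtain ⟨b, rfl⟩ : ∃ b, l₂ = b + 1 := ⟨l₂ - 1, by omega⟩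
  have hD := qnum_natCast_ne_zero hq0 hq (n := l₁ + b + 1) (by omega)
  have ha := zpow_sub_zpow_neg_ne_zero hq0 hq (n := l₁ + 1) (by omega)
  have hb := zpow_sub_zpow_neg_ne_zero hq0 hq (n := b + 1) (by omega)
  have hsub := qnum_add_sub_qnum_sub hq0 (l₁ : ℤ) ((b : ℤ) + 1)
  have hadd := qnum_add_add_qnum_sub hq0 ((l₁ : ℤ) + 1) (b : ℤ)
  rw [Nat.add_sub_cancel, qpairRow_eq hq0 hq (by omega), qpairRow_eq hq0 hq (by omega),
    qrow_succ q l₁, qrow_succ q b]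
  push_cast at hD ha hb ⊢
  rw [← add_assoc] at hsub ⊢
  rw [add_right_comm (l₁ : ℤ) 1 b] at hadd ⊢
  generalize qnum q ((l₁ : ℤ) + b + 1) = D at *
  rw [sub_eq_iff_eq_add, ← sub_eq_iff_eq_add'] at hsub
  rw [← eq_sub_iff_add_eq'] at hadd
  rw [hadd, ← hsub]
  field_simp
  ring
end
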